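/- Let S = sgp⟨A | u = v⟩ be the one-relator monoid presented by A = {a_1,…,a_n} with n ≥ 2, where u, v ∈ A^* and |v| ≤ |u| ≤ 3. If the relation u = v is not of the form aba = ba, aab = ba, or abb = bb for some distinct letters a, b ∈ A, then S is prefix-automatic. Moreover, if u = v is of one of the forms aba = ba, aab = ba, or abb = bb for distinct a, b ∈ A, then S is not automatic. -/

import Mathlib

/-!  Common definitions, following the conventions of the paper
"Automaticity of one-relator semigroups with length less than or equal to three".

Words over an alphabet `α` are modelled as `List α`; the empty word is `[]`.
The padded alphabet `A(2,$)` is modelled inside `Option α × Option α`,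
where `none` plays the role of the padding symbol `$` (the pair `(none, none)`
never occurs in a padded convolution). -/

/-- A regular set of words: one accepted by a DFA with finitely many states. -/
abbrev IsReg {α : Type*} (L : Set (List α)) : Prop :=
  Language.IsRegular (L : Language α)

/-- Right-padded convolution `(x,y)δᴿ`: align the two words letter by letter
from the left and pad the shorter one on the right with the padding symbol. -/
def padR {α : Type*} (x y : List α) : List (Option α × Option α) :=
  (x.map some ++ List.replicate (y.length - x.length) none).zip
    (y.map some ++ List.replicate (x.length - y.length) none)

/-- Left-padded convolution `(x,y)δᴸ`: align the two words letter by letter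
from the right and pad the shorter one on the left with the padding symbol. -/
def padL {α : Type*} (x y : List α) : List (Option α × Option α) :=
  (List.replicate (y.length - x.length) none ++ x.map some).zip
    (List.replicate (x.length - y.length) none ++ y.map some)

/-- One elementary rewriting step: replace a factor `u` by `v`
for some defining relation `(u, v) ∈ R` (in either direction via `Relation.EqvGen`). -/
def OneStep {α : Type*} (R : Set (List α × List α)) (x y : List α) : Prop :=
  ∃ p u v s, (u, v) ∈ R ∧ x = p ++ u ++ s ∧ y = p ++ v ++ s

/-- Equality of two words in the semigroup `sgp⁺⟨α ∣ R⟩` (resp. the monoid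
`sgp⟨α ∣ R⟩`): the congruence on words generated by the relations `R`. -/
def WordEq {α : Type*} (R : Set (List α × List α)) : List α → List α → Prop :=
  Relation.EqvGen (OneStep R)

/-- Expansion of a word over an abstract generating set `β` into a word over the
presentation alphabet `α`, where `g b` is a word representing the generator `b`. -/
def expandW {α β : Type*} (g : β → List α) (w : List β) : List α :=
  (w.map g).flatten

/-- `(g, L)` is an automatic structure for the semigroup `sgp⁺⟨α ∣ R⟩` with
respect to the finite generating set indexed by `β`:  each generator `b` is the
element of the semigroup represented by the nonempty word `g b`, the language
`L ⊆ β⁺` is regular and maps onto the semigroup, and `L_ε^$` together with all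
`L_b^$` (right multiplication, right padding) are regular. -/
structure SgpAutoStruct {α β : Type*} (R : Set (List α × List α))
    (g : β → List α) (L : Set (List β)) : Prop where
  gen_ne : ∀ b, g b ≠ []
  reg : IsReg L
  ne : ∀ w ∈ L, w ≠ []
  onto : ∀ w : List α, w ≠ [] → ∃ x ∈ L, WordEq R (expandW g x) w
  eq_reg : IsReg {p | ∃ x ∈ L, ∃ y ∈ L,
      WordEq R (expandW g x) (expandW g y) ∧ p = padR x y}
  mul_reg : ∀ b : β, IsReg {p | ∃ x ∈ L, ∃ y ∈ L,
      WordEq R (expandW g x ++ g b) (expandW g y) ∧ p = padR x y}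

/-- A prefix-automatic structure for `sgp⁺⟨α ∣ R⟩`: an automatic structure for
which moreover `L'_= = {(x,y)δᴿ : x ∈ L, y ∈ Pref(L), x = y in S}` is regular. -/
structure SgpPrefixAutoStruct {α β : Type*} (R : Set (List α × List α))
    (g : β → List α) (L : Set (List β)) extends SgpAutoStruct R g L : Prop where
  pre_reg : IsReg {p | ∃ x ∈ L, ∃ y : List β, (∃ z ∈ L, y <+: z) ∧
      WordEq R (expandW g x) (expandW g y) ∧ p = padR x y}

/-- A biautomatic structure for the semigroup `sgp⁺⟨α ∣ R⟩`: the languages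
`L_b^$`, `_bL^$`, `^$L_b` and `_b^$L` are regular for every `b ∈ β ∪ {ε}`. -/
structure SgpBiautoStruct {α β : Type*} (R : Set (List α × List α))
    (g : β → List α) (L : Set (List β)) : Prop where
  gen_ne : ∀ b, g b ≠ []
  reg : IsReg L
  ne : ∀ w ∈ L, w ≠ []
  onto : ∀ w : List α, w ≠ [] → ∃ x ∈ L, WordEq R (expandW g x) w
  eqR_reg : IsReg {p | ∃ x ∈ L, ∃ y ∈ L,
      WordEq R (expandW g x) (expandW g y) ∧ p = padR x y}
  eqL_reg : IsReg {p | ∃ x ∈ L, ∃ y ∈ L,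
      WordEq R (expandW g x) (expandW g y) ∧ p = padL x y}
  mulRR_reg : ∀ b : β, IsReg {p | ∃ x ∈ L, ∃ y ∈ L,
      WordEq R (expandW g x ++ g b) (expandW g y) ∧ p = padR x y}
  mulLR_reg : ∀ b : β, IsReg {p | ∃ x ∈ L, ∃ y ∈ L,
      WordEq R (g b ++ expandW g x) (expandW g y) ∧ p = padR x y}
  mulRL_reg : ∀ b : β, IsReg {p | ∃ x ∈ L, ∃ y ∈ L,
      WordEq R (expandW g x ++ g b) (expandW g y) ∧ p = padL x y}
  mulLL_reg : ∀ b : β, IsReg {p | ∃ x ∈ L, ∃ y ∈ L,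
      WordEq R (g b ++ expandW g x) (expandW g y) ∧ p = padL x y}

/-- The semigroup `sgp⁺⟨α ∣ R⟩` is automatic: it admits an automatic structure
over some finite generating set. -/
def SgpAutomatic {α : Type*} (R : Set (List α × List α)) : Prop :=
  ∃ (β : Type) (_ : Fintype β) (g : β → List α) (L : Set (List β)),
    SgpAutoStruct R g L

/-- The semigroup `sgp⁺⟨α ∣ R⟩` is prefix-automatic. -/
def SgpPrefixAutomatic {α : Type*} (R : Set (List α × List α)) : Prop :=
  ∃ (β : Type) (_ : Fintype β) (g : β → List α) (L : Set (List β)),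
    SgpPrefixAutoStruct R g L

/-- The semigroup `sgp⁺⟨α ∣ R⟩` is biautomatic. -/
def SgpBiautomatic {α : Type*} (R : Set (List α × List α)) : Prop :=
  ∃ (β : Type) (_ : Fintype β) (g : β → List α) (L : Set (List β)),
    SgpBiautoStruct R g L

/-- `(g, L)` is an automatic structure for the monoid `sgp⟨α ∣ R⟩` with respect
to a finite generating set indexed by `β`; generators may represent any element
of the monoid (in particular the identity, represented by the empty word). -/
structure MonAutoStruct {α β : Type*} (R : Set (List α × List α))
    (g : β → List α) (L : Set (List β)) : Prop where
  reg : IsReg L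
  ne : ∀ w ∈ L, w ≠ []
  onto : ∀ w : List α, ∃ x ∈ L, WordEq R (expandW g x) w
  eq_reg : IsReg {p | ∃ x ∈ L, ∃ y ∈ L,
      WordEq R (expandW g x) (expandW g y) ∧ p = padR x y}
  mul_reg : ∀ b : β, IsReg {p | ∃ x ∈ L, ∃ y ∈ L,
      WordEq R (expandW g x ++ g b) (expandW g y) ∧ p = padR x y}

/-- A prefix-automatic structure for the monoid `sgp⟨α ∣ R⟩`. -/
structure MonPrefixAutoStruct {α β : Type*} (R : Set (List α × List α))
    (g : β → List α) (L : Set (List β)) extends MonAutoStruct R g L : Prop where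
  pre_reg : IsReg {p | ∃ x ∈ L, ∃ y : List β, (∃ z ∈ L, y <+: z) ∧
      WordEq R (expandW g x) (expandW g y) ∧ p = padR x y}

/-- A biautomatic structure for the monoid `sgp⟨α ∣ R⟩`. -/
structure MonBiautoStruct {α β : Type*} (R : Set (List α × List α))
    (g : β → List α) (L : Set (List β)) : Prop where
  reg : IsReg L
  ne : ∀ w ∈ L, w ≠ []
  onto : ∀ w : List α, ∃ x ∈ L, WordEq R (expandW g x) w
  eqR_reg : IsReg {p | ∃ x ∈ L, ∃ y ∈ L,
      WordEq R (expandW g x) (expandW g y) ∧ p = padR x y}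
  eqL_reg : IsReg {p | ∃ x ∈ L, ∃ y ∈ L,
      WordEq R (expandW g x) (expandW g y) ∧ p = padL x y}
  mulRR_reg : ∀ b : β, IsReg {p | ∃ x ∈ L, ∃ y ∈ L,
      WordEq R (expandW g x ++ g b) (expandW g y) ∧ p = padR x y}
  mulLR_reg : ∀ b : β, IsReg {p | ∃ x ∈ L, ∃ y ∈ L,
      WordEq R (g b ++ expandW g x) (expandW g y) ∧ p = padR x y}
  mulRL_reg : ∀ b : β, IsReg {p | ∃ x ∈ L, ∃ y ∈ L,
      WordEq R (expandW g x ++ g b) (expandW g y) ∧ p = padL x y}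
  mulLL_reg : ∀ b : β, IsReg {p | ∃ x ∈ L, ∃ y ∈ L,
      WordEq R (g b ++ expandW g x) (expandW g y) ∧ p = padL x y}

/-- The monoid `sgp⟨α ∣ R⟩` is automatic. -/
def MonAutomatic {α : Type*} (R : Set (List α × List α)) : Prop :=
  ∃ (β : Type) (_ : Fintype β) (g : β → List α) (L : Set (List β)),
    MonAutoStruct R g L

/-- The monoid `sgp⟨α ∣ R⟩` is prefix-automatic. -/
def MonPrefixAutomatic {α : Type*} (R : Set (List α × List α)) : Prop :=
  ∃ (β : Type) (_ : Fintype β) (g : β → List α) (L : Set (List β)),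
    MonPrefixAutoStruct R g L

/-- The monoid `sgp⟨α ∣ R⟩` is biautomatic. -/
def MonBiautomatic {α : Type*} (R : Set (List α × List α)) : Prop :=
  ∃ (β : Type) (_ : Fintype β) (g : β → List α) (L : Set (List β)),
    MonBiautoStruct R g L

/-- The defining relations of `S¹ = sgp⁺⟨α, e ∣ R, ea = ae = a, ee = e⟩`,
the monoid obtained from `S = sgp⁺⟨α ∣ R⟩` by adjoining an identity element,
presented as a semigroup over the alphabet `Option α` where `none` is the new
identity letter `e`. -/
def adjoinOne {α : Type*} (R : Set (List α × List α)) :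
    Set (List (Option α) × List (Option α)) :=
  {q | ∃ p ∈ R, q = (p.1.map some, p.2.map some)} ∪
    {q | ∃ a : α, q = ([none, some a], [some a])} ∪
    {q | ∃ a : α, q = ([some a, none], [some a])} ∪
    {([none, none], [none])}


section RegTools

theorem reg_of_coalg {γ σ : Type} [Finite σ] (A : σ → Set (List γ)) (step : σ → γ → Set σ)
    (h : ∀ s c w, (c :: w) ∈ A s ↔ ∃ t ∈ step s c, w ∈ A t) (s : σ) : IsReg (A s) := by
  classical
  haveI := Fintype.ofFinite σ
  let M : NFA γ σ := ⟨step, {s}, {t | [] ∈ A t}⟩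
  refine ⟨Set σ, inferInstance, M.toDFA, ?_⟩
  rw [NFA.toDFA_correct, NFA.accepts_eq_acceptsFrom_start]
  have key : ∀ (w : List γ) (S : Set σ), w ∈ M.acceptsFrom S ↔ ∃ t ∈ S, w ∈ A t := by
    intro w
    induction w with
    | nil => intro S; rw [NFA.nil_mem_acceptsFrom]; rfl
    | cons c w ih =>
      intro S
      rw [NFA.cons_mem_acceptsFrom, ih]
      constructor
      · rintro ⟨t, ht, hw⟩
        obtain ⟨r, hr, hrt⟩ := (NFA.mem_stepSet (M := M)).1 ht
        exact ⟨r, hr, (h r c w).2 ⟨t, hrt, hw⟩⟩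
      · rintro ⟨r, hr, hw⟩
        obtain ⟨t, ht, hw⟩ := (h r c w).1 hw
        exact ⟨t, (NFA.mem_stepSet (M := M)).2 ⟨r, hr, ht⟩, hw⟩
  ext w
  have := key w {s}
  simp only [Set.mem_singleton_iff, exists_eq_left] at this
  exact this

theorem IsReg.dfa {γ : Type} {L : Set (List γ)} (h : IsReg L) :
    ∃ (σ : Type) (_ : Fintype σ) (M : DFA γ σ), ∀ w, w ∈ L ↔ M.evalFrom M.start w ∈ M.accept := by
  obtain ⟨σ, i, M, hM⟩ := h
  refine ⟨σ, i, M, fun w => ?_⟩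
  have : w ∈ M.accepts ↔ w ∈ L := by rw [hM]; rfl
  exact this.symm

theorem IsReg.of_fun {γ σ : Type} [Finite σ] (δ : σ → γ → σ) (s : σ) (acc : Set σ)
    (L : Set (List γ)) (h : ∀ w, w ∈ L ↔ w.foldl δ s ∈ acc) : IsReg L := by
  haveI := Fintype.ofFinite σ
  refine ⟨σ, inferInstance, ⟨δ, s, acc⟩, ?_⟩
  ext w
  exact (h w).symm

theorem IsReg.union {γ : Type} {L K : Set (List γ)} (h : IsReg L) (h' : IsReg K) :
    IsReg (L ∪ K) := Language.IsRegular.add h h'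

theorem IsReg.inter {γ : Type} {L K : Set (List γ)} (h : IsReg L) (h' : IsReg K) :
    IsReg (L ∩ K) := Language.IsRegular.inf h h'

theorem IsReg.empty {γ : Type} : IsReg (∅ : Set (List γ)) :=
  IsReg.of_fun (σ := Unit) (fun _ _ => ()) () ∅ _ (by simp)

theorem IsReg.iUnion {γ ι : Type} [Finite ι] {L : ι → Set (List γ)} (h : ∀ i, IsReg (L i)) :
    IsReg (⋃ i, L i) := by
  classical
  haveI := Fintype.ofFinite ι
  have : ∀ s : Finset ι, IsReg (⋃ i ∈ s, L i) := by
    intro s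
    induction s using Finset.induction_on with
    | empty => simpa using IsReg.empty
    | insert a s _ ih => rw [Finset.set_biUnion_insert]; exact (h a).union ih
  simpa using this Finset.univ

theorem IsReg.comap {γ γ' : Type} {L : Set (List γ)} (h : IsReg L) (f : γ' → γ) :
    IsReg {w : List γ' | w.map f ∈ L} := by
  obtain ⟨σ, _, M, hM⟩ := h.dfa
  refine IsReg.of_fun (fun s c => M.step s (f c)) M.start M.accept _ (fun w => ?_)
  simp only [Set.mem_setOf_eq, hM, DFA.evalFrom, List.foldl_map]

theorem IsReg.filterMap {γ γ' : Type} {L : Set (List γ)} (h : IsReg L) (f : γ' → Option γ) :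
    IsReg {w : List γ' | w.filterMap f ∈ L} := by
  obtain ⟨σ, _, M, hM⟩ := h.dfa
  refine IsReg.of_fun (fun s c => match f c with | none => s | some d => M.step s d)
    M.start M.accept _ (fun w => ?_)
  simp only [Set.mem_setOf_eq, hM, DFA.evalFrom]
  generalize M.start = s
  induction w generalizing s with
  | nil => rfl
  | cons c w ih =>
    rw [List.foldl_cons, List.filterMap_cons]
    cases hc : f c with
    | none => simpa using ih s
    | some d => simpa using ih (M.step s d)

theorem IsReg.all {γ : Type} (P : γ → Prop) : IsReg {w : List γ | ∀ c ∈ w, P c} := by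
  refine reg_of_coalg (σ := Unit) (fun _ => {w : List γ | ∀ c ∈ w, P c})
    (fun _ c => {_x | P c}) ?_ ()
  intro s c w
  simp


end RegTools


section RegTools2

theorem evalFrom_cons' {γ σ : Type} (M : DFA γ σ) (q : σ) (c : γ) (w : List γ) :
    M.evalFrom q (c :: w) = M.evalFrom (M.step q c) w := rfl

theorem IsReg.mul {γ : Type} {L K : Set (List γ)} (hL : IsReg L) (hK : IsReg K) :
    IsReg {w | ∃ x ∈ L, ∃ y ∈ K, w = x ++ y} := by
  obtain ⟨σ, _, M, hM⟩ := hL.dfa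
  obtain ⟨τ, _, P, hP⟩ := hK.dfa
  let A : σ ⊕ τ → Set (List γ) := fun s => match s with
    | .inl q => {w | ∃ x y, M.evalFrom q x ∈ M.accept ∧ y ∈ K ∧ w = x ++ y}
    | .inr q => {w | P.evalFrom q w ∈ P.accept}
  have : {w | ∃ x ∈ L, ∃ y ∈ K, w = x ++ y} = A (.inl M.start) := by
    ext w
    simp only [A, Set.mem_ofPred_eq, hM]
    grind
  rw [this]
  refine reg_of_coalg A (fun s c => match s with
    | .inl q => {t | t = .inl (M.step q c) ∨ (q ∈ M.accept ∧ t = .inr (P.step P.start c))}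
    | .inr q => {.inr (P.step q c)}) ?_ (.inl M.start)
  intro s c w
  cases s with
  | inr q => simp [A, evalFrom_cons']
  | inl q =>
    simp only [A, Set.mem_ofPred_eq]
    constructor
    · rintro ⟨x, y, h1, h2, h3⟩
      cases x with
      | nil =>
        simp only [List.nil_append] at h3
        subst h3
        exact ⟨_, Or.inr ⟨h1, rfl⟩, (hP _).1 h2⟩
      | cons d x =>
        simp only [List.cons_append, List.cons.injEq] at h3
        obtain ⟨rfl, rfl⟩ := h3
        exact ⟨_, Or.inl rfl, x, y, h1, h2, rfl⟩
    · rintro ⟨t, rfl | ⟨h1, rfl⟩, h2⟩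
      · obtain ⟨x, y, h1, h2, rfl⟩ := h2
        exact ⟨c :: x, y, h1, h2, rfl⟩
      · exact ⟨[], c :: w, h1, (hP _).2 h2, rfl⟩

/-- powers of a word -/
def pw {γ : Type} (z : List γ) : ℕ → List γ
  | 0 => []
  | k + 1 => z ++ pw z k

theorem pw_succ' {γ : Type} (z : List γ) (k : ℕ) : pw z (k+1) = pw z k ++ z := by
  induction k with
  | zero => simp [pw]
  | succ k ih =>
    have : pw z (k+1+1) = z ++ pw z (k+1) := rfl
    rw [this, ih, ← List.append_assoc, ← ih]
    rfl

theorem pw_reverse {γ : Type} (z : List γ) (k : ℕ) : (pw z k).reverse = pw z.reverse k := by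
  induction k with
  | zero => simp [pw]
  | succ k ih => rw [pw_succ']; simp [pw, ih]

theorem pw_nil {γ : Type} (k : ℕ) : pw ([] : List γ) k = [] := by
  induction k with
  | zero => simp [pw]
  | succ k ih => simp [pw, ih]

theorem pw_map {γ γ' : Type} (f : γ → γ') (z : List γ) (k : ℕ) : (pw z k).map f = pw (z.map f) k := by
  induction k with
  | zero => simp [pw]
  | succ k ih => simp [pw, ih]

theorem IsReg.pw {γ : Type} (z : List γ) : IsReg {w | ∃ k, w = pw z k} := by
  let A : Fin (z.length + 1) → Set (List γ) := fun i => {w | ∃ k, w = z.drop i ++ _root_.pw z k}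
  have h0 : {w | ∃ k, w = _root_.pw z k} = A (Fin.last _) := by
    ext w; simp [A]
  rw [h0]
  refine reg_of_coalg A (fun i c => {j | (∃ h : i.1 < z.length, z[i.1] = c ∧ j.1 = i.1 + 1) ∨
    (i.1 = z.length ∧ ∃ h : 0 < z.length, z[0] = c ∧ j.1 = 1)}) ?_ _
  rintro ⟨i, hi⟩ c w
  simp only [A, Set.mem_ofPred_eq]
  constructor
  · rintro ⟨k, hk⟩
    by_cases h : i < z.length
    · rw [List.drop_eq_getElem_cons h] at hk
      simp only [List.cons_append, List.cons.injEq] at hk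
      exact ⟨⟨i+1, by omega⟩, Or.inl ⟨h, hk.1.symm, rfl⟩, k, hk.2⟩
    · rw [List.drop_eq_nil_of_le (by omega)] at hk
      cases k with
      | zero => simp [_root_.pw] at hk
      | succ k =>
        cases z with
        | nil => simp [pw_nil] at hk
        | cons d z =>
          simp [_root_.pw] at hk
          refine ⟨⟨1, by simp⟩, Or.inr ⟨by simp at *; omega, by simp, hk.1.symm, rfl⟩, k, ?_⟩
          simp [hk.2]
  · rintro ⟨⟨j, hj⟩, ⟨h, h1, h2⟩ | ⟨h, h0, h1, h2⟩, k, rfl⟩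
    · simp only at h h1 h2
      subst h2
      refine ⟨k, ?_⟩
      rw [List.drop_eq_getElem_cons h, h1]; rfl
    · simp only at h h1 h2
      subst h2 h
      refine ⟨k+1, ?_⟩
      cases z with
      | nil => simp at h0
      | cons d z => simp at h1; simp [_root_.pw, h1]

section pad
variable {β : Type}

@[simp] theorem padR_nil_nil : padR ([] : List β) [] = [] := rfl
@[simp] theorem padR_cons_cons (a b : β) (x y : List β) :
    padR (a :: x) (b :: y) = (some a, some b) :: padR x y := by
  simp [padR]
@[simp] theorem padR_cons_nil (a : β) (x : List β) :
    padR (a :: x) [] = (some a, none) :: padR x [] := by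
  simp [padR, List.replicate_succ]
@[simp] theorem padR_nil_cons (b : β) (y : List β) :
    padR [] (b :: y) = (none, some b) :: padR [] y := by
  simp [padR, List.replicate_succ]

theorem padR_ind {P : List β → List β → Prop} (h0 : P [] []) (h1 : ∀ a b x y, P x y → P (a::x) (b::y))
    (h2 : ∀ a x, P x [] → P (a::x) []) (h3 : ∀ a y, P [] y → P [] (a::y)) : ∀ x y, P x y := by
  intro x
  induction x with
  | nil => intro y; induction y with
    | nil => exact h0
    | cons b y ih => exact h3 _ _ ih
  | cons a x ih => intro y; cases y with
    | nil => exact h2 _ _ (ih [])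
    | cons b y => exact h1 _ _ _ _ (ih y)

theorem padR_fst (x y : List β) : (padR x y).filterMap Prod.fst = x := by
  induction x, y using padR_ind with
  | h0 => rfl
  | h1 a b x y ih => simp [ih]
  | h2 a x ih => simp [ih]
  | h3 a y ih => rw [padR_nil_cons]; exact ih
theorem padR_snd (x y : List β) : (padR x y).filterMap Prod.snd = y := by
  induction x, y using padR_ind with
  | h0 => rfl
  | h1 a b x y ih => simp [ih]
  | h2 a y ih => rw [padR_cons_nil]; exact ih
  | h3 a x ih => simp [ih]
theorem padR_inj {x y x' y' : List β} (h : padR x y = padR x' y') : x = x' ∧ y = y' :=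
  ⟨by rw [← padR_fst x y, h, padR_fst], by rw [← padR_snd x y, h, padR_snd]⟩
theorem padR_swap (x y : List β) : (padR x y).map Prod.swap = padR y x := by
  induction x, y using padR_ind <;> simp_all
theorem padR_append (x y x' y' : List β) (h : x.length = y.length) :
    padR (x ++ x') (y ++ y') = padR x y ++ padR x' y' := by
  induction x, y using padR_ind <;> simp_all
theorem padR_append_nil (x x' : List β) :
    padR (x ++ x') [] = padR x [] ++ padR x' [] := by
  induction x <;> simp_all
theorem padR_self (x : List β) : padR x x = x.map (fun a => (some a, some a)) := by
  induction x <;> simp_all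

/-- regularity of a binary relation on words -/
def RR (ρ : List β → List β → Prop) : Prop := IsReg {p | ∃ x y, ρ x y ∧ p = padR x y}

theorem RR.congr {ρ ρ' : List β → List β → Prop} (h : RR ρ) (e : ∀ x y, ρ x y ↔ ρ' x y) : RR ρ' := by
  have : ρ = ρ' := by funext x y; exact propext (e x y)
  rwa [← this]

theorem RR.union {ρ ρ' : List β → List β → Prop} (h : RR ρ) (h' : RR ρ') :
    RR (fun x y => ρ x y ∨ ρ' x y) := by
  have := IsReg.union h h'
  unfold RR
  convert this using 1
  ext p; simp only [Set.mem_ofPred_eq, Set.mem_union]; grind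

theorem RR.iUnion {ι : Type} [Finite ι] {ρ : ι → List β → List β → Prop} (h : ∀ i, RR (ρ i)) :
    RR (fun x y => ∃ i, ρ i x y) := by
  have := IsReg.iUnion h
  unfold RR
  convert this using 1
  ext p; simp only [Set.mem_ofPred_eq, Set.mem_iUnion]; grind

theorem RR.restrict {ρ : List β → List β → Prop} (h : RR ρ) {N N' : Set (List β)}
    (hN : IsReg N) (hN' : IsReg N') : RR (fun x y => ρ x y ∧ x ∈ N ∧ y ∈ N') := by
  have := IsReg.inter h (IsReg.inter (hN.filterMap (Prod.fst : Option β × Option β → _)) (hN'.filterMap Prod.snd))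
  unfold RR
  convert this using 1
  ext p
  simp only [Set.mem_ofPred_eq, Set.mem_inter_iff]
  constructor
  · rintro ⟨x, y, ⟨h1, h2, h3⟩, rfl⟩
    exact ⟨⟨x, y, h1, rfl⟩, by rwa [padR_fst], by rwa [padR_snd]⟩
  · rintro ⟨⟨x, y, h1, rfl⟩, h2, h3⟩
    rw [padR_fst] at h2
    rw [padR_snd] at h3
    exact ⟨x, y, ⟨h1, h2, h3⟩, rfl⟩

theorem RR.swap {ρ : List β → List β → Prop} (h : RR ρ) : RR (fun x y => ρ y x) := by
  have := h.comap (Prod.swap : Option β × Option β → _)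
  unfold RR
  convert this using 1
  ext p
  simp only [Set.mem_ofPred_eq]
  constructor
  · rintro ⟨x, y, h1, rfl⟩
    exact ⟨y, x, h1, padR_swap _ _⟩
  · rintro ⟨x, y, h1, h2⟩
    refine ⟨y, x, h1, ?_⟩
    rw [← padR_swap, ← h2]; simp

theorem RR.pw (s t : List β) (h : s.length = t.length ∨ t = []) :
    RR (fun x y => ∃ k, x = pw s k ∧ y = pw t k) := by
  have := IsReg.pw (padR s t)
  unfold RR
  convert this using 1
  have key : ∀ k, padR (_root_.pw s k) (_root_.pw t k) = _root_.pw (padR s t) k := by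
    intro k
    induction k with
    | zero => simp [_root_.pw]
    | succ k ih =>
      simp only [_root_.pw]
      rcases h with h | rfl
      · rw [padR_append _ _ _ _ h, ih]
      · rw [← ih, pw_nil, List.append_nil, padR_append_nil]
  ext p
  simp only [Set.mem_ofPred_eq]
  constructor
  · rintro ⟨x, y, ⟨k, rfl, rfl⟩, rfl⟩; exact ⟨k, key k⟩
  · rintro ⟨k, rfl⟩; exact ⟨_, _, ⟨k, rfl, rfl⟩, (key k).symm⟩

theorem RR.common {ρ : List β → List β → Prop} (h : RR ρ) (P : β → Prop := fun _ => True):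
    RR (fun x y => ∃ w x' y', (∀ a ∈ w, P a) ∧ ρ x' y' ∧ x = w ++ x' ∧ y = w ++ y') := by
  have := IsReg.mul (IsReg.all (γ := Option β × Option β) (fun c => ∃ a, P a ∧ c = (some a, some a))) h
  unfold RR
  convert this using 1
  ext p
  simp only [Set.mem_ofPred_eq]
  constructor
  · rintro ⟨x, y, ⟨w, x', y', h0, h1, rfl, rfl⟩, rfl⟩
    refine ⟨padR w w, ?_, _, ⟨x', y', h1, rfl⟩, ?_⟩
    · rw [padR_self]; simpa using h0
    · rw [padR_append _ _ _ _ rfl]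
  · rintro ⟨d, hd, _, ⟨x', y', h1, rfl⟩, rfl⟩
    have : ∃ w : List β, (∀ a ∈ w, P a) ∧ d = w.map (fun a => (some a, some a)) := by
      induction d with
      | nil => exact ⟨[], by simp⟩
      | cons c d ih =>
        obtain ⟨w, hw, rfl⟩ := ih (fun c hc => hd c (List.mem_cons_of_mem _ hc))
        obtain ⟨a, ha, rfl⟩ := hd c List.mem_cons_self
        exact ⟨a :: w, by simp; grind, rfl⟩
    obtain ⟨w, hw, rfl⟩ := this
    refine ⟨_, _, ⟨w, x', y', hw, h1, rfl, rfl⟩, ?_⟩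
    rw [padR_append _ _ _ _ rfl, padR_self]

theorem RR.dfa {ρ : List β → List β → Prop} (h : RR ρ) :
    ∃ (σ : Type) (_ : Fintype σ) (M : DFA (Option β × Option β) σ),
      ∀ x y, ρ x y ↔ M.evalFrom M.start (padR x y) ∈ M.accept := by
  obtain ⟨σ, i, M, hM⟩ := IsReg.dfa h
  refine ⟨σ, i, M, fun x y => ?_⟩
  rw [← hM]
  constructor
  · intro h; exact ⟨x, y, h, rfl⟩
  · rintro ⟨x', y', h, e⟩
    obtain ⟨rfl, rfl⟩ := padR_inj e
    exact h

theorem RR.cons_snd [Finite β] {ρ : List β → List β → Prop} (h : RR ρ) (e : β) :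
    RR (fun x y => ∃ y', ρ x y' ∧ y = e :: y') := by
  obtain ⟨σ, _, M, hM⟩ := h.dfa
  -- none: start; some none q ..
  let A : Unit ⊕ σ ⊕ (σ × β) ⊕ (σ × β) → Set (List (Option β × Option β)) := fun s => match s with
    | .inl _ => {p | ∃ x y, (∃ y', ρ x y' ∧ y = e :: y') ∧ p = padR x y}
    | .inr (.inl q) => {p | ∃ y, M.evalFrom q (padR [] y) ∈ M.accept ∧ p = padR [] y}
    | .inr (.inr (.inl (q, c))) => {p | ∃ x y, M.evalFrom q (padR (c :: x) y) ∈ M.accept ∧ p = padR x y}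
    | .inr (.inr (.inr (q, c))) => {p | ∃ x, M.evalFrom q (padR (c :: x) []) ∈ M.accept ∧ p = padR x []}
  let step : Unit ⊕ σ ⊕ (σ × β) ⊕ (σ × β) → (Option β × Option β) →
      Set (Unit ⊕ σ ⊕ (σ × β) ⊕ (σ × β)) := fun s l => match s with
    | .inl _ => {t | (l = (none, some e) ∧ t = .inr (.inl M.start)) ∨
        (∃ c, l = (some c, some e) ∧ t = .inr (.inr (.inl (M.start, c))))}
    | .inr (.inl q) => {t | ∃ f, l = (none, some f) ∧ t = .inr (.inl (M.step q (none, some f)))}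
    | .inr (.inr (.inl (q, c))) => {t |
        (∃ f, l = (none, some f) ∧ t = .inr (.inl (M.step q (some c, some f)))) ∨
        (∃ d f, l = (some d, some f) ∧ t = .inr (.inr (.inl (M.step q (some c, some f), d)))) ∨
        (∃ d, l = (some d, none) ∧ t = .inr (.inr (.inr (M.step q (some c, none), d))))}
    | .inr (.inr (.inr (q, c))) => {t |
        (∃ d, l = (some d, none) ∧ t = .inr (.inr (.inr (M.step q (some c, none), d))))}
  refine reg_of_coalg A step ?_ (.inl ())
  rintro (s | q | ⟨q, c⟩ | ⟨q, c⟩) l p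
  · simp only [A, step, Set.mem_ofPred_eq]
    constructor
    · rintro ⟨x, y, ⟨y', h1, rfl⟩, h2⟩
      rw [hM] at h1
      cases x with
      | nil =>
        simp only [padR_nil_cons, List.cons.injEq] at h2
        exact ⟨_, Or.inl ⟨h2.1, rfl⟩, y', h1, h2.2⟩
      | cons c x =>
        simp only [padR_cons_cons, List.cons.injEq] at h2
        exact ⟨_, Or.inr ⟨c, h2.1, rfl⟩, x, y', h1, h2.2⟩
    · rintro ⟨t, ⟨rfl, rfl⟩ | ⟨c, rfl, rfl⟩, h⟩
      · obtain ⟨y, h1, rfl⟩ := h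
        exact ⟨[], e :: y, ⟨y, (hM _ _).2 h1, rfl⟩, by simp⟩
      · obtain ⟨x, y, h1, rfl⟩ := h
        exact ⟨c :: x, e :: y, ⟨y, (hM _ _).2 h1, rfl⟩, by simp⟩
  · simp only [A, step, Set.mem_ofPred_eq]
    constructor
    · rintro ⟨y, h1, h2⟩
      cases y with
      | nil => simp at h2
      | cons f y =>
        simp only [padR_nil_cons, List.cons.injEq] at h2 h1
        exact ⟨_, ⟨f, h2.1, rfl⟩, y, h1, h2.2⟩
    · rintro ⟨t, ⟨f, rfl, rfl⟩, y, h1, rfl⟩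
      exact ⟨f :: y, by rw [padR_nil_cons]; exact h1, by simp⟩
  · simp only [A, step, Set.mem_ofPred_eq]
    constructor
    · rintro ⟨x, y, h1, h2⟩
      rcases x with _ | ⟨d, x⟩ <;> rcases y with _ | ⟨f, y⟩
      · simp at h2
      · simp only [padR_nil_cons, padR_cons_cons, List.cons.injEq] at h2 h1
        exact ⟨_, Or.inl ⟨f, h2.1, rfl⟩, y, h1, h2.2⟩
      · rw [padR_cons_nil, List.cons.injEq] at h2
        rw [padR_cons_nil] at h1
        exact ⟨_, Or.inr (Or.inr ⟨d, h2.1, rfl⟩), x, h1, h2.2⟩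
      · rw [padR_cons_cons, List.cons.injEq] at h2
        rw [padR_cons_cons] at h1
        exact ⟨_, Or.inr (Or.inl ⟨d, f, h2.1, rfl⟩), x, y, h1, h2.2⟩
    · rintro ⟨t, ⟨f, rfl, rfl⟩ | ⟨d, f, rfl, rfl⟩ | ⟨d, rfl, rfl⟩, h⟩
      · obtain ⟨y, h1, rfl⟩ := h
        exact ⟨[], f :: y, by rw [padR_cons_cons]; exact h1, by simp⟩
      · obtain ⟨x, y, h1, rfl⟩ := h
        exact ⟨d :: x, f :: y, by rw [padR_cons_cons]; exact h1, by simp⟩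
      · obtain ⟨x, h1, rfl⟩ := h
        exact ⟨d :: x, [], by rw [padR_cons_nil]; exact h1, by simp⟩
  · simp only [A, step, Set.mem_ofPred_eq]
    constructor
    · rintro ⟨x, h1, h2⟩
      rcases x with _ | ⟨d, x⟩
      · simp at h2
      · rw [padR_cons_nil, List.cons.injEq] at h2
        rw [padR_cons_nil] at h1
        exact ⟨_, ⟨d, h2.1, rfl⟩, x, h1, h2.2⟩
    · rintro ⟨t, ⟨d, rfl, rfl⟩, h⟩
      obtain ⟨x, h1, rfl⟩ := h
      exact ⟨d :: x, by rw [padR_cons_nil]; exact h1, by simp⟩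

theorem RR.app_snd [Finite β] {ρ : List β → List β → Prop} (h : RR ρ) (q : List β) :
    RR (fun x y => ∃ y', ρ x y' ∧ y = q ++ y') := by
  induction q with
  | nil => exact h.congr (by simp)
  | cons e q ih => exact (ih.cons_snd e).congr (by intro x y; constructor <;> [rintro ⟨_, ⟨y, h, rfl⟩, rfl⟩; rintro ⟨y, h, rfl⟩] <;> simp [h])

theorem RR.app [Finite β] {ρ : List β → List β → Prop} (h : RR ρ) (q q' : List β) :
    RR (fun x y => ∃ x' y', ρ x' y' ∧ x = q ++ x' ∧ y = q' ++ y') := by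
  have := ((h.app_snd q').swap.app_snd q).swap
  exact this.congr (by intro x y; grind)

/-- regularity of relation on stacks (reversed words) -/
def RRs (ρ : List β → List β → Prop) : Prop := RR (fun x y => ρ x.reverse y.reverse)

theorem RRs.union {ρ ρ' : List β → List β → Prop} (h : RRs ρ) (h' : RRs ρ') :
    RRs (fun x y => ρ x y ∨ ρ' x y) := RR.union h h'

theorem RRs.iUnion {ι : Type} [Finite ι] {ρ : ι → List β → List β → Prop} (h : ∀ i, RRs (ρ i)) :
    RRs (fun x y => ∃ i, ρ i x y) := RR.iUnion h

theorem RRs.pat [Finite β] (q q' s t : List β) (h : s.length = t.length ∨ t = []) :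
    RRs (fun x y => ∃ k w, x = pw s k ++ q ++ w ∧ y = pw t k ++ q' ++ w) := by
  have := ((RR.pw s.reverse t.reverse (by simpa using h)).app q.reverse q'.reverse).common
  refine this.congr (fun x y => ?_)
  constructor
  · rintro ⟨w, _, _, -, ⟨_, _, ⟨k, rfl, rfl⟩, rfl, rfl⟩, rfl, rfl⟩
    refine ⟨k, w.reverse, ?_, ?_⟩ <;> simp [pw_reverse]
  · rintro ⟨k, w, hx, hy⟩
    refine ⟨w.reverse, _, _, by simp, ⟨_, _, ⟨k, rfl, rfl⟩, rfl, rfl⟩, ?_, ?_⟩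
    · rw [← x.reverse_reverse, hx]; simp [pw_reverse]
    · rw [← y.reverse_reverse, hy]; simp [pw_reverse]

end pad
end RegTools2


section Quot
variable {α : Type}

theorem WordEq.refl' (R : Set (List α × List α)) (x) : WordEq R x x := Relation.EqvGen.refl x
theorem WordEq.symm' {R : Set (List α × List α)} {x y} (h : WordEq R x y) : WordEq R y x :=
  Relation.EqvGen.symm _ _ h
theorem WordEq.trans' {R : Set (List α × List α)} {x y z} (h : WordEq R x y) (h' : WordEq R y z) :
    WordEq R x z := Relation.EqvGen.trans _ _ _ h h'

theorem WordEq.app {R : Set (List α × List α)} {x y} (h : WordEq R x y) (p s : List α) :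
    WordEq R (p ++ x ++ s) (p ++ y ++ s) := by
  induction h with
  | rel x y h =>
    obtain ⟨p', u, v, s', h, rfl, rfl⟩ := h
    exact Relation.EqvGen.rel _ _ ⟨p ++ p', u, v, s' ++ s, h, by simp, by simp⟩
  | refl x => exact WordEq.refl' _ _
  | symm x y _ ih => exact ih.symm'
  | trans x y z _ _ ih ih' => exact ih.trans' ih'

theorem WordEq.mul {R : Set (List α × List α)} {x y x' y'} (h : WordEq R x y) (h' : WordEq R x' y') :
    WordEq R (x ++ x') (y ++ y') := by
  have h1 := h.app [] x'
  have h2 := h'.app y []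
  simp only [List.nil_append, List.append_nil] at h1 h2
  exact h1.trans' h2

theorem WordEq.of_rel (u v : List α) : WordEq {(u, v)} u v :=
  Relation.EqvGen.rel _ _ ⟨[], u, v, [], rfl, by simp, by simp⟩

/-- invariants -/
theorem WordEq.inv {u v : List α} {ι : Type*} (f : List α → ι)
    (h : ∀ p s, f (p ++ u ++ s) = f (p ++ v ++ s)) {x y} (hxy : WordEq {(u, v)} x y) : f x = f y := by
  induction hxy with
  | rel x y h' =>
    obtain ⟨p', u, v, s', h', rfl, rfl⟩ := h'
    obtain ⟨rfl, rfl⟩ := Prod.mk.inj h'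
    exact h _ _
  | refl x => rfl
  | symm x y _ ih => exact ih.symm
  | trans x y z _ _ ih ih' => exact ih.trans ih'

theorem WordEq.swap {u v : List α} {x y} (hxy : WordEq {(u, v)} x y) : WordEq {(v, u)} x y := by
  induction hxy with
  | rel x y h' =>
    obtain ⟨p', u, v, s', h', rfl, rfl⟩ := h'
    obtain ⟨rfl, rfl⟩ := Prod.mk.inj h'
    exact ((WordEq.of_rel v u).symm').app _ _
  | refl x => exact WordEq.refl' _ _
  | symm x y _ ih => exact ih.symm'
  | trans x y z _ _ ih ih' => exact ih.trans' ih'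

theorem MonPrefixAutomatic.swap {u v : List α} (h : MonPrefixAutomatic {(u, v)}) :
    MonPrefixAutomatic {(v, u)} := by
  have e : ∀ x y, WordEq {(u, v)} x y ↔ WordEq {(v, u)} x y := fun x y => ⟨WordEq.swap, WordEq.swap⟩
  obtain ⟨β, i, g, L, h⟩ := h
  obtain ⟨⟨h1, h2, h3, h4, h5⟩, h6⟩ := h
  simp only [e] at h3 h4 h5 h6
  exact ⟨β, i, g, L, ⟨⟨h1, h2, h3, h4, h5⟩, h6⟩⟩

def wcon (R : Set (List α × List α)) : Con (FreeMonoid α) where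
  r x y := WordEq R x.toList y.toList
  iseqv := ⟨fun _ => WordEq.refl' _ _, WordEq.symm', WordEq.trans'⟩
  mul' h h' := WordEq.mul h h'

abbrev Q (R : Set (List α × List α)) := (wcon R).Quotient

def toQ (R : Set (List α × List α)) (x : List α) : Q R := ((FreeMonoid.ofList x : FreeMonoid α) : (wcon R).Quotient)

theorem toQ_eq {R : Set (List α × List α)} {x y : List α} : toQ R x = toQ R y ↔ WordEq R x y :=
  (wcon R).eq
theorem toQ_append (R : Set (List α × List α)) (x y : List α) : toQ R (x ++ y) = toQ R x * toQ R y := rfl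
theorem toQ_nil (R : Set (List α × List α)) : toQ R [] = 1 := rfl
theorem toQ_cons (R : Set (List α × List α)) (a : α) (x : List α) : toQ R (a :: x) = toQ R [a] * toQ R x := rfl
theorem toQ_rel (u v : List α) : toQ {(u, v)} u = toQ {(u, v)} v := toQ_eq.2 (WordEq.of_rel u v)

variable {β : Type}
def evs (R : Set (List α × List α)) (g : β → List α) : List β → Q R
  | [] => 1
  | b :: x => evs R g x * toQ R (g b)

theorem evs_append (R : Set (List α × List α)) (g : β → List α) (x y : List β) :
    evs R g (x ++ y) = evs R g y * evs R g x := by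
  induction x with
  | nil => simp [evs]
  | cons b x ih => simp [evs, ih, mul_assoc]

theorem evs_eq (R : Set (List α × List α)) (g : β → List α) (x : List β) :
    evs R g x = toQ R (expandW g x.reverse) := by
  induction x with
  | nil => rfl
  | cons b x ih => simp [evs, ih, expandW, toQ_append]

theorem evs_pw (R : Set (List α × List α)) (g : β → List α) (s : List β) (k : ℕ) :
    evs R g (pw s k) = (evs R g s) ^ k := by
  induction k with
  | zero => simp [pw, evs]
  | succ k ih => simp [pw, evs_append, ih, pow_succ]

end Quot

section NF
variable {β : Type}

def NF (ok : List β → β → Prop) : List β → Prop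
  | [] => True
  | c :: w => ok w c ∧ NF ok w

@[simp] theorem NF_nil (ok : List β → β → Prop) : NF ok [] := trivial
@[simp] theorem NF_cons (ok : List β → β → Prop) (c w) : NF ok (c :: w) ↔ ok w c ∧ NF ok w := Iff.rfl

theorem NF_reg {σ : Type} [Finite σ] (ok : List β → β → Prop) (st : List β → σ) (δ : σ → β → σ)
    (ok' : σ → β → Prop) (h1 : ∀ c w, st (c :: w) = δ (st w) c) (h2 : ∀ c w, ok w c ↔ ok' (st w) c) :
    IsReg {x | NF ok x.reverse} := by
  classical
  refine IsReg.of_fun (σ := Option σ)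
    (fun o c => o.bind (fun s => if ok' s c then some (δ s c) else none)) (some (st [])) {none}ᶜ _ ?_
  intro w
  have h3 : ∀ x : List β, NF ok x → (x.reverse.foldl (fun (o : Option σ) c => o.bind (fun s => if ok' s c then some (δ s c) else none)) (some (st []))) = some (st x) := by
    intro x
    induction x with
    | nil => simp
    | cons c x ih =>
      rintro ⟨h, hx⟩
      simp [List.foldl_append, ih hx, h1]
      exact (h2 _ _).1 h
  have h' : ∀ x : List β, ¬ NF ok x → (x.reverse.foldl (fun (o : Option σ) c => o.bind (fun s => if ok' s c then some (δ s c) else none)) (some (st []))) = none := by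
    intro x
    induction x with
    | nil => simp
    | cons c x ih =>
      intro h
      by_cases hx : NF ok x
      · have : ¬ ok x c := fun h' => h ⟨h', hx⟩
        rw [List.reverse_cons, List.foldl_append, h3 x hx]
        simpa [← h2] using this
      · simp [List.foldl_append, ih hx]
  by_cases hw : NF ok w.reverse
  · have := h3 _ hw
    rw [List.reverse_reverse] at this
    rw [this]
    simpa using hw
  · have := h' _ hw
    rw [List.reverse_reverse] at this
    rw [this]
    simpa using hw

theorem NF_reg_take [Finite β] (K : ℕ) (ok : List β → β → Prop) (h : ∀ c w, ok w c ↔ ok (w.take K) c) :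
    IsReg {x | NF ok x.reverse} := by
  haveI : Finite {l : List β // l.length ≤ K} := (List.finite_length_le β K).to_subtype
  refine NF_reg (σ := {l : List β // l.length ≤ K}) ok (fun w => ⟨w.take K, by simp⟩)
    (fun s c => ⟨(c :: s.1).take K, by simp⟩) (fun s c => ok s.1 c) ?_ h
  intro c w
  apply Subtype.ext
  cases K with
  | zero => simp
  | succ K => simp [List.take_take]

theorem NF_suffix (ok : List β → β → Prop) (x y : List β) (h : NF ok (x ++ y)) : NF ok y := by
  induction x with
  | nil => exact h
  | cons c x ih => exact ih h.2

end NF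

section KEY

theorem IsReg.single {γ : Type} (l : γ) : IsReg {w | w = [l]} := by
  let A : Bool → Set (List γ) := fun s => if s then {[l]} else {[]}
  refine reg_of_coalg A (fun s c => {t | s = true ∧ c = l ∧ t = false}) ?_ true
  intro s c w
  cases s <;> simp [A]

theorem IsReg.image {γ γ' : Type} {L : Set (List γ)} (h : IsReg L) (f : γ → γ') (f' : γ' → γ)
    (hf : ∀ a, f' (f a) = a) : IsReg {w | ∃ x ∈ L, w = x.map f} := by
  have := IsReg.inter (h.comap f') (IsReg.all (fun c => f (f' c) = c))
  convert this using 1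
  ext w
  constructor
  · rintro ⟨x, hx, rfl⟩
    refine ⟨?_, ?_⟩
    · have : f' ∘ f = id := by funext a; exact hf a
      simpa [this] using hx
    · simp [hf]
  · rintro ⟨h1, h2⟩
    refine ⟨_, h1, ?_⟩
    rw [List.map_map]
    symm
    have : ∀ c ∈ w, (f ∘ f') c = c := h2
    rw [List.map_congr_left this]; simp

variable {α β : Type}

theorem padR_map_some (x y : List β) : padR (x.map some) (y.map some) =
    (padR x y).map (fun p => (p.1.map some, p.2.map some)) := by
  induction x, y using padR_ind <;> simp_all

theorem RR.opt {ρ : List β → List β → Prop} (h : RR ρ) :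
    IsReg {p : List (Option (Option β) × Option (Option β)) |
      ∃ x y : List β, ρ x y ∧ p = padR (none :: x.map some) (none :: y.map some)} := by
  have := IsReg.mul (IsReg.single ((some none, some none) : Option (Option β) × Option (Option β)))
    (IsReg.image h (fun p : Option β × Option β => (p.1.map some, p.2.map some))
      (fun p => (p.1.join, p.2.join)) (by rintro ⟨_ | a, _ | b⟩ <;> rfl))
  convert this using 1
  ext p
  simp only [Set.mem_ofPred_eq]
  constructor
  · rintro ⟨x, y, h, rfl⟩
    exact ⟨_, rfl, _, ⟨_, ⟨x, y, h, rfl⟩, rfl⟩, by simp [padR_map_some]⟩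
  · rintro ⟨_, rfl, _, ⟨_, ⟨x, y, h, rfl⟩, rfl⟩, rfl⟩
    exact ⟨x, y, h, by simp [padR_map_some]⟩

/-- multiplication by generator `c` is realised by a regular relation -/
def Good (R : Set (List α × List α)) (g : β → List α) (ok : List β → β → Prop)
    (act : List β → β → List β) (c : β) : Prop :=
  ∃ ρ, RRs ρ ∧ (∀ w, NF ok w → ρ w (act w c)) ∧
    ∀ x y, ρ x y → evs R g x * toQ R (g c) = evs R g y

theorem KEY [Finite β] {u v : List α} (g : β → List α) (s : α → β) (hs : ∀ a, g (s a) = [a])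
    (ok : List β → β → Prop) (act : List β → β → List β)
    (hreg : IsReg {x | NF ok x.reverse})
    (hok : ∀ w c, NF ok w → ok w c → act w c = c :: w)
    (hN : ∀ w c, NF ok w → NF ok (act w c))
    (hgood : ∀ c, Good {(u, v)} g ok act c)
    (hrel : ∀ w, NF ok w → (u.map s).foldl act w = (v.map s).foldl act w)
    (hgen : ∀ w c, NF ok w → ((g c).map s).foldl act w = act w c) :
    MonPrefixAutomatic {(u, v)} := by
  haveI := Fintype.ofFinite β
  set R : Set (List α × List α) := {(u, v)} with hR
  have hNl : ∀ (l : List β) w, NF ok w → NF ok (l.foldl act w) := by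
    intro l
    induction l with
    | nil => intro w h; exact h
    | cons c l ih => intro w h; exact ih _ (hN _ _ h)
  let nf : List α → List β := fun x => (x.map s).foldl act []
  have hnf : ∀ {x y}, WordEq R x y → nf x = nf y := by
    intro x y h
    refine WordEq.inv nf ?_ h
    intro p t
    simp only [nf, List.map_append, List.foldl_append]
    rw [hrel _ (hNl _ _ (NF_nil _))]
  have hnfx : ∀ x, NF ok x → nf (expandW g x.reverse) = x := by
    intro x
    induction x with
    | nil => intro _; rfl
    | cons c x ih =>
      rintro ⟨h1, h2⟩
      have : nf (expandW g (c :: x).reverse) = ((g c).map s).foldl act (nf (expandW g x.reverse)) := by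
        simp [nf, expandW, List.foldl_append]
      rw [this, ih h2, hgen _ _ h2, hok _ _ h2 h1]
  have huniq : ∀ x y, NF ok x → NF ok y → evs R g x = evs R g y → x = y := by
    intro x y hx hy h
    rw [evs_eq, evs_eq, toQ_eq] at h
    rw [← hnfx x hx, ← hnfx y hy, hnf h]
  have hact : ∀ w c, NF ok w → evs R g w * toQ R (g c) = evs R g (act w c) := by
    intro w c hw
    obtain ⟨ρ, _, h1, h2⟩ := hgood c
    exact h2 _ _ (h1 w hw)
  have hevs : ∀ (l : List α) w, NF ok w → evs R g ((l.map s).foldl act w) = evs R g w * toQ R l := by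
    intro l
    induction l with
    | nil => intro w _; simp [toQ_nil]
    | cons a l ih =>
      intro w hw
      simp only [List.map_cons, List.foldl_cons]
      rw [ih _ (hN _ _ hw), ← hact _ _ hw, hs, toQ_cons R a l, mul_assoc]
  let g' : Option β → List α := fun o => match o with | none => [] | some b => g b
  have hexp : ∀ x : List β, toQ R (expandW g' (none :: x.map some)) = evs R g x.reverse := by
    intro x
    rw [evs_eq, List.reverse_reverse]
    congr 1
    simp [expandW, g', Function.comp_def]
  let L : Set (List (Option β)) := {z | ∃ x : List β, NF ok x.reverse ∧ z = none :: x.map some}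
  have hdiag : RR (fun x y : List β => x = y ∧ NF ok x.reverse) := by
    have h0 : RR (fun x y : List β => ∃ k, x = pw [] k ∧ y = pw [] k) := RR.pw [] [] (Or.inr rfl)
    have := RR.restrict h0.common hreg hreg
    refine this.congr (fun x y => ?_)
    simp only [pw_nil]
    constructor
    · rintro ⟨⟨w, _, _, -, ⟨_, rfl, rfl⟩, rfl, rfl⟩, h, _⟩
      exact ⟨rfl, h⟩
    · rintro ⟨rfl, h⟩
      exact ⟨⟨x, [], [], by simp, ⟨0, rfl, rfl⟩, by simp, by simp⟩, h, h⟩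
  have hD := hdiag.opt
  have hRdiag : IsReg {p | ∃ x ∈ L, ∃ y ∈ L, WordEq R (expandW g' x) (expandW g' y) ∧ p = padR x y} := by
    convert hD using 1
    ext p
    constructor
    · rintro ⟨_, ⟨x, hx, rfl⟩, _, ⟨y, hy, rfl⟩, h, rfl⟩
      rw [← toQ_eq, hexp, hexp] at h
      have := huniq _ _ hx hy h
      rw [List.reverse_inj] at this
      subst this
      exact ⟨x, x, ⟨rfl, hx⟩, rfl⟩
    · rintro ⟨x, y, ⟨rfl, hx⟩, rfl⟩
      exact ⟨_, ⟨x, hx, rfl⟩, _, ⟨x, hx, rfl⟩, WordEq.refl' _ _, rfl⟩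
  refine ⟨Option β, inferInstance, g', L, ⟨⟨?_, ?_, ?_, hRdiag, ?_⟩, ?_⟩⟩
  · have := IsReg.mul (IsReg.single (none : Option β)) (IsReg.inter (hreg.filterMap (id : Option β → Option β))
      (IsReg.all (fun c : Option β => c ≠ none)))
    convert this using 1
    ext p
    constructor
    · rintro ⟨x, hx, rfl⟩
      refine ⟨_, rfl, x.map some, ⟨?_, ?_⟩, rfl⟩
      · simpa [List.filterMap_map] using hx
      · simp
    · rintro ⟨_, rfl, y, ⟨h1, h2⟩, rfl⟩
      refine ⟨_, h1, ?_⟩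
      simp only [List.cons_append, List.nil_append, List.cons.injEq, true_and]
      clear h1
      induction y with
      | nil => rfl
      | cons o y ih =>
        have h3 := ih (fun c hc => h2 c (List.mem_cons_of_mem _ hc))
        have h4 := h2 o List.mem_cons_self
        cases o with
        | none => exact absurd rfl h4
        | some b => simpa using h3
  · rintro w ⟨x, _, rfl⟩; simp
  · intro w
    refine ⟨none :: (nf w).reverse.map some, ⟨_, ?_, rfl⟩, ?_⟩
    · rw [List.reverse_reverse]; exact hNl _ _ (NF_nil _)
    · rw [← toQ_eq, hexp, List.reverse_reverse, hevs _ _ (NF_nil _)]; simp [evs]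
  · rintro (_ | b)
    · simpa [g'] using hRdiag
    · obtain ⟨ρ, h1, h2, h3⟩ := hgood b
      have := (RR.restrict h1 hreg hreg).opt
      convert this using 1
      ext p
      constructor
      · rintro ⟨_, ⟨x, hx, rfl⟩, _, ⟨y, hy, rfl⟩, h, rfl⟩
        rw [← toQ_eq, toQ_append, hexp, hexp] at h
        refine ⟨x, y, ⟨?_, hx, hy⟩, rfl⟩
        have h4 := hact _ b hx
        have : y.reverse = act x.reverse b := by
          refine huniq _ _ hy (hN _ _ hx) ?_
          rw [← h4, ← h]
        rw [this]
        exact h2 _ hx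
      · rintro ⟨x, y, ⟨h, hx, hy⟩, rfl⟩
        refine ⟨_, ⟨x, hx, rfl⟩, _, ⟨y, hy, rfl⟩, ?_, rfl⟩
        rw [← toQ_eq, toQ_append, hexp, hexp]
        exact h3 _ _ h
  · have := hD.union (IsReg.single ((some none, none) : Option (Option β) × Option (Option β)))
    convert this using 1
    ext p
    constructor
    · rintro ⟨_, ⟨x, hx, rfl⟩, y, ⟨_, ⟨z, hz, rfl⟩, hyz⟩, h, rfl⟩
      cases y with
      | nil =>
        right
        rw [← toQ_eq, hexp] at h
        have := huniq _ [] hx (NF_nil _) h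
        simp at this
        subst this
        simp
      | cons o y =>
        left
        rw [List.cons_prefix_cons] at hyz
        obtain ⟨rfl, t, ht⟩ := hyz
        obtain ⟨y, t, rfl, rfl, rfl⟩ := List.map_eq_append_iff.1 ht.symm
        rw [← toQ_eq, hexp, hexp] at h
        have hy : NF ok y.reverse := by
          rw [List.reverse_append] at hz
          exact NF_suffix _ _ _ hz
        have := huniq _ _ hx hy h
        rw [List.reverse_inj] at this
        subst this
        exact ⟨x, x, ⟨rfl, hx⟩, rfl⟩
    · rintro (⟨x, y, ⟨rfl, hx⟩, rfl⟩ | rfl)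
      · exact ⟨_, ⟨x, hx, rfl⟩, _, ⟨_, ⟨x, hx, rfl⟩, List.prefix_rfl⟩, WordEq.refl' _ _, rfl⟩
      · exact ⟨[none], ⟨[], by simp, rfl⟩, [], ⟨_, ⟨[], by simp, rfl⟩, by simp⟩, by
          simp [expandW, g']; exact WordEq.refl' _ _, by simp⟩

end KEY


section tools
variable {α β : Type}

theorem RR.snoc_fst {ρ : List β → List β → Prop} (h : RR ρ) (e : β) :
    RR (fun x y => ∃ x', ρ x' y ∧ x = x' ++ [e]) := by
  obtain ⟨σ, _, M, hM⟩ := h.dfa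
  let A : σ ⊕ σ ⊕ σ ⊕ Unit → Set (List (Option β × Option β)) := fun s => match s with
    | .inl q => {p | ∃ x y, M.evalFrom q (padR x y) ∈ M.accept ∧ p = padR (x ++ [e]) y}
    | .inr (.inl q) => {p | ∃ y, M.evalFrom q (padR [] y) ∈ M.accept ∧ p = padR [] y}
    | .inr (.inr (.inl q)) => {p | ∃ x, M.evalFrom q (padR x []) ∈ M.accept ∧ p = padR (x ++ [e]) []}
    | .inr (.inr (.inr _)) => {p | p = []}
  let step : σ ⊕ σ ⊕ σ ⊕ Unit → (Option β × Option β) → Set (σ ⊕ σ ⊕ σ ⊕ Unit) := fun s l => match s with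
    | .inl q => {t | (∃ c f, l = (some c, some f) ∧ t = .inl (M.step q l)) ∨
        (∃ f, l = (some e, some f) ∧ t = .inr (.inl (M.step q (none, some f)))) ∨
        (∃ c, l = (some c, none) ∧ t = .inr (.inr (.inl (M.step q l)))) ∨
        (l = (some e, none) ∧ q ∈ M.accept ∧ t = .inr (.inr (.inr ())))}
    | .inr (.inl q) => {t | ∃ f, l = (none, some f) ∧ t = .inr (.inl (M.step q l))}
    | .inr (.inr (.inl q)) => {t | (∃ c, l = (some c, none) ∧ t = .inr (.inr (.inl (M.step q l)))) ∨
        (l = (some e, none) ∧ q ∈ M.accept ∧ t = .inr (.inr (.inr ())))}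
    | .inr (.inr (.inr _)) => ∅
  have e0 : {p | ∃ x y, (∃ x', ρ x' y ∧ x = x' ++ [e]) ∧ p = padR x y} = A (.inl M.start) := by
    ext p
    simp only [A, Set.mem_ofPred_eq, ← hM]
    grind
  unfold RR
  rw [e0]
  refine reg_of_coalg A step ?_ (.inl M.start)
  rintro (q | q | q | _) l p
  · simp only [A, step, Set.mem_ofPred_eq]
    constructor
    · rintro ⟨x, y, h1, h2⟩
      rcases x with _ | ⟨c, x⟩ <;> rcases y with _ | ⟨f, y⟩
      · simp only [List.nil_append, padR_cons_nil, padR_nil_nil, List.cons.injEq] at h2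
        exact ⟨_, Or.inr (Or.inr (Or.inr ⟨h2.1, h1, rfl⟩)), h2.2⟩
      · simp only [List.nil_append, padR_cons_cons, List.cons.injEq] at h2
        rw [padR_nil_cons] at h1
        exact ⟨_, Or.inr (Or.inl ⟨f, h2.1, rfl⟩), y, h1, h2.2⟩
      · rw [List.cons_append, padR_cons_nil, List.cons.injEq] at h2
        rw [padR_cons_nil] at h1
        obtain ⟨rfl, h2⟩ := h2
        exact ⟨_, Or.inr (Or.inr (Or.inl ⟨c, rfl, rfl⟩)), x, h1, h2⟩
      · rw [List.cons_append, padR_cons_cons, List.cons.injEq] at h2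
        rw [padR_cons_cons] at h1
        obtain ⟨rfl, h2⟩ := h2
        exact ⟨_, Or.inl ⟨c, f, rfl, rfl⟩, x, y, h1, h2⟩
    · rintro ⟨t, ⟨c, f, rfl, rfl⟩ | ⟨f, rfl, rfl⟩ | ⟨c, rfl, rfl⟩ | ⟨rfl, hq, rfl⟩, h⟩
      · obtain ⟨x, y, h1, rfl⟩ := h
        exact ⟨c :: x, f :: y, by rw [padR_cons_cons]; exact h1, by simp⟩
      · obtain ⟨y, h1, rfl⟩ := h
        exact ⟨[], f :: y, by rw [padR_nil_cons]; exact h1, by simp⟩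
      · obtain ⟨x, h1, rfl⟩ := h
        exact ⟨c :: x, [], by rw [padR_cons_nil]; exact h1, by simp⟩
      · simp only [Set.mem_ofPred_eq] at h
        subst h
        exact ⟨[], [], hq, by simp⟩
  · simp only [A, step, Set.mem_ofPred_eq]
    constructor
    · rintro ⟨y, h1, h2⟩
      cases y with
      | nil => simp at h2
      | cons f y =>
        simp only [padR_nil_cons, List.cons.injEq] at h2 h1
        obtain ⟨rfl, h2⟩ := h2
        exact ⟨_, ⟨f, rfl, rfl⟩, y, h1, h2⟩
    · rintro ⟨t, ⟨f, rfl, rfl⟩, y, h1, rfl⟩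
      exact ⟨f :: y, by rw [padR_nil_cons]; exact h1, by simp⟩
  · simp only [A, step, Set.mem_ofPred_eq]
    constructor
    · rintro ⟨x, h1, h2⟩
      rcases x with _ | ⟨c, x⟩
      · simp only [List.nil_append, padR_cons_nil, padR_nil_nil, List.cons.injEq] at h2
        exact ⟨_, Or.inr ⟨h2.1, h1, rfl⟩, h2.2⟩
      · rw [List.cons_append, padR_cons_nil, List.cons.injEq] at h2
        rw [padR_cons_nil] at h1
        obtain ⟨rfl, h2⟩ := h2
        exact ⟨_, Or.inl ⟨c, rfl, rfl⟩, x, h1, h2⟩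
    · rintro ⟨t, ⟨c, rfl, rfl⟩ | ⟨rfl, hq, rfl⟩, h⟩
      · obtain ⟨x, h1, rfl⟩ := h
        exact ⟨c :: x, by rw [padR_cons_nil]; exact h1, by simp⟩
      · simp only [Set.mem_ofPred_eq] at h
        subst h
        exact ⟨[], hq, by simp⟩
  · simp [A, step]

theorem RRs.cons_fst {ρ : List β → List β → Prop} (h : RRs ρ) (e : β) :
    RRs (fun x y => ∃ x', ρ x' y ∧ x = e :: x') := by
  refine (RR.snoc_fst h e).congr (fun x y => ?_)
  constructor
  · rintro ⟨x', h, rfl⟩; exact ⟨x'.reverse, h, by simp⟩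
  · rintro ⟨x', h, h'⟩; exact ⟨x'.reverse, by simpa using h, by rw [← x.reverse_reverse, h']; simp⟩

theorem RRs.cons_snd {ρ : List β → List β → Prop} (h : RRs ρ) (e : β) :
    RRs (fun x y => ∃ y', ρ x y' ∧ y = e :: y') :=
  (RRs.cons_fst (ρ := fun x y => ρ y x) (RR.swap h) e : RRs _).swap

theorem RRs.congr {ρ ρ' : List β → List β → Prop} (h : RRs ρ) (e : ∀ x y, ρ x y ↔ ρ' x y) : RRs ρ' :=
  RR.congr h (fun _ _ => e _ _)

inductive Rl (s t : List β) (Tm : List (List β × List β)) : List β → List β → Prop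
  | term (q q' w : List β) : (q, q') ∈ Tm → Rl s t Tm (q ++ w) (q' ++ w)
  | step (x y : List β) : Rl s t Tm x y → Rl s t Tm (s ++ x) (t ++ y)

theorem Rl.rr [Finite β] (s t : List β) (h : s.length = t.length ∨ t = []) (Tm : List (List β × List β)) :
    RRs (Rl s t Tm) := by
  have := RRs.iUnion (fun i : Fin Tm.length => RRs.pat (Tm[i].1) (Tm[i].2) s t h)
  refine this.congr (fun x y => ?_)
  constructor
  · rintro ⟨i, k, w, rfl, rfl⟩
    induction k with
    | zero => exact Rl.term _ _ _ (by simp [pw])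
    | succ k ih =>
      have := Rl.step _ _ ih
      simpa [pw] using this
  · intro h
    induction h with
    | term q q' w hq =>
      obtain ⟨i, hi, e⟩ := List.getElem_of_mem hq
      exact ⟨⟨i, hi⟩, 0, w, by simp [pw, e], by simp [pw, e]⟩
    | step x y _ ih =>
      obtain ⟨i, k, w, rfl, rfl⟩ := ih
      exact ⟨i, k+1, w, by simp [pw], by simp [pw]⟩

theorem Rl.sound {R : Set (List α × List α)} {g : β → List α} {s t : List β} {Tm : List (List β × List β)}
    (m : Q R) (h1 : evs R g s * m = m * evs R g t)
    (h2 : ∀ q ∈ Tm, evs R g q.1 * m = evs R g q.2) {x y : List β} (h : Rl s t Tm x y) :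
    evs R g x * m = evs R g y := by
  induction h with
  | term q q' w hq =>
    rw [evs_append, evs_append, mul_assoc, h2 _ hq]
  | step x y _ ih =>
    rw [evs_append, evs_append, mul_assoc, h1, ← mul_assoc, ih]

theorem good_of_Rl [Finite β] {R : Set (List α × List α)} {g : β → List α} {ok : List β → β → Prop}
    {act : List β → β → List β} {c : β} (s t : List β) (Tm : List (List β × List β))
    (hst : s.length = t.length ∨ t = [])
    (h0 : ∀ w, NF ok w → Rl s t Tm w (act w c))
    (h1 : evs R g s * toQ R (g c) = toQ R (g c) * evs R g t)
    (h2 : ∀ q ∈ Tm, evs R g q.1 * toQ R (g c) = evs R g q.2) : Good R g ok act c :=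
  ⟨Rl s t Tm, Rl.rr s t hst Tm, h0, fun _ _ h => h.sound _ h1 h2⟩

theorem good_push [Finite β] {R : Set (List α × List α)} {g : β → List α} {ok : List β → β → Prop}
    {act : List β → β → List β} {c : β} (h : ∀ w, NF ok w → act w c = c :: w) : Good R g ok act c :=
  good_of_Rl [] [] [([], [c])] (Or.inl rfl)
    (fun w hw => by rw [h w hw]; exact Rl.term [] [c] w (by simp)) (by simp [evs]) (by simp [evs])

/-- image of a letter -/
def el (R : Set (List α × List α)) (a : α) : Q R := toQ R [a]
theorem toQ_cons' (R : Set (List α × List α)) (a : α) (x : List α) : toQ R (a :: x) = el R a * toQ R x := rfl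

abbrev sg : α → List α := fun a => [a]

theorem evs_sg (R : Set (List α × List α)) (x : List α) : evs R sg x = toQ R x.reverse := by
  rw [evs_eq]
  congr 1
  generalize x.reverse = y
  induction y with
  | nil => rfl
  | cons a y ih => simp [expandW, sg] at ih ⊢; exact ih
theorem evs_sg_cons (R : Set (List α × List α)) (a : α) (x : List α) : evs R sg (a :: x) = evs R sg x * el R a := rfl
theorem evs_nil (R : Set (List α × List α)) (g : β → List α) : evs R g [] = 1 := rfl
theorem evs_cons (R : Set (List α × List α)) (g : β → List α) (a : β) (x : List β) :
    evs R g (a :: x) = evs R g x * toQ R (g a) := rfl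

theorem KEYa [Finite α] {u v : List α}
    (ok : List α → α → Prop) (act : List α → α → List α)
    (hreg : IsReg {x | NF ok x.reverse})
    (hok : ∀ w c, NF ok w → ok w c → act w c = c :: w)
    (hN : ∀ w c, NF ok w → NF ok (act w c))
    (hgood : ∀ c, Good {(u, v)} sg ok act c)
    (hrel : ∀ w, NF ok w → u.foldl act w = v.foldl act w) :
    MonPrefixAutomatic {(u, v)} :=
  KEY sg id (fun _ => rfl) ok act hreg hok hN hgood (by simpa using hrel) (by simp)

theorem F0 [Finite α] (u : List α) : MonPrefixAutomatic {(u, u)} := by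
  refine KEYa (fun _ _ => True) (fun w c => c :: w) (NF_reg_take 0 _ (by simp)) (by simp) (by simp)
    (fun c => good_push (by simp)) (by simp)

/-- forbidden-factor `ok` -/
def okF (d : β) (p : List β) : List β → β → Prop := fun w c => ¬ (c = d ∧ p <+: w)

theorem okF_reg [Finite β] (d : β) (p : List β) : IsReg {x | NF (okF d p) x.reverse} := by
  refine NF_reg_take p.length _ ?_
  intro c w
  unfold okF
  have : p <+: w ↔ p <+: w.take p.length := by
    simp [List.prefix_take_iff]
  rw [this]

open Classical in
/-- bounded reduction -/
noncomputable def actG0 (d : β) (p r : List β) (w : List β) (c : β) : List β :=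
  if c = d ∧ p <+: w then r ++ w.drop p.length else c :: w

theorem actG0_ok {d : β} {p r w : List β} {c : β} (h : okF d p w c) : actG0 d p r w c = c :: w := by
  unfold actG0; rw [if_neg h]

theorem foldl_push {ok : List β → β → Prop} {act : List β → β → List β}
    (hok : ∀ w c, NF ok w → ok w c → act w c = c :: w) (z w : List β) (h : NF ok (z ++ w)) :
    z.reverse.foldl act w = z ++ w := by
  induction z with
  | nil => rfl
  | cons c z ih =>
    rw [List.cons_append, NF_cons] at h
    rw [List.reverse_cons, List.foldl_append, ih h.2, List.foldl_cons, hok _ _ h.2 h.1]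
    rfl

theorem G0core [Finite α] (d : α) (p r : List α)
    (hp : ∀ w, NF (okF d p) w → NF (okF d p) (p ++ w))
    (hr : ∀ w, NF (okF d p) w → NF (okF d p) (r ++ w)) :
    MonPrefixAutomatic {(p.reverse ++ [d], r.reverse)} := by
  refine KEYa (okF d p) (actG0 d p r) (okF_reg d p) (fun w c _ h => actG0_ok h) ?_ ?_ ?_
  · intro w c hw
    unfold actG0
    split_ifs with h
    · obtain ⟨-, t, rfl⟩ := h
      simp only [List.drop_left]
      exact hr _ (NF_suffix _ _ _ hw)
    · exact ⟨h, hw⟩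
  · intro c
    by_cases hc : c = d
    · subst hc
      refine good_of_Rl [] [] [([], [c]), (p, r)] (Or.inl rfl) ?_ (by simp [evs]) ?_
      · intro w _
        unfold actG0
        split_ifs with h
        · obtain ⟨-, t, rfl⟩ := h
          simp only [List.drop_left]
          exact Rl.term p r t (by simp)
        · exact Rl.term [] [c] w (by simp)
      · simp only [List.mem_cons, List.not_mem_nil, or_false, forall_eq_or_imp, forall_eq]
        refine ⟨by simp [evs], ?_⟩
        rw [evs_sg, evs_sg, ← toQ_rel, ← toQ_append]
    · refine good_push (fun w _ => ?_)
      unfold actG0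
      rw [if_neg (fun h => hc h.1)]
  · intro w hw
    rw [List.foldl_append, foldl_push (fun w c _ h => actG0_ok h) _ _ (hp w hw),
      foldl_push (fun w c _ h => actG0_ok h) _ _ (hr w hw)]
    simp [actG0]

theorem G0_1 [Finite α] (l : α) (r : List α) (h : l ∉ r) : MonPrefixAutomatic {([l], r)} := by
  have := G0core l [] r.reverse (fun w h => h) (fun w hw => ?_)
  · simpa using this
  · have h' : l ∉ r.reverse := by simpa using h
    clear h
    revert h'
    generalize r.reverse = z
    intro h'
    induction z with
    | nil => exact hw
    | cons c z ih => simp at h'; refine ⟨?_, ih h'.2⟩; simp [okF]; tauto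

theorem G0_2 [Finite α] (l1 l2 : α) (r : List α) (h : l1 ≠ l2) (hr : r.length ≤ 3)
    (h1 : r[0]? ≠ some l2) (h2 : ¬ [l1, l2] <:+: r) : MonPrefixAutomatic {([l1, l2], r)} := by
  have := G0core l2 [l1] r.reverse (fun w hw => ?_) (fun w hw => ?_)
  · simpa using this
  · simp [okF, h, hw]
  · match r, hr with
    | [], _ => exact hw
    | [a], _ => simp at h1; simp [okF, hw, h1]
    | [a, b], _ =>
      simp [List.infix_cons_iff] at h1 h2
      simp [okF, hw, h1]; grind
    | [a, b, c], _ =>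
      simp [List.infix_cons_iff] at h1 h2
      simp [okF, hw, h1]; grind

theorem G0_3 [Finite α] (l1 l2 l3 : α) (r : List α) (h : l1 ≠ l3) (hr : r.length ≤ 3)
    (h1 : r[0]? ≠ some l3) (h2 : ¬ [l2, l3] <+: r) (h3 : r ≠ [l1, l2, l3]) :
    MonPrefixAutomatic {([l1, l2, l3], r)} := by
  have := G0core l3 [l2, l1] r.reverse (fun w hw => ?_) (fun w hw => ?_)
  · simpa using this
  · simp [okF, h, hw]; grind
  · match r, hr with
    | [], _ => exact hw
    | [a], _ => simp at h1; simp [okF, hw, h1]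
    | [a, b], _ =>
      simp at h1 h2
      simp [okF, hw, h1]; grind
    | [a, b, c], _ =>
      simp at h1 h2 h3
      simp [okF, hw, h1]; grind

end tools


section fam
variable {α β : Type}

open Classical in
/-- generic recursive reduction -/
noncomputable def Fr (s t q q' dflt : List β) (w : List β) : List β :=
  if h : s ≠ [] ∧ s <+: w then t ++ Fr s t q q' dflt (w.drop s.length)
  else if q <+: w then q' ++ w.drop q.length else dflt ++ w
termination_by w.length
decreasing_by
  obtain ⟨h1, h2⟩ := h
  have := List.length_pos_of_ne_nil h1
  have := h2.length_le
  simp; omega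

theorem Fr_step {s t q q' dflt : List β} (hs : s ≠ []) (w : List β) :
    Fr s t q q' dflt (s ++ w) = t ++ Fr s t q q' dflt w := by
  rw [Fr]; simp [hs]

theorem Fr_term {s t q q' dflt : List β} (w : List β) (h : s ≠ [] → ¬ s <+: q ++ w) :
    Fr s t q q' dflt (q ++ w) = q' ++ w := by
  rw [Fr, dif_neg (fun h' => h h'.1 h'.2)]; simp

theorem Fr_dflt {s t q q' dflt : List β} (w : List β) (h : s ≠ [] → ¬ s <+: w) (h' : ¬ q <+: w) :
    Fr s t q q' dflt w = dflt ++ w := by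
  rw [Fr, dif_neg (fun h' => h h'.1 h'.2)]; simp [h']

/-- case analysis principle -/
theorem Fr_ind {s t q q' dflt : List β} (P : List β → Prop)
    (h1 : ∀ w, s ≠ [] → P w → P (s ++ w))
    (h2 : ∀ w, (s ≠ [] → ¬ s <+: q ++ w) → Fr s t q q' dflt (q ++ w) = q' ++ w → P (q ++ w))
    (h3 : ∀ w, (s ≠ [] → ¬ s <+: w) → ¬ q <+: w → Fr s t q q' dflt w = dflt ++ w → P w) : ∀ w, P w := by
  intro w
  induction hn : w.length using Nat.strong_induction_on generalizing w with
  | _ n ih =>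
    by_cases h : s ≠ [] ∧ s <+: w
    · obtain ⟨hs, w', rfl⟩ := h
      have := List.length_pos_of_ne_nil hs
      exact h1 _ hs (ih w'.length (by rw [← hn]; simp; omega) w' rfl)
    · have h : s ≠ [] → ¬ s <+: w := fun h' h'' => h ⟨h', h''⟩
      by_cases hq : q <+: w
      · obtain ⟨w', rfl⟩ := hq
        exact h2 _ h (Fr_term _ h)
      · exact h3 _ h hq (Fr_dflt _ h hq)

theorem Fr_Rl (s t q q' dflt w : List β) :
    Rl s t [(q, q'), ([], dflt)] w (Fr s t q q' dflt w) := by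
  refine Fr_ind (s := s) (t := t) (q := q) (q' := q') (dflt := dflt)
    (fun w => Rl s t [(q, q'), ([], dflt)] w (Fr s t q q' dflt w)) ?_ ?_ ?_ w
  · intro w hs h
    rw [Fr_step hs]; exact Rl.step _ _ h
  · intro w _ h; rw [h]; exact Rl.term _ _ _ (by simp)
  · intro w _ _ h; rw [h]; exact Rl.term [] _ _ (by simp)

/-- the `ok` predicate of the recursive family -/
def okR (d : β) (s q : List β) : List β → β → Prop :=
  fun w c => c = d → (s ≠ [] → ¬ s <+: w) ∧ (q ≠ [] → ¬ q <+: w)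

theorem okR_reg [Finite β] (d : β) (s q : List β) : IsReg {x | NF (okR d s q) x.reverse} := by
  refine NF_reg_take (max s.length q.length) _ ?_
  intro c w
  unfold okR
  have : ∀ p : List β, p.length ≤ max s.length q.length →
      (p <+: w ↔ p <+: w.take (max s.length q.length)) := by
    intro p hp
    simp [List.prefix_take_iff]; intro _; simpa using hp
  rw [this s (by simp), this q (by simp)]

open Classical in
noncomputable def actR (d : β) (s t q q' : List β) (w : List β) (c : β) : List β :=
  if c = d then Fr s t q q' [d] w else c :: w

theorem actR_self {d : β} {s t q q' : List β} (w : List β) : actR d s t q q' w d = Fr s t q q' [d] w := by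
  simp [actR]
theorem actR_ne {d : β} {s t q q' : List β} (w : List β) {c : β} (h : c ≠ d) :
    actR d s t q q' w c = c :: w := by
  simp [actR, h]
theorem Fr_ok {d : β} {s t q q' : List β} (hq : q = [] → q' = [d]) (w : List β)
    (h : okR d s q w d) : Fr s t q q' [d] w = d :: w := by
  obtain ⟨h1, h2⟩ := h rfl
  by_cases hq' : q = []
  · subst hq'
    have := Fr_term (s := s) (t := t) (q := []) (q' := q') (dflt := [d]) w h1
    rw [hq rfl] at this ⊢; simpa using this
  · exact Fr_dflt _ h1 (h2 hq')

theorem actR_ok {d : β} {s t q q' : List β} (hq : q = [] → q' = [d]) (w : List β) (c : β)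
    (h : okR d s q w c) : actR d s t q q' w c = c :: w := by
  by_cases hc : c = d
  · subst hc; rw [actR_self, Fr_ok hq _ h]
  · exact actR_ne _ hc

theorem okR_NF_app {d : β} {s q : List β} (z w : List β) (hd : d ∉ z) (h : NF (okR d s q) w) :
    NF (okR d s q) (z ++ w) := by
  induction z with
  | nil => exact h
  | cons c z ih =>
    simp at hd
    exact ⟨fun h => absurd h.symm hd.1, ih hd.2⟩

theorem actR_push {d : β} {s t q q' : List β} (z w : List β) (hd : d ∉ z) :
    z.reverse.foldl (actR d s t q q') w = z ++ w := by
  induction z with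
  | nil => rfl
  | cons c z ih =>
    simp at hd
    rw [List.reverse_cons, List.foldl_append, ih hd.2, List.foldl_cons, actR_ne _ (fun h => hd.1 h.symm)]
    rfl

theorem FAM [Finite α] {u v : List α} (d : α) (s t q q' : List α)
    (hst : s.length = t.length ∨ t = []) (hq : q = [] → q' = [d])
    (hNt : ∀ w, NF (okR d s q) (s ++ w) → NF (okR d s q) (Fr s t q q' [d] w) →
      NF (okR d s q) (t ++ Fr s t q q' [d] w))
    (hNq : ∀ w, q ≠ [] → NF (okR d s q) (q ++ w) → NF (okR d s q) (q' ++ w))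
    (h1 : toQ {(u, v)} (s.reverse ++ [d]) = toQ {(u, v)} (d :: t.reverse))
    (h2 : toQ {(u, v)} (q.reverse ++ [d]) = toQ {(u, v)} q'.reverse)
    (hrel : (∀ w, NF (okR d s q) w → NF (okR d s q) (Fr s t q q' [d] w)) →
      ∀ w, NF (okR d s q) w → u.foldl (actR d s t q q') w = v.foldl (actR d s t q q') w) :
    MonPrefixAutomatic {(u, v)} := by
  have hF : ∀ w, NF (okR d s q) w → NF (okR d s q) (Fr s t q q' [d] w) := by
    refine Fr_ind (s := s) (t := t) (q := q) (q' := q') (dflt := [d]) _ ?_ ?_ ?_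
    · intro w hs ih h
      rw [Fr_step hs]
      exact hNt _ h (ih (NF_suffix _ _ _ h))
    · intro w h e hn
      rw [e]
      by_cases hq' : q = []
      · subst hq'
        rw [hq rfl]
        exact ⟨fun _ => ⟨h, by simp⟩, hn⟩
      · exact hNq w hq' hn
    · intro w h h' e hn
      rw [e]
      exact ⟨fun _ => ⟨h, fun _ => h'⟩, hn⟩
  refine KEYa (okR d s q) (actR d s t q q') (okR_reg d s q) (fun w c _ h => actR_ok hq w c h) ?_ ?_ (hrel hF)
  · intro w c hw
    by_cases hc : c = d
    · subst hc; rw [actR_self]; exact hF w hw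
    · rw [actR_ne _ hc]; exact ⟨fun h => absurd h hc, hw⟩
  · intro c
    by_cases hc : c = d
    · subst hc
      refine good_of_Rl s t [(q, q'), ([], [c])] hst (fun w _ => by rw [actR_self]; exact Fr_Rl _ _ _ _ _ _) ?_ ?_
      · rw [evs_sg, evs_sg, ← toQ_append, h1]; rfl
      · simp only [List.mem_cons, List.not_mem_nil, or_false, forall_eq_or_imp, forall_eq]
        refine ⟨?_, by simp [evs]⟩
        rw [evs_sg, evs_sg, ← h2, ← toQ_append]
    · exact good_push (fun w _ => actR_ne w hc)

/-- family A: `a a = S` -/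
theorem famA2 [Finite α] (a : α) (S : List α) (hS : S ≠ []) (ha : a ∉ S) :
    MonPrefixAutomatic {([a, a], S)} := by
  obtain ⟨S, rfl⟩ : ∃ z, S = z.reverse := ⟨S.reverse, by simp⟩
  have hS : S ≠ [] := by simpa using hS
  have ha : a ∉ S := by simpa using ha
  have hnp : ∀ w, ¬ S <+: a :: w := by
    intro w h; cases S with
    | nil => exact hS rfl
    | cons c S => rw [List.cons_prefix_cons] at h; simp [h.1] at ha
  have hrel := toQ_rel [a, a] S.reverse
  refine FAM a S S [a] S (Or.inl rfl) (by simp) (fun w _ h => okR_NF_app _ _ ha h)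
    (fun w _ h => okR_NF_app _ _ ha (NF_suffix _ _ _ h)) ?_ hrel ?_
  · rw [toQ_cons, toQ_append, ← hrel, ← toQ_append, ← toQ_append]; rfl
  · intro hF w hw
    rw [actR_push S w ha]
    simp only [List.foldl_cons, List.foldl_nil, actR_self]
    revert w
    refine Fr_ind (s := S) (t := S) (q := [a]) (q' := S) (dflt := [a]) _ ?_ ?_ ?_
    · intro w _ ih h
      rw [Fr_step hS, Fr_step hS, ih (NF_suffix _ _ _ h)]
    · intro w h e hn
      rw [e, Fr_step hS, Fr_ok (by simp) w hn.1]; rfl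
    · intro w h h' e hn
      rw [e, Fr_term _ (fun _ => hnp w)]

theorem famA3 [Finite α] (a : α) (S : List α) (hS : S ≠ []) (ha : a ∉ S) :
    MonPrefixAutomatic {([a, a, a], S)} := by
  obtain ⟨S, rfl⟩ : ∃ z, S = z.reverse := ⟨S.reverse, by simp⟩
  have hS : S ≠ [] := by simpa using hS
  have ha : a ∉ S := by simpa using ha
  have hnp : ∀ w, ¬ S <+: a :: w := by
    intro w h; cases S with
    | nil => exact hS rfl
    | cons c S => rw [List.cons_prefix_cons] at h; simp [h.1] at ha
  have hrel := toQ_rel [a, a, a] S.reverse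
  refine FAM a S S [a, a] S (Or.inl rfl) (by simp) (fun w _ h => okR_NF_app _ _ ha h)
    (fun w _ h => okR_NF_app _ _ ha (NF_suffix _ _ _ h)) ?_ hrel ?_
  · rw [toQ_cons, toQ_append, ← hrel, ← toQ_append, ← toQ_append]; rfl
  · intro hF w hw
    rw [actR_push S w ha]
    simp only [List.foldl_cons, List.foldl_nil, actR_self]
    revert w
    refine Fr_ind (s := S) (t := S) (q := [a, a]) (q' := S) (dflt := [a]) _ ?_ ?_ ?_
    · intro w _ ih h
      rw [Fr_step hS, Fr_step hS, Fr_step hS, ih (NF_suffix _ _ _ h)]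
    · intro w h e hn
      rw [e, Fr_step hS, Fr_step hS, Fr_ok (by simp) w hn.2.1, Fr_ok (by simp) (a :: w) hn.1]; rfl
    · intro w h h' e hn
      rw [e]
      by_cases hw : [a] <+: w
      · obtain ⟨w, rfl⟩ := hw
        have := Fr_term (s := S) (t := S) (q := [a, a]) (q' := S) (dflt := [a]) w (fun _ => hnp _)
        simp only [List.cons_append, List.nil_append] at this ⊢
        rw [this, Fr_step hS, Fr_ok (by simp) w hn.1]
      · have e2 : Fr S S [a, a] S [a] ([a] ++ w) = [a] ++ ([a] ++ w) := by
          refine Fr_dflt _ (fun _ => hnp _) ?_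
          intro h2
          simp only [List.cons_append, List.nil_append, List.cons_prefix_cons] at h2
          exact hw h2.2
        have := Fr_term (s := S) (t := S) (q := [a, a]) (q' := S) (dflt := [a]) w (fun _ => hnp _)
        simp only [List.cons_append, List.nil_append] at this e2 ⊢
        rw [e2, this]

theorem famB [Finite α] (a b : α) (hab : a ≠ b) (S : List α) (hS : S ≠ []) (ha : a ∉ S) :
    MonPrefixAutomatic {([a, b, a], S)} := by
  obtain ⟨S, rfl⟩ : ∃ z, S = z.reverse := ⟨S.reverse, by simp⟩
  have hS : S ≠ [] := by simpa using hS
  have ha : a ∉ S := by simpa using ha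
  have hnp : ∀ w, ¬ S <+: a :: w := by
    intro w h; cases S with
    | nil => exact hS rfl
    | cons c S => rw [List.cons_prefix_cons] at h; simp [h.1] at ha
  have hrel := toQ_rel [a, b, a] S.reverse
  refine FAM a (b :: S) (S ++ [b]) [b, a] S (Or.inl (by simp)) (by simp)
    (fun w _ h => okR_NF_app _ _ (by simp [ha, hab]) h)
    (fun w _ h => okR_NF_app _ _ ha (NF_suffix _ _ _ h)) ?_ hrel ?_
  · simp only [List.reverse_cons, List.reverse_append, List.append_assoc, List.reverse_nil, List.nil_append,
      List.cons_append]
    have e1 : toQ {([a, b, a], S.reverse)} (a :: b :: S.reverse) = toQ {([a, b, a], S.reverse)} ([a, b] ++ S.reverse) := rfl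
    rw [e1, toQ_append, toQ_append, ← hrel, ← toQ_append, ← toQ_append]; rfl
  · intro hF w hw
    rw [actR_push S w ha]
    simp only [List.foldl_cons, List.foldl_nil, actR_self, actR_ne _ hab.symm]
    revert w
    refine Fr_ind (s := b :: S) (t := S ++ [b]) (q := [b, a]) (q' := S) (dflt := [a]) _ ?_ ?_ ?_
    · intro w _ ih h
      rw [Fr_step (by simp)]
      have := Fr_step (s := b :: S) (t := S ++ [b]) (q := [b, a]) (q' := S) (dflt := [a]) (by simp)
        (b :: Fr (b :: S) (S ++ [b]) [b, a] S [a] w)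
      rw [ih (NF_suffix _ _ _ h)] at this
      simp at this ⊢
      exact this
    · intro w h e hn
      rw [e]
      have := Fr_step (s := b :: S) (t := S ++ [b]) (q := [b, a]) (q' := S) (dflt := [a]) (by simp) w
      rw [Fr_ok (by simp) w hn.2.1] at this
      simp at this ⊢
      exact this
    · intro w h h' e hn
      rw [e]
      exact Fr_term (s := b :: S) (t := S ++ [b]) (q := [b, a]) (q' := S) (dflt := [a]) w
        (by intro _ h; simp at h; exact hnp _ h)

end fam


section fam2
variable {α β : Type}

open Classical in
theorem Fr_nil (t q q' dflt w : List β) :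
    Fr [] t q q' dflt w = if q <+: w then q' ++ w.drop q.length else dflt ++ w := by
  rw [Fr]; simp

theorem famP2 [Finite α] (a : α) (r : List α) (hr : r = [] ∨ r = [a]) :
    MonPrefixAutomatic {([a, a], r)} := by
  classical
  refine FAM a [] [] [a] r (Or.inl rfl) (by simp) (fun w _ h => by simpa using h) ?_ (by simp) ?_ ?_
  · intro w _ h
    rcases hr with rfl | rfl
    · exact h.2
    · exact h
  · have := toQ_rel [a, a] r
    rcases hr with rfl | rfl <;> exact this
  · intro _ w hw
    rcases hr with rfl | rfl
    · simp only [List.foldl_cons, List.foldl_nil, actR_self]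
      cases w with
      | nil => simp [Fr_nil]
      | cons x w =>
        by_cases hx : a = x
        · subst hx
          have h2 := (hw.1 rfl).2
          have h2 : ¬ [a] <+: w := h2 (by simp)
          simp [Fr_nil, h2]
        · simp [Fr_nil, hx]
    · simp only [List.foldl_cons, List.foldl_nil, actR_self]
      cases w with
      | nil => simp [Fr_nil]
      | cons x w =>
        by_cases hx : a = x
        · subst hx
          simp [Fr_nil]
        · simp [Fr_nil, hx]

theorem famP3 [Finite α] (a : α) (r : List α) (hr : r = [] ∨ r = [a] ∨ r = [a, a]) :
    MonPrefixAutomatic {([a, a, a], r)} := by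
  classical
  refine FAM a [] [] [a, a] r (Or.inl rfl) (by simp) (fun w _ h => by simpa using h) ?_ (by simp) ?_ ?_
  · intro w _ h
    rcases hr with rfl | rfl | rfl
    · exact h.2.2
    · exact h.2
    · exact h
  · have := toQ_rel [a, a, a] r
    rcases hr with rfl | rfl | rfl <;> exact this
  · intro _ w hw
    have key : (¬ [a] <+: w) ∨ (∃ w', w = a :: w' ∧ ¬ [a] <+: w') ∨ (∃ w', w = a :: a :: w' ∧ ¬ [a] <+: w') := by
      by_cases h1 : [a] <+: w
      · obtain ⟨w, rfl⟩ := h1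
        by_cases h2 : [a] <+: w
        · obtain ⟨w, rfl⟩ := h2
          by_cases h3 : [a] <+: w
          · obtain ⟨w, rfl⟩ := h3
            exact absurd ⟨w, rfl⟩ ((hw.1 rfl).2 (by simp))
          · exact Or.inr (Or.inr ⟨w, rfl, h3⟩)
        · exact Or.inr (Or.inl ⟨w, rfl, h2⟩)
      · exact Or.inl h1
    have aux : ∀ w : List α, ¬ [a] <+: w → ¬ [a, a] <+: w := by
      rintro _ h ⟨w, rfl⟩; exact h ⟨a :: w, rfl⟩
    rcases key with h | ⟨w, rfl, h⟩ | ⟨w, rfl, h⟩ <;> have := aux _ h <;>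
    rcases hr with rfl | rfl | rfl <;>
    simp [actR_self, Fr_nil, List.cons_prefix_cons, h, this]

theorem G1core [Finite α] (d : α) (p t : List α) (hpt : p.length = t.length ∨ t = []) (hp0 : p ≠ [])
    (hp : ∀ w, NF (okR d p []) w → NF (okR d p []) (p ++ w))
    (ht : ∀ w, NF (okR d p []) (Fr p t [] [d] [d] w) → NF (okR d p []) (t ++ Fr p t [] [d] [d] w)) :
    MonPrefixAutomatic {(p.reverse ++ [d], d :: t.reverse)} := by
  refine FAM d p t [] [d] hpt (by simp) (fun w _ h => ht w h) (by simp) (toQ_rel _ _) (by simp) ?_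
  intro hF w hw
  have hok : ∀ w c, NF (okR d p []) w → okR d p [] w c → actR d p t [] [d] w c = c :: w :=
    fun w c _ h => actR_ok (by simp) w c h
  rw [List.foldl_append, foldl_push hok _ _ (hp w hw), List.foldl_cons, List.foldl_nil, actR_self,
    List.foldl_cons, actR_self, Fr_step hp0, foldl_push hok _ _ (ht w (hF w hw))]

/-- shape of the result -/
theorem Fr_shape (p t : List α) (d : α) (w : List α) :
    (∃ w', Fr p t [] [d] [d] w = d :: w') ∨ (p ≠ [] ∧ ∃ w', Fr p t [] [d] [d] w = t ++ Fr p t [] [d] [d] w') := by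
  revert w
  refine Fr_ind (s := p) (t := t) (q := []) (q' := [d]) (dflt := [d]) _ ?_ ?_ ?_
  · intro w hp _
    exact Or.inr ⟨hp, w, Fr_step hp w⟩
  · intro w _ e
    exact Or.inl ⟨_, e⟩
  · intro w _ _ e
    exact Or.inl ⟨_, e⟩

theorem G1_1 [Finite α] (l d : α) (h : l ≠ d) : MonPrefixAutomatic {([l, d], [d])} := by
  refine G1core d [l] [] (Or.inr rfl) (by simp) ?_ ?_
  · intro w hw; exact ⟨fun e => absurd e h, hw⟩
  · intro w h; exact h

theorem G1_2 [Finite α] (l d x : α) (h : l ≠ d) : MonPrefixAutomatic {([l, d], [d, x])} := by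
  refine G1core d [l] [x] (Or.inl rfl) (by simp) ?_ ?_
  · intro w hw; exact ⟨fun e => absurd e h, hw⟩
  · intro w hw
    refine ⟨?_, hw⟩
    rintro rfl
    refine ⟨fun _ => ?_, by simp⟩
    rcases Fr_shape [l] [x] x w with ⟨w', e⟩ | ⟨_, w', e⟩ <;>
    · change Fr [l] [x] [] [x] [x] w = _ at e
      show ¬ [l] <+: Fr [l] [x] [] [x] [x] w
      rw [e]; simp [h]

theorem G1_3 [Finite α] (l1 l2 d : α) (h : l1 ≠ d) : MonPrefixAutomatic {([l1, l2, d], [d])} := by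
  refine G1core d [l2, l1] [] (Or.inr rfl) (by simp) ?_ ?_
  · intro w hw; 
    refine ⟨?_, fun e => absurd e h, hw⟩
    rintro rfl
    simp [List.cons_prefix_cons, h.symm]
  · intro w h; exact h

theorem G1_4 [Finite α] (l1 l2 d r2 r3 : α) (h : l1 ≠ d) (h' : ¬ (l2 = d ∧ r2 = d)) :
    MonPrefixAutomatic {([l1, l2, d], [d, r2, r3])} := by
  refine G1core d [l2, l1] [r3, r2] (Or.inl rfl) (by simp) ?_ ?_
  · intro w hw; 
    refine ⟨?_, fun e => absurd e h, hw⟩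
    rintro rfl
    simp [List.cons_prefix_cons, h.symm]
  · intro w hw
    have := Fr_shape [l2, l1] [r3, r2] d w
    refine ⟨?_, ?_, hw⟩
    · rintro rfl
      refine ⟨fun _ => ?_, by simp⟩
      show ¬ [l2, l1] <+: r2 :: Fr [l2, l1] [r3, r2] [] [r3] [r3] w
      rcases this with ⟨w', e⟩ | ⟨_, w', e⟩ <;>
      · rw [e]; simp [List.cons_prefix_cons, h]
    · rintro rfl
      refine ⟨fun _ => ?_, by simp⟩
      show ¬ [l2, l1] <+: Fr [l2, l1] [r3, r2] [] [r2] [r2] w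
      rcases this with ⟨w', e⟩ | ⟨_, w', e⟩ <;>
      · rw [e]; simp [List.cons_prefix_cons]; try tauto

theorem G1' [Finite α] (a b : α) (hab : a ≠ b) (t : List α) (ht : t = [] ∨ ∃ x, x ≠ b ∧ t = [a, x]) :
    MonPrefixAutomatic {([a, b, a], a :: t.reverse)} := by
  have hlt : [b, a].length = t.length ∨ t = [] := by rcases ht with rfl | ⟨x, _, rfl⟩ <;> simp
  have hst : ∀ w, ∃ z, Fr [b, a] t [] [a] [a] w = a :: z := by
    refine Fr_ind (s := [b, a]) (t := t) (q := []) (q' := [a]) (dflt := [a]) _ ?_ ?_ ?_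
    · intro w hp ⟨z, hz⟩
      rw [Fr_step hp, hz]
      rcases ht with rfl | ⟨x, _, rfl⟩ <;> simp
    · intro w _ e; exact ⟨_, e⟩
    · intro w _ _ e; exact ⟨_, e⟩
  have hNt : ∀ w, NF (okR a [b, a] []) (Fr [b, a] t [] [a] [a] w) →
      NF (okR a [b, a] []) (t ++ Fr [b, a] t [] [a] [a] w) := by
    intro w hw
    rcases ht with rfl | ⟨x, hx, rfl⟩
    · exact hw
    · refine ⟨?_, ?_, hw⟩
      · intro _
        exact ⟨fun _ => by simp [List.cons_prefix_cons, hx.symm], by simp⟩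
      · intro _
        obtain ⟨z, hz⟩ := hst w
        refine ⟨fun _ => ?_, by simp⟩
        show ¬ [b, a] <+: Fr [b, a] [a, x] [] [a] [a] w
        rw [hz]; simp [List.cons_prefix_cons, hab.symm]
  have hok : ∀ w c, NF (okR a [b, a] []) w → okR a [b, a] [] w c → actR a [b, a] t [] [a] w c = c :: w :=
    fun w c _ h => actR_ok (by simp) w c h
  refine FAM a [b, a] t [] [a] hlt (by simp) (fun w _ h => hNt w h) (by simp) ?_ (by simp) ?_
  · exact toQ_rel _ _
  · intro hF w hw
    have key : ∀ w, ∀ z, Fr [b, a] t [] [a] [a] w = a :: z → Fr [b, a] t [] [a] [a] z = a :: z := by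
      refine Fr_ind (s := [b, a]) (t := t) (q := []) (q' := [a]) (dflt := [a]) _ ?_ ?_ ?_
      · intro w hp ih z hz
        rw [Fr_step hp] at hz
        rcases ht with rfl | ⟨x, hx, rfl⟩
        · exact ih z hz
        · simp at hz
          subst hz
          exact Fr_term (q := []) (q' := [a]) _ (fun _ => by simp [List.cons_prefix_cons, hx.symm])
      · intro w h e z hz
        rw [e] at hz
        simp at hz; subst hz
        exact e
      · intro w _ h e z hz
        simp at h
    rw [List.foldl_cons (l := t.reverse), actR_self, foldl_push hok _ _ (hNt w (hF w hw))]
    simp only [List.foldl_cons, List.foldl_nil, actR_self, actR_ne _ hab.symm]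
    obtain ⟨z, hz⟩ := hst w
    rw [hz, ← key w z hz]
    have := Fr_step (s := [b, a]) (t := t) (q := []) (q' := [a]) (dflt := [a]) (by simp) z
    rw [key w z hz] at this ⊢
    exact this

open Classical in
noncomputable def actG2 (l1 l2 l3 : α) (r : List α) (w : List α) (c : α) : List α :=
  if c = l3 ∧ [l2] <+: w then Fr [l1] r [] [l3, l2] [l3, l2] w.tail else c :: w

theorem G2 [Finite α] (l1 l2 l3 : α) (r : List α) (h13 : l1 ≠ l3) (h23 : l2 ≠ l3) (hr : r = [] ∨ ∃ x, r = [x]) :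
    MonPrefixAutomatic {([l1, l2, l3], l2 :: l3 :: r)} := by
  have hlt : [l1].length = r.length ∨ r = [] := by rcases hr with rfl | ⟨x, rfl⟩ <;> simp
  have hst : ∀ w, NF (okR l3 [l2, l1] []) w → (∃ z, Fr [l1] r [] [l3, l2] [l3, l2] w = l3 :: z) ∨
      (∃ z x, r = [x] ∧ Fr [l1] r [] [l3, l2] [l3, l2] w = x :: z) := by
    refine Fr_ind (s := [l1]) (t := r) (q := []) (q' := [l3, l2]) (dflt := [l3, l2]) _ ?_ ?_ ?_
    · intro w hp ih hw
      rw [Fr_step hp]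
      rcases hr with rfl | ⟨x, rfl⟩
      · exact ih hw.2
      · exact Or.inr ⟨_, x, rfl, rfl⟩
    · intro w _ e _; exact Or.inl ⟨_, e⟩
    · intro w _ _ e _; exact Or.inl ⟨_, e⟩
  have hNr : ∀ w, NF (okR l3 [l2, l1] []) w → NF (okR l3 [l2, l1] []) (Fr [l1] r [] [l3, l2] [l3, l2] w) →
      NF (okR l3 [l2, l1] []) (r ++ Fr [l1] r [] [l3, l2] [l3, l2] w) := by
    intro w hw h
    rcases hr with rfl | ⟨x, rfl⟩
    · exact h
    · refine ⟨?_, h⟩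
      rintro rfl
      refine ⟨fun _ => ?_, by simp⟩
      show ¬ [l2, l1] <+: Fr [l1] [x] [] [x, l2] [x, l2] w
      rcases hst w hw with ⟨z, e⟩ | ⟨z, y, hy, e⟩
      · rw [e]; simp [List.cons_prefix_cons, h23]
      · simp at hy; subst hy
        rw [e]; simp [List.cons_prefix_cons, h23]
  have hF : ∀ w, NF (okR l3 [l2, l1] []) w → NF (okR l3 [l2, l1] []) (Fr [l1] r [] [l3, l2] [l3, l2] w) := by
    refine Fr_ind (s := [l1]) (t := r) (q := []) (q' := [l3, l2]) (dflt := [l3, l2]) _ ?_ ?_ ?_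
    · intro w hp ih hw
      rw [Fr_step hp]
      exact hNr w hw.2 (ih hw.2)
    · intro w h e hw
      rw [e]
      refine ⟨fun _ => ⟨fun _ => ?_, by simp⟩, fun e => absurd e h23, hw⟩
      have := h (by simp)
      simpa [List.cons_prefix_cons] using this
    · intro w _ h e hw
      simp at h
  have hact : ∀ w, actG2 l1 l2 l3 r (l2 :: w) l3 = Fr [l1] r [] [l3, l2] [l3, l2] w := by
    intro w; simp [actG2]
  have hok : ∀ w c, NF (okR l3 [l2, l1] []) w → okR l3 [l2, l1] [] w c → actG2 l1 l2 l3 r w c = c :: w := by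
    intro w c _ h
    unfold actG2
    split_ifs with h'
    · obtain ⟨rfl, w, rfl⟩ := h'
      have := (h rfl).1 (by simp)
      exact Fr_term (q := []) (q' := [c, l2]) _ (fun _ => by simpa [List.cons_prefix_cons] using this)
    · rfl
  refine KEYa (okR l3 [l2, l1] []) (actG2 l1 l2 l3 r) (okR_reg _ _ _) hok ?_ ?_ ?_
  · intro w c hw
    unfold actG2
    split_ifs with h
    · obtain ⟨rfl, w, rfl⟩ := h
      exact hF _ hw.2
    · refine ⟨?_, hw⟩
      rintro rfl
      refine ⟨?_, by simp⟩
      rintro - ⟨z, rfl⟩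
      exact h ⟨rfl, l1 :: z, rfl⟩
  · intro c
    by_cases hc : c = l3
    · subst hc
      refine ⟨_, ((Rl.rr [l1] r hlt [([], [c, l2]), ([], [c, l2])]).cons_fst l2).union
        (Rl.rr [] [] (Or.inl rfl) [([], [c])]), ?_, ?_⟩
      · intro w _
        unfold actG2
        split_ifs with h
        · obtain ⟨-, w, rfl⟩ := h
          exact Or.inl ⟨w, Fr_Rl _ _ _ _ _ _, rfl⟩
        · exact Or.inr (Rl.term [] [c] w (by simp))
      · rintro x y (⟨x, h, rfl⟩ | h)
        · rw [evs_cons, mul_assoc]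
          refine h.sound _ ?_ ?_
          · rw [evs_sg, evs_sg]
            have := toQ_rel [l1, l2, c] (l2 :: c :: r)
            rcases hr with rfl | ⟨x, rfl⟩ <;> exact this
          · simp [evs]
        · exact h.sound _ (by simp [evs]) (by simp [evs])
    · exact good_push (fun w _ => by simp [actG2, hc])
  · intro w hw
    have p1 : ∀ w c, c ≠ l3 → actG2 l1 l2 l3 r w c = c :: w := fun w c h => by simp [actG2, h]
    simp only [List.foldl_cons, List.foldl_nil]
    rw [p1 _ l1 h13, p1 _ l2 h23, p1 _ l2 h23, hact, hact]
    have := Fr_step (s := [l1]) (t := r) (q := []) (q' := [l3, l2]) (dflt := [l3, l2]) (by simp) w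
    have hr' : r = r.reverse := by rcases hr with rfl | ⟨x, rfl⟩ <;> simp
    have h5 := foldl_push hok _ _ (hNr w hw (hF w hw))
    rw [← hr'] at h5
    rw [h5]
    exact this
end fam2


set_option linter.unusedSimpArgs false
set_option linter.unusedVariables false
set_option linter.unusedTactic false
set_option linter.unreachableTactic false
section fin
variable {α β : Type}

open Classical in
/-- act by the first matching rule -/
noncomputable def actL : List (List β × List β) → List β → List β → List β
  | [], dflt, _ => dflt
  | (p, r) :: l, dflt, w => if p <+: w then r ++ w.drop p.length else actL l dflt w

theorem actL_cons_app (p r : List β) (l : List (List β × List β)) (d w : List β) :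
    actL ((p, r) :: l) d (p ++ w) = r ++ w := by simp [actL]

theorem actL_skip (p r : List β) (l : List (List β × List β)) (d w : List β) (h : ¬ p <+: w) :
    actL ((p, r) :: l) d w = actL l d w := by simp [actL, h]

noncomputable def actF (Ru : β → List (List β × List β)) (w : List β) (c : β) : List β :=
  actL (Ru c) (c :: w) w

def okU (Ru : β → List (List β × List β)) (w : List β) (c : β) : Prop := ∀ pr ∈ Ru c, ¬ pr.1 <+: w

theorem actL_ok (l : List (List β × List β)) (d w : List β) (h : ∀ pr ∈ l, ¬ pr.1 <+: w) : actL l d w = d := by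
  induction l with
  | nil => rfl
  | cons pr l ih =>
    simp at h
    rw [actL_skip _ _ _ _ _ h.1, ih]
    simpa using h.2

theorem actL_cases (l : List (List β × List β)) (d w : List β) :
    (actL l d w = d ∧ ∀ pr ∈ l, ¬ pr.1 <+: w) ∨ ∃ p r z, (p, r) ∈ l ∧ w = p ++ z ∧ actL l d w = r ++ z := by
  induction l with
  | nil => exact Or.inl ⟨rfl, by simp⟩
  | cons pr l ih =>
    obtain ⟨p, r⟩ := pr
    by_cases h : p <+: w
    · obtain ⟨z, rfl⟩ := h
      exact Or.inr ⟨p, r, z, by simp, rfl, actL_cons_app _ _ _ _ _⟩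
    · rw [actL_skip _ _ _ _ _ h]
      rcases ih with ⟨h1, h2⟩ | ⟨p, r, z, h1, h2, h3⟩
      · exact Or.inl ⟨h1, by intro pr hp; rcases List.mem_cons.1 hp with rfl | hp; exacts [h, h2 _ hp]⟩
      · exact Or.inr ⟨p, r, z, by simp [h1], h2, h3⟩

/-- finite rule systems on an alphabet with extra generators -/
theorem FIN [Finite β] {u v : List α} (g : β → List α) (s : α → β) (hs : ∀ a, g (s a) = [a])
    (Ru : β → List (List β × List β)) (K : ℕ) (hK : ∀ c, ∀ pr ∈ Ru c, pr.1.length ≤ K)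
    (hN : ∀ w c, NF (okU Ru) w → NF (okU Ru) (actF Ru w c))
    (hsound : ∀ c, ∀ pr ∈ Ru c, evs {(u, v)} g pr.1 * toQ {(u, v)} (g c) = evs {(u, v)} g pr.2)
    (hrel : ∀ w, NF (okU Ru) w → (u.map s).foldl (actF Ru) w = (v.map s).foldl (actF Ru) w)
    (hgen : ∀ w c, NF (okU Ru) w → ((g c).map s).foldl (actF Ru) w = actF Ru w c) :
    MonPrefixAutomatic {(u, v)} := by
  refine KEY g s hs (okU Ru) (actF Ru) ?_ ?_ hN ?_ hrel hgen
  · refine NF_reg_take K _ ?_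
    intro c w
    unfold okU
    refine forall_congr' fun pr => forall_congr' fun h => not_congr ?_
    simp [List.prefix_take_iff]; intro _; exact hK c pr h
  · intro w c _ h; exact actL_ok _ _ _ h
  · intro c
    refine good_of_Rl [] [] (([], [c]) :: Ru c) (Or.inl rfl) ?_ (by simp [evs]) ?_
    · intro w _
      unfold actF
      rcases actL_cases (Ru c) (c :: w) w with ⟨h, _⟩ | ⟨p, r, z, h, rfl, e⟩
      · rw [h]; exact Rl.term [] [c] w (by simp)
      · rw [e]; exact Rl.term p r z (by simp [h])
    · rintro q hq
      rcases List.mem_cons.1 hq with rfl | h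
      · simp [evs]
      · exact hsound c q h

def gO (D : List α) : Option α → List α
  | none => D
  | some a => [a]

@[simp] theorem evs_gO_some (R : Set (List α × List α)) (D : List α) (a : α) (x : List (Option α)) :
    evs R (gO D) (some a :: x) = evs R (gO D) x * el R a := rfl
@[simp] theorem evs_gO_none (R : Set (List α × List α)) (D : List α) (x : List (Option α)) :
    evs R (gO D) (none :: x) = evs R (gO D) x * toQ R D := rfl
@[simp] theorem evs_nil_s (R : Set (List α × List α)) (g : β → List α) : evs R g [] = 1 := rfl
@[simp] theorem toQ_cons_s (R : Set (List α × List α)) (a : α) (x : List α) : toQ R (a :: x) = el R a * toQ R x := rfl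
@[simp] theorem toQ_nil_s (R : Set (List α × List α)) : toQ R [] = 1 := rfl
@[simp] theorem gO_none (D : List α) : gO D none = D := rfl
@[simp] theorem gO_some (D : List α) (a : α) : gO D (some a) = [a] := rfl

open Classical in
/-- aba = aa -/
theorem S6 [Finite α] (a b : α) (hab : a ≠ b) : MonPrefixAutomatic {([a, b, a], [a, a])} := by
  let Ru : Option α → List (List (Option α) × List (Option α)) := fun c =>
    if c = some b then [([some a], [none])] else if c = some a then [([none], [some a, some a])]
    else if c = none then [([none], [none, some a])] else []
  have Rb : Ru (some b) = [([some a], [none])] := by simp [Ru]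
  have Ra : Ru (some a) = [([none], [some a, some a])] := by simp [Ru, hab]
  have Rn : Ru none = [([none], [none, some a])] := by simp [Ru]
  have Rc : ∀ c, c ≠ some a → c ≠ some b → c ≠ none → Ru c = [] := by
    intro c h1 h2 h3; simp [Ru, h1, h2, h3]
  have cs : ∀ c : Option α, c = some a ∨ c = some b ∨ c = none ∨ Ru c = [] := by
    intro c
    by_cases h1 : c = some a; · exact Or.inl h1
    by_cases h2 : c = some b; · exact Or.inr (Or.inl h2)
    by_cases h3 : c = none; · exact Or.inr (Or.inr (Or.inl h3))
    exact Or.inr (Or.inr (Or.inr (Rc c h1 h2 h3)))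
  have tn : ∀ w : List (Option α), (∃ z, w = none :: z) ∨ ¬ [none] <+: w := by
    intro w; by_cases h : [none] <+: w
    · obtain ⟨z, rfl⟩ := h; exact Or.inl ⟨z, rfl⟩
    · exact Or.inr h
  have ta : ∀ w : List (Option α), (∃ z, w = some a :: z) ∨ ¬ [some a] <+: w := by
    intro w; by_cases h : [some a] <+: w
    · obtain ⟨z, rfl⟩ := h; exact Or.inl ⟨z, rfl⟩
    · exact Or.inr h
  refine FIN (gO [a, b]) some (fun _ => rfl) Ru 1 ?_ ?_ ?_ ?_ ?_
  · intro c; rcases cs c with rfl | rfl | rfl | h <;> simp [*]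
  · intro w c hw
    rcases cs c with rfl | rfl | rfl | h
    · rcases tn w with ⟨z, rfl⟩ | h
      · simp [okU, actF, actL, Ra, Rn] at hw ⊢; tauto
      · simp [okU, actF, actL, Ra, Rn, hw, h]
    · rcases ta w with ⟨z, rfl⟩ | h
      · simp [okU, actF, actL, Ra, Rb, Rn] at hw ⊢; tauto
      · simp [okU, actF, actL, Ra, Rb, Rn, hw, h]
    · rcases tn w with ⟨z, rfl⟩ | h
      · simp [okU, actF, actL, Ra, Rb, Rn] at hw ⊢; tauto
      · simp [okU, actF, actL, Ra, Rb, Rn, hw, h]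
    · simp [okU, actF, actL, h, hw]
  · intro c
    have hr := toQ_rel [a, b, a] [a, a]
    simp only [toQ_cons_s, toQ_nil_s, mul_one] at hr
    generalize hR : ({([a, b, a], [a, a])} : Set (List α × List α)) = R at hr ⊢
    rcases cs c with rfl | rfl | rfl | h
    · simp [Ra, mul_assoc]; simpa using hr
    · simp [Rb]
    · simp [Rn]
      rw [← mul_assoc, mul_assoc (el R a), hr]
      simp [mul_assoc]
    · simp [h]
  · intro w hw
    rcases tn w with ⟨z, rfl⟩ | h
    · simp [actF, actL, Ra, Rb]
    · simp [actF, actL, Ra, Rb, h]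
  · intro w c hw
    cases c with
    | some c => simp
    | none =>
      rcases tn w with ⟨z, rfl⟩ | h
      · simp [actF, actL, Ra, Rb, Rn]
      · simp [actF, actL, Ra, Rb, Rn, h]

open Classical in
/-- aba = 1 -/
theorem S1 [Finite α] (a b : α) (hab : a ≠ b) : MonPrefixAutomatic {([a, b, a], [])} := by
  let Ru : Option α → List (List (Option α) × List (Option α)) := fun c =>
    if c = some b then [([some a, some a], []), ([some a], [none]), ([], [none, none])]
    else if c = some a then [([none], [])]
    else if c = none then [([some a], [])] else []
  have Rb : Ru (some b) = [([some a, some a], []), ([some a], [none]), ([], [none, none])] := by simp [Ru]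
  have Ra : Ru (some a) = [([none], [])] := by simp [Ru, hab]
  have Rn : Ru none = [([some a], [])] := by simp [Ru]
  have Rc : ∀ c, c ≠ some a → c ≠ some b → c ≠ none → Ru c = [] := by
    intro c h1 h2 h3; simp [Ru, h1, h2, h3]
  have cs : ∀ c : Option α, c = some a ∨ c = some b ∨ c = none ∨ Ru c = [] := by
    intro c
    by_cases h1 : c = some a; · exact Or.inl h1
    by_cases h2 : c = some b; · exact Or.inr (Or.inl h2)
    by_cases h3 : c = none; · exact Or.inr (Or.inr (Or.inl h3))
    exact Or.inr (Or.inr (Or.inr (Rc c h1 h2 h3)))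
  have tt : ∀ w : List (Option α), NF (okU Ru) w → (∃ z, w = none :: z ∧ ¬ [some a] <+: z) ∨ 
      (∃ z, w = some a :: some a :: z ∧ ¬ [none] <+: z) ∨
      (∃ z, w = some a :: z ∧ ¬ [none] <+: z ∧ ¬ [some a] <+: z) ∨ 
      (¬ [none] <+: w ∧ ¬ [some a] <+: w) := by
    intro w hw; by_cases h : [none] <+: w
    · obtain ⟨z, rfl⟩ := h
      have := hw.1 ([some a], []) (by simp [Rn])
      exact Or.inl ⟨z, rfl, this⟩
    · by_cases h2 : [some a] <+: w
      · obtain ⟨z, rfl⟩ := h2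
        by_cases h3 : [some a] <+: z
        · obtain ⟨z, rfl⟩ := h3
          have := hw.2.1 ([none], []) (by simp [Ra])
          exact Or.inr (Or.inl ⟨z, rfl, this⟩)
        · have := hw.1 ([none], []) (by simp [Ra])
          exact Or.inr (Or.inr (Or.inl ⟨z, rfl, this, h3⟩))
      · exact Or.inr (Or.inr (Or.inr ⟨h, h2⟩))
  have aux : ∀ w : List (Option α), ¬ [some a] <+: w → ¬ [some a, some a] <+: w := by
      rintro _ h ⟨w, rfl⟩; exact h ⟨some a :: w, rfl⟩
  refine FIN (gO [a, b]) some (fun _ => rfl) Ru 2 ?_ ?_ ?_ ?_ ?_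
  · intro c; rcases cs c with rfl | rfl | rfl | h <;> simp [*]
  · intro w c hw
    rcases cs c with rfl | rfl | rfl | h
    · rcases tt w hw with ⟨z, rfl, h⟩ | ⟨z, rfl, h⟩ | ⟨z, rfl, h, h'⟩ | ⟨h, h'⟩ <;>
        simp [okU, actF, actL, Ra, Rb, Rn, List.cons_prefix_cons, *] at hw ⊢ <;> try tauto
    · rcases tt w hw with ⟨z, rfl, h⟩ | ⟨z, rfl, h⟩ | ⟨z, rfl, h, h'⟩ | ⟨h, h'⟩ <;>
        simp [okU, actF, actL, Ra, Rb, Rn, List.cons_prefix_cons, *] at hw ⊢ <;> try tauto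
    · rcases tt w hw with ⟨z, rfl, h⟩ | ⟨z, rfl, h⟩ | ⟨z, rfl, h, h'⟩ | ⟨h, h'⟩ <;>
        simp [okU, actF, actL, Ra, Rb, Rn, List.cons_prefix_cons, *] at hw ⊢ <;> try tauto
    · simp [okU, actF, actL, h, hw]
  · intro c
    have hr := toQ_rel [a, b, a] []
    simp only [toQ_cons_s, toQ_nil_s, mul_one] at hr
    generalize hR : ({([a, b, a], [])} : Set (List α × List α)) = R at hr ⊢
    have hr2 : el R a * el R b = el R b * el R a := by
      calc el R a * el R b = (el R a * el R b) * (el R a * (el R b * el R a)) := by rw [hr, mul_one]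
        _ = (el R a * (el R b * el R a)) * (el R b * el R a) := by simp only [mul_assoc]
        _ = _ := by rw [hr, one_mul]
    have hr3 : el R a * (el R a * el R b) = 1 := by rw [hr2, hr]
    rcases cs c with rfl | rfl | rfl | h
    · simp [Ra, mul_assoc]; simpa using hr
    · simp [Rb, mul_assoc, hr3]
      rw [← mul_assoc, ← mul_assoc, mul_assoc (el R a), hr, one_mul]
    · simp [Rn, hr3]
    · simp [h]
  · intro w hw
    rcases tt w hw with ⟨z, rfl, h⟩ | ⟨z, rfl, h⟩ | ⟨z, rfl, h, h'⟩ | ⟨h, h'⟩ <;>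
        simp [okU, actF, actL, Ra, Rb, Rn, List.cons_prefix_cons, *] at hw ⊢
  · intro w c hw
    cases c with
    | some c => simp
    | none =>
      rcases tt w hw with ⟨z, rfl, h⟩ | ⟨z, rfl, h⟩ | ⟨z, rfl, h, h'⟩ | ⟨h, h'⟩ <;>
        simp [okU, actF, actL, Ra, Rb, Rn, List.cons_prefix_cons, *] at hw ⊢
end fin

set_option linter.unusedSimpArgs false
set_option linter.unusedVariables false
set_option linter.unnecessarySeqFocus false
section sp
variable {α β : Type}

theorem Rl.sound2 {R : Set (List α × List α)} {g : β → List α} {s t : List β} {Tm : List (List β × List β)}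
    (m m' : Q R) (h1 : evs R g s * m = m * m') (h1' : evs R g t * m = m * m')
    (h2 : ∀ q ∈ Tm, evs R g q.1 * m = evs R g q.2 * m) {x y : List β} (h : Rl s t Tm x y) :
    evs R g x * m = evs R g y * m := by
  induction h with
  | term q q' w hq =>
    rw [evs_append, evs_append, mul_assoc, mul_assoc, h2 _ hq]
  | step x y _ ih =>
    rw [evs_append, evs_append, mul_assoc, mul_assoc, h1, h1', ← mul_assoc, ← mul_assoc, ih]

/-- act by pushing a letter after a recursive rewriting -/
theorem good_Fr_push [Finite β] {R : Set (List α × List α)} {g : β → List α} {ok : List β → β → Prop}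
    {act : List β → β → List β} {c : β} (s t q q' : List β) (m' : Q R) (hst : s.length = t.length ∨ t = [])
    (h0 : ∀ w, NF ok w → act w c = c :: Fr s t q q' [] w)
    (h1 : evs R g s * toQ R (g c) = toQ R (g c) * m') (h1' : evs R g t * toQ R (g c) = toQ R (g c) * m')
    (h2 : evs R g q * toQ R (g c) = evs R g q' * toQ R (g c)) : Good R g ok act c := by
  refine ⟨_, (Rl.rr s t hst [(q, q'), ([], [])]).cons_snd c, ?_, ?_⟩
  · intro w hw
    exact ⟨_, Fr_Rl s t q q' [] w, h0 w hw⟩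
  · rintro x _ ⟨y, h, rfl⟩
    exact h.sound2 _ m' h1 h1' (by simpa using h2)

open Classical in
/-- state for S2: 0 no b, 1: b a^even, 2: b a^odd -/
noncomputable def stB (a b : α) (s : Fin 3) (c : α) : Fin 3 :=
  if c = b then 1 else if c = a then (if s = 1 then 2 else if s = 2 then 1 else 0) else 0

noncomputable def stBw (a b : α) : List α → Fin 3
  | [] => 0
  | c :: w => stB a b (stBw a b w) c

open Classical in
/-- aab = bb -/
theorem S2 [Finite α] (a b : α) (hab : a ≠ b) : MonPrefixAutomatic {([a, a, b], [b, b])} := by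
  let st := stBw a b
  have sta : ∀ w, st (a :: w) = if st w = 1 then 2 else if st w = 2 then 1 else 0 := by
    intro w; simp [st, stBw, stB, hab]
  have stb : ∀ w, st (b :: w) = 1 := by intro w; simp [st, stBw, stB]
  have staa : ∀ w, st (a :: a :: w) = st w := by
    intro w; rw [sta, sta]; generalize st w = s; revert s; decide
  let ok : List α → α → Prop := fun w c => c = b → st w ≠ 1
  let h := Fr [a, a] [a, a] [b] [a, a] ([] : List α)
  have h_step : ∀ w, h (a :: a :: w) = a :: a :: h w := fun w => Fr_step (s := [a, a]) (by simp) w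
  have h_term : ∀ w, h (b :: w) = a :: a :: w := fun w =>
    Fr_term (q := [b]) w (by intro _ h; simp [List.cons_prefix_cons, hab] at h)
  let act : List α → α → List α := fun w c => if c = b then b :: h w else c :: w
  have actb : ∀ w, act w b = b :: h w := by intro w; simp [act]
  have actn : ∀ w c, c ≠ b → act w c = c :: w := by intro w c hc; simp [act, hc]
  have hid : ∀ w, st w ≠ 1 → h w = w := by
    refine Fr_ind (s := [a, a]) (t := [a, a]) (q := [b]) (q' := [a, a]) (dflt := []) _ ?_ ?_ ?_
    · intro w _ ih hw
      exact (h_step w).trans (by rw [ih (by rw [← staa]; exact hw)]; rfl)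
    · intro w _ _ hw; exact absurd (stb w) hw
    · intro w _ _ e _; exact e
  have hN : ∀ w, NF ok w → NF ok (h w) ∧ st (h w) ≠ 1 := by
    refine Fr_ind (s := [a, a]) (t := [a, a]) (q := [b]) (q' := [a, a]) (dflt := []) _ ?_ ?_ ?_
    · intro w _ ih hw
      have : h ([a, a] ++ w) = a :: a :: h w := h_step w
      rw [this, staa]
      have := ih hw.2.2
      exact ⟨⟨fun e => absurd e hab, fun e => absurd e hab, this.1⟩, this.2⟩
    · intro w _ _ hw
      have : h ([b] ++ w) = a :: a :: w := h_term w
      rw [this, staa]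
      exact ⟨⟨fun e => absurd e hab, fun e => absurd e hab, hw.2⟩, hw.1 rfl⟩
    · intro w h1 h2 e hw
      have : h w = w := e
      rw [this]
      refine ⟨hw, ?_⟩
      have h1 := h1 (by simp)
      cases w with
      | nil => simp [st, stBw]
      | cons x w =>
        by_cases hx : x = b
        · subst hx; simp at h2
        · by_cases hx : x = a
          · subst hx
            rw [sta]
            cases w with
            | nil => simp [st, stBw]
            | cons y w =>
              simp [List.cons_prefix_cons] at h1
              by_cases hy : y = b
              · subst hy; rw [stb]; decide
              · have h1' := Ne.symm h1; simp [st, stBw, stB, hy, h1']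
          · simp [st, stBw, stB, *]
  refine KEYa ok act ?_ ?_ ?_ ?_ ?_
  · exact NF_reg ok st (stB a b) (fun s c => c = b → s ≠ 1) (fun _ _ => rfl) (fun _ _ => Iff.rfl)
  · intro w c hw hc
    by_cases h1 : c = b
    · subst h1; rw [actb, hid w (hc rfl)]
    · exact actn _ _ h1
  · intro w c hw
    by_cases h1 : c = b
    · subst h1; rw [actb]; exact ⟨fun _ => (hN w hw).2, (hN w hw).1⟩
    · rw [actn _ _ h1]; exact ⟨fun e => absurd e h1, hw⟩
  · intro c
    by_cases h1 : c = b
    · subst h1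
      have hr := toQ_rel [a, a, c] [c, c]
      refine good_Fr_push [a, a] [a, a] [c] [a, a] (toQ _ [c]) (Or.inl rfl) (fun w _ => actb w) ?_ ?_ ?_
      · rw [evs_sg]; exact hr
      · rw [evs_sg]; exact hr
      · rw [evs_sg, evs_sg]; exact hr.symm
    · exact good_push (fun w _ => actn _ _ h1)
  · intro w hw
    simp only [List.foldl_cons, List.foldl_nil]
    rw [actn _ _ hab, actn _ _ hab, actb, actb, actb, h_step, h_term]

open Classical in
/-- state for S4: 0 other, 1: a on top, 2: a b^+ -/
noncomputable def stD (a b : α) (s : Fin 3) (c : α) : Fin 3 :=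
  if c = a then 1 else if c = b then (if s = 0 then 0 else 2) else 0

noncomputable def stDw (a b : α) : List α → Fin 3
  | [] => 0
  | c :: w => stD a b (stDw a b w) c

open Classical in
/-- aba = ab -/
theorem S4 [Finite α] (a b : α) (hab : a ≠ b) : MonPrefixAutomatic {([a, b, a], [a, b])} := by
  let st := stDw a b
  have sta : ∀ w, st (a :: w) = 1 := by intro w; simp [st, stDw, stD, hab]
  have stb : ∀ w, st (b :: w) = if st w = 0 then 0 else 2 := by intro w; simp [st, stDw, stD, hab.symm]
  let ok : List α → α → Prop := fun w c => c = a → st w ≠ 2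
  let act : List α → α → List α := fun w c => if c = a ∧ st w = 2 then w else c :: w
  have acta : ∀ w, st w = 2 → act w a = w := by intro w h; simp [act, h]
  have acta' : ∀ w, st w ≠ 2 → act w a = a :: w := by intro w h; simp [act, h]
  have actn : ∀ w c, c ≠ a → act w c = c :: w := by intro w c hc; simp [act, hc]
  refine KEYa ok act ?_ ?_ ?_ ?_ ?_
  · exact NF_reg ok st (stD a b) (fun s c => c = a → s ≠ 2) (fun _ _ => rfl) (fun _ _ => Iff.rfl)
  · intro w c hw hc
    by_cases h1 : c = a
    · subst h1; exact acta' w (hc rfl)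
    · exact actn _ _ h1
  · intro w c hw
    by_cases h1 : c = a
    · subst h1
      by_cases h2 : st w = 2
      · rw [acta _ h2]; exact hw
      · rw [acta' _ h2]; exact ⟨fun _ => h2, hw⟩
    · rw [actn _ _ h1]; exact ⟨fun e => absurd e h1, hw⟩
  · intro c
    by_cases h1 : c = a
    · subst h1
      refine ⟨_, (Rl.rr [b] [b] (Or.inl rfl) [([b, c], [b, c])]).union (Rl.rr [] [] (Or.inl rfl) [([], [c])]), ?_, ?_⟩
      · intro w hw
        clear hw
        by_cases h2 : st w = 2
        · rw [acta _ h2]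
          refine Or.inl ?_
          induction w with
          | nil => simp [st, stDw] at h2
          | cons x w ih =>
            by_cases hx : x = c
            · subst hx; rw [sta] at h2; simp at h2
            · by_cases hx' : x = b
              · subst hx'
                cases w with
                | nil => simp [st, stDw, stD, hx] at h2
                | cons y w =>
                  by_cases hy : y = c
                  · subst hy; exact Rl.term [x, y] [x, y] w (by simp)
                  · by_cases hy' : y = x
                    · subst hy'
                      refine Rl.step _ _ (ih ?_)
                      rw [stb] at h2 ⊢
                      split_ifs with h3
                      · rw [stb, if_pos h3] at h2; simp at h2
                      · rfl
                    · have : st (y :: w) = 0 := by simp [st, stDw, stD, hy, hy']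
                      rw [stb, this] at h2; simp at h2
              · simp [st, stDw, stD, hx, hx'] at h2
        · rw [acta' _ h2]
          exact Or.inr (Rl.term [] [c] w (by simp))
      · have hr := toQ_rel [c, b, c] [c, b]
        simp only [toQ_cons_s, toQ_nil_s, mul_one] at hr
        generalize hR : ({([c, b, c], [c, b])} : Set (List α × List α)) = R at hr ⊢
        rintro x y (h | h)
        · show evs R sg x * el R c = evs R sg y
          induction h with
          | term q q' w hq =>
            simp at hq
            obtain ⟨rfl, rfl⟩ := hq
            simp only [List.cons_append, List.nil_append, evs_sg_cons, mul_assoc, hr]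
          | step x y h ih =>
            simp only [List.cons_append, List.nil_append, evs_sg_cons]
            have e : x = y := by
              clear ih
              induction h with
              | term q q' w hq =>
                simp at hq
                obtain ⟨rfl, rfl⟩ := hq
                rfl
              | step x y h ih => rw [ih]
            subst e
            rw [← ih]
            simp only [mul_assoc]
            rw [hr]
        · exact h.sound _ (by simp [evs]) (by simp [evs])
    · exact good_push (fun w _ => actn _ _ h1)
  · intro w hw
    simp only [List.foldl_cons, List.foldl_nil]
    by_cases h2 : st w = 2
    · rw [acta _ h2, actn _ _ hab.symm, acta]
      rw [stb, h2]; rfl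
    · rw [acta' _ h2, actn _ _ hab.symm, acta]
      rw [stb, sta]; rfl

end sp

set_option linter.unusedSimpArgs false
set_option linter.unusedVariables false
set_option linter.unnecessarySeqFocus false
section sp2
variable {α β : Type}

/-- one finite rule -/
theorem good_rule [Finite β] {R : Set (List α × List α)} {g : β → List α} {ok : List β → β → Prop}
    {act : List β → β → List β} {c : β} (p r : List β)
    (h0 : ∀ w, NF ok w → (∃ z, w = p ++ z ∧ act w c = r ++ z) ∨ act w c = c :: w)
    (h : evs R g p * toQ R (g c) = evs R g r) : Good R g ok act c := by
  refine good_of_Rl [] [] [([], [c]), (p, r)] (Or.inl rfl) ?_ (by simp [evs]) (by simpa [evs] using h)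
  intro w hw
  rcases h0 w hw with ⟨z, rfl, e⟩ | e
  · rw [e]; exact Rl.term p r z (by simp)
  · rw [e]; exact Rl.term [] [c] w (by simp)

open Classical in
/-- state for S5: 0 other, 1: a on top, 2: d c^* -/
noncomputable def stE (a c : α) (s : Fin 3) (x : Option α) : Fin 3 :=
  if x = some a then 1 else if x = none then 2 else if x = some c then (if s = 2 then 2 else 0) else 0

noncomputable def stEw (a c : α) : List (Option α) → Fin 3
  | [] => 0
  | x :: w => stE a c (stEw a c w) x

open Classical in
/-- aba = ca -/
theorem S5 [Finite α] (a b c : α) (hab : a ≠ b) (hac : a ≠ c) (hbc : b ≠ c) :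
    MonPrefixAutomatic {([a, b, a], [c, a])} := by
  let st := stEw a c
  have sta : ∀ w, st (some a :: w) = 1 := by intro w; simp [st, stEw, stE]
  have stn : ∀ w, st (none :: w) = 2 := by intro w; simp [st, stEw, stE]
  have stc : ∀ w, st (some c :: w) = if st w = 2 then 2 else 0 := by intro w; simp [st, stEw, stE, hac.symm]
  let ok : List (Option α) → Option α → Prop := fun w x =>
    ((x = some a ∨ x = none) → st w ≠ 2) ∧ (x = some b → st w ≠ 1)
  have okc : ∀ w x, x ≠ some a → x ≠ none → x ≠ some b → ok w x := by
    intro w x h1 h2 h3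
    exact ⟨fun h => by simp_all, fun h => absurd h h3⟩
  let h := Fr [some c] [some c] [none] [some c] ([] : List (Option α))
  have h_step : ∀ w, h (some c :: w) = some c :: h w := fun w => Fr_step (s := [some c]) (by simp) w
  have h_term : ∀ w, h (none :: w) = some c :: w := fun w =>
    Fr_term (q := [none]) w (by intro _ h; simp [List.cons_prefix_cons] at h)
  let act : List (Option α) → Option α → List (Option α) := fun w x =>
    if x = some a ∨ x = none then x :: h w else if x = some b ∧ [some a] <+: w then none :: w.tail else x :: w
  have act1 : ∀ w x, x = some a ∨ x = none → act w x = x :: h w := by intro w x hx; simp [act, hx]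
  have act2 : ∀ w, act (some a :: w) (some b) = none :: w := by intro w; simp [act, hab.symm]
  have act3 : ∀ w, ¬ [some a] <+: w → act w (some b) = some b :: w := by
    intro w h; simp [act, hab.symm, h]
  have act4 : ∀ w x, x ≠ some a → x ≠ none → x ≠ some b → act w x = x :: w := by
    intro w x h1 h2 h3; simp [act, h1, h2, h3]
  have st1 : ∀ w, st w ≠ 1 → ¬ [some a] <+: w := by
    rintro w h ⟨z, rfl⟩; exact h (sta z)
  have hid : ∀ w, st w ≠ 2 → h w = w := by
    refine Fr_ind (s := [some c]) (t := [some c]) (q := [none]) (q' := [some c]) (dflt := []) _ ?_ ?_ ?_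
    · intro w _ ih hw
      refine (h_step w).trans ?_
      rw [ih]; rfl
      intro h; exact hw ((stc w).trans (by simp [h]))
    · intro w _ _ hw; exact absurd (stn w) hw
    · intro w _ _ e _; exact e
  have hN : ∀ w, NF ok w → NF ok (h w) ∧ st (h w) ≠ 2 := by
    refine Fr_ind (s := [some c]) (t := [some c]) (q := [none]) (q' := [some c]) (dflt := []) _ ?_ ?_ ?_
    · intro w _ ih hw
      have : h ([some c] ++ w) = some c :: h w := h_step w
      have h2 := ih hw.2
      rw [this, stc, if_neg h2.2]
      exact ⟨⟨okc _ _ (by simp [hac.symm]) (by simp) (by simp [hbc.symm]), h2.1⟩, by decide⟩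
    · intro w _ _ hw
      have : h ([none] ++ w) = some c :: w := h_term w
      have hw1 : st w ≠ 2 := hw.1.1 (Or.inr rfl)
      rw [this, stc, if_neg hw1]
      exact ⟨⟨okc _ _ (by simp [hac.symm]) (by simp) (by simp [hbc.symm]), hw.2⟩, by decide⟩
    · intro w h1 h2 e hw
      have : h w = w := e
      rw [this]
      refine ⟨hw, ?_⟩
      have h1 := h1 (by simp)
      cases w with
      | nil => simp [st, stEw]
      | cons x w =>
        by_cases hx : x = some a
        · subst hx; rw [sta]; decide
        · have hx1 : x ≠ none := by rintro rfl; simp at h2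
          have hx2 : x ≠ some c := by rintro rfl; simp at h1
          simp [st, stEw, stE, hx, hx1, hx2]
  refine KEY (gO [a, b]) some (fun _ => rfl) ok act ?_ ?_ ?_ ?_ ?_ ?_
  · exact NF_reg ok st (stE a c) (fun s x => ((x = some a ∨ x = none) → s ≠ 2) ∧ (x = some b → s ≠ 1))
      (fun _ _ => rfl) (fun _ _ => Iff.rfl)
  · intro w x hw hc
    by_cases h1 : x = some a ∨ x = none
    · rw [act1 _ _ h1, hid w (hc.1 h1)]
    · push Not at h1
      by_cases h2 : x = some b
      · subst h2; exact act3 _ (st1 _ (hc.2 rfl))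
      · exact act4 _ _ h1.1 h1.2 h2
  · intro w x hw
    by_cases h1 : x = some a ∨ x = none
    · rw [act1 _ _ h1]; exact ⟨⟨fun _ => (hN w hw).2, fun e => by subst e; simp [hab.symm] at h1⟩, (hN w hw).1⟩
    · have h1' := h1
      push Not at h1
      by_cases h2 : x = some b
      · subst h2
        by_cases h3 : [some a] <+: w
        · obtain ⟨z, rfl⟩ := h3
          simp only [List.cons_append, List.nil_append] at hw ⊢
          rw [act2]
          exact ⟨⟨fun _ => hw.1.1 (Or.inl rfl), by simp⟩, hw.2⟩
        · rw [act3 _ h3]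
          refine ⟨⟨fun e => absurd e h1', fun _ e => h3 ?_⟩, hw⟩
          cases w with
          | nil => simp [st, stEw] at e
          | cons y w =>
            by_cases hy : y = some a
            · subst hy; simp
            · simp [st, stEw, stE, hy] at e
              grind
      · rw [act4 _ _ h1.1 h1.2 h2]; exact ⟨okc _ _ h1.1 h1.2 h2, hw⟩
  · intro x
    have hr := toQ_rel [a, b, a] [c, a]
    simp only [toQ_cons_s, toQ_nil_s, mul_one] at hr
    generalize hR : ({([a, b, a], [c, a])} : Set (List α × List α)) = R at hr ⊢
    by_cases h1 : x = some a
    · subst h1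
      refine good_Fr_push [some c] [some c] [none] [some c] (el R b * el R a) (Or.inl rfl)
        (fun w _ => act1 w _ (Or.inl rfl)) ?_ ?_ ?_
      · simp [hr]
      · simp [hr]
      · simp [hr, mul_assoc]
    · by_cases h2 : x = none
      · subst h2
        have hr2 : el R a * (el R b * (el R a * el R b)) = el R c * (el R a * el R b) := by
          rw [← mul_assoc, ← mul_assoc, mul_assoc (el R a), hr, mul_assoc]
        refine good_Fr_push [some c] [some c] [none] [some c] (el R a * el R b) (Or.inl rfl)
          (fun w _ => act1 w _ (Or.inr rfl)) ?_ ?_ ?_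
        · simp [mul_assoc, hr2]
        · simp [mul_assoc, hr2]
        · simp [mul_assoc, hr2]
      · by_cases h3 : x = some b
        · subst h3
          refine good_rule [some a] [none] ?_ (by simp)
          intro w _
          by_cases h3 : [some a] <+: w
          · obtain ⟨z, rfl⟩ := h3
            exact Or.inl ⟨z, rfl, act2 z⟩
          · exact Or.inr (act3 _ h3)
        · exact good_push (fun w _ => act4 _ _ h1 h2 h3)
  · intro w hw
    simp only [List.foldl_cons, List.foldl_nil, List.map_cons, List.map_nil]
    rw [act1 w (some a) (Or.inl rfl), act2, act1 _ (some a) (Or.inl rfl), act4 w (some c) (by simp [hac.symm]) (by simp) (by simp [hbc.symm]),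
      act1 _ (some a) (Or.inl rfl), h_step, h_term]
  · intro w x hw
    cases x with
    | some x => simp
    | none =>
      simp only [gO, List.foldl_cons, List.foldl_nil, List.map_cons, List.map_nil]
      rw [act1 _ (some a) (Or.inl rfl), act2, act1 _ none (Or.inr rfl)]

open Classical in
/-- abc = cx, x ∈ {a, c} -/
theorem LF [Finite α] (a b c x : α) (hab : a ≠ b) (hac : a ≠ c) (hbc : b ≠ c) (hx : x = a ∨ x = c) :
    MonPrefixAutomatic {([a, b, c], [c, x])} := by
  let ok : List (Option α) → Option α → Prop := fun w y =>
    (y = some b → ¬ [some a] <+: w) ∧ (y = some c → ¬ [none] <+: w)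
  let f := Fr [none] [some x] [] [some c] [some c]
  have f_step : ∀ w, f (none :: w) = some x :: f w := fun w => Fr_step (s := [none]) (by simp) w
  have f_term : ∀ w, ¬ [none] <+: w → f w = some c :: w := fun w h =>
    Fr_term (q := []) w (by intro _; exact h)
  let act : List (Option α) → Option α → List (Option α) := fun w y =>
    if y = some b ∧ [some a] <+: w then none :: w.tail else if y = some c then f w else y :: w
  have act1 : ∀ w, act (some a :: w) (some b) = none :: w := by intro w; simp [act]
  have act2 : ∀ w, ¬ [some a] <+: w → act w (some b) = some b :: w := by
    intro w h; simp [act, h, hbc]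
  have act3 : ∀ w, act w (some c) = f w := by
    intro w; simp [act, hbc.symm]
  have act4 : ∀ w y, y ≠ some b → y ≠ some c → act w y = y :: w := by
    intro w x h1 h2; simp [act, h1, h2]
  have hst : ∀ w, ∃ y z, f w = some y :: z := by
    intro w
    rcases Fr_shape [none] [some x] (some c) w with ⟨z, e⟩ | ⟨_, z, e⟩
    · exact ⟨c, z, e⟩
    · exact ⟨x, _, e⟩
  have hst' : ∀ w, ¬ [none] <+: f w := by
    intro w; obtain ⟨y, z, e⟩ := hst w; rw [e]; simp
  have hok : ∀ w y, NF ok w → ok w y → act w y = y :: w := by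
    intro w y hw h
    by_cases h1 : y = some b
    · subst h1; exact act2 _ (h.1 rfl)
    · by_cases h2 : y = some c
      · subst h2; rw [act3, f_term _ (h.2 rfl)]
      · exact act4 _ _ h1 h2
  have okx : ∀ w, ok (f w) (some x) := by
    intro w
    refine ⟨?_, fun _ => hst' w⟩
    rcases hx with rfl | rfl <;> simp [hab, hbc.symm]
  have hN : ∀ w, NF ok w → NF ok (f w) := by
    refine Fr_ind (s := [none]) (t := [some x]) (q := []) (q' := [some c]) (dflt := [some c]) _ ?_ ?_ ?_
    · intro w _ ih hw
      have : f ([none] ++ w) = some x :: f w := f_step w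
      rw [this]
      exact ⟨okx w, ih hw.2⟩
    · intro w h e hw
      have : f w = some c :: w := e
      simp only [List.nil_append] at hw ⊢
      rw [this]
      exact ⟨⟨by simp [hbc.symm], fun _ => h (by simp)⟩, hw⟩
    · intro w h1 h2 e hw
      simp at h2
  refine KEY (gO [a, b]) some (fun _ => rfl) ok act ?_ hok ?_ ?_ ?_ ?_
  · refine NF_reg_take 1 _ ?_
    intro c w
    cases w <;> simp [ok]
  · intro w y hw
    by_cases h1 : y = some b
    · subst h1
      by_cases h3 : [some a] <+: w
      · obtain ⟨z, rfl⟩ := h3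
        simp only [List.cons_append, List.nil_append] at hw ⊢
        rw [act1]
        exact ⟨by simp [ok], hw.2⟩
      · rw [act2 _ h3]; exact ⟨⟨fun _ => h3, by simp [hbc]⟩, hw⟩
    · by_cases h2 : y = some c
      · subst h2; rw [act3]; exact hN w hw
      · rw [act4 _ _ h1 h2]; exact ⟨⟨fun e => absurd e h1, fun e => absurd e h2⟩, hw⟩
  · intro y
    have hr := toQ_rel [a, b, c] [c, x]
    simp only [toQ_cons_s, toQ_nil_s, mul_one] at hr
    generalize hR : ({([a, b, c], [c, x])} : Set (List α × List α)) = R at hr ⊢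
    by_cases h1 : y = some b
    · subst h1
      refine good_rule [some a] [none] ?_ (by simp)
      intro w _
      by_cases h3 : [some a] <+: w
      · obtain ⟨z, rfl⟩ := h3
        exact Or.inl ⟨z, rfl, act1 z⟩
      · exact Or.inr (act2 _ h3)
    · by_cases h2 : y = some c
      · subst h2
        refine good_of_Rl [none] [some x] _ (Or.inl rfl) (fun w _ => by rw [act3]; exact Fr_Rl _ _ _ _ _ _) ?_ ?_
        · simpa [mul_assoc] using hr
        · simp
      · exact good_push (fun w _ => act4 _ _ h1 h2)
  · intro w hw
    simp only [List.foldl_cons, List.foldl_nil, List.map_cons, List.map_nil]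
    rw [act4 _ (some a) (by simp [hab]) (by simp [hac]), act1, act3, act3, f_step, hok _ _ (hN w hw) (okx w)]
  · intro w x hw
    cases x with
    | some x => simp
    | none =>
      simp only [gO, List.foldl_cons, List.foldl_nil, List.map_cons, List.map_nil]
      rw [act4 _ (some a) (by simp [hab]) (by simp [hac]), act1, act4 _ none (by simp) (by simp)]

open Classical in
/-- abb = ba -/
theorem S7 [Finite α] (a b : α) (hab : a ≠ b) : MonPrefixAutomatic {([a, b, b], [b, a])} := by
  let ok : List (Option α) → Option α → Prop := fun w y =>
    (y = some b → ¬ [some a] <+: w ∧ ¬ [none] <+: w)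
  let f := Fr [none] [some a] [some a] [none] [some b]
  have f_step : ∀ w, f (none :: w) = some a :: f w := fun w => Fr_step (s := [none]) (by simp) w
  have f_term : ∀ w, f (some a :: w) = none :: w := fun w =>
    Fr_term (q := [some a]) w (by simp)
  let act : List (Option α) → Option α → List (Option α) := fun w y =>
    if y = some b then f w else y :: w
  have act1 : ∀ w, act w (some b) = f w := by intro w; simp [act]
  have act2 : ∀ w y, y ≠ some b → act w y = y :: w := by intro w y h; simp [act, h]
  have hok : ∀ w y, NF ok w → ok w y → act w y = y :: w := by
    intro w y hw h
    by_cases h1 : y = some b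
    · subst h1; rw [act1]; exact Fr_dflt _ (fun _ => (h rfl).2) (h rfl).1
    · exact act2 _ _ h1
  have hN : ∀ w, NF ok w → NF ok (f w) := by
    refine Fr_ind (s := [none]) (t := [some a]) (q := [some a]) (q' := [none]) (dflt := [some b]) _ ?_ ?_ ?_
    · intro w _ ih hw
      have : f ([none] ++ w) = some a :: f w := f_step w
      rw [this]
      exact ⟨by simp [ok, hab], ih hw.2⟩
    · intro w h e hw
      have : f ([some a] ++ w) = none :: w := e
      rw [this]
      exact ⟨by simp [ok], hw.2⟩
    · intro w h1 h2 e hw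
      have : f w = some b :: w := e
      rw [this]
      exact ⟨fun _ => ⟨h2, h1 (by simp)⟩, hw⟩
  refine KEY (gO [a, b]) some (fun _ => rfl) ok act ?_ hok ?_ ?_ ?_ ?_
  · refine NF_reg_take 1 _ ?_
    intro c w
    cases w <;> simp [ok]
  · intro w y hw
    by_cases h1 : y = some b
    · subst h1; rw [act1]; exact hN w hw
    · rw [act2 _ _ h1]; exact ⟨fun e => absurd e h1, hw⟩
  · intro y
    have hr := toQ_rel [a, b, b] [b, a]
    simp only [toQ_cons_s, toQ_nil_s, mul_one] at hr
    generalize hR : ({([a, b, b], [b, a])} : Set (List α × List α)) = R at hr ⊢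
    by_cases h1 : y = some b
    · subst h1
      refine good_of_Rl [none] [some a] _ (Or.inl rfl) (fun w _ => by rw [act1]; exact Fr_Rl _ _ _ _ _ _) ?_ ?_
      · simpa [mul_assoc] using hr
      · simp
    · exact good_push (fun w _ => act2 _ _ h1)
  · intro w hw
    simp only [List.foldl_cons, List.foldl_nil, List.map_cons, List.map_nil]
    rw [act2 _ (some a) (by simp [hab]), act1, act1, act1, f_term, f_step, act2 _ (some a) (by simp [hab])]
  · intro w x hw
    cases x with
    | some x => simp
    | none =>
      simp only [gO, List.foldl_cons, List.foldl_nil, List.map_cons, List.map_nil]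
      rw [act2 _ (some a) (by simp [hab]), act1, act2 _ none (by simp), f_term]
end sp2

set_option linter.unusedSimpArgs false
set_option linter.unusedVariables false
set_option linter.unnecessarySeqFocus false
section sp
variable {α β : Type}

open Classical in
/-- state for S3: 0 no a in run, 1: a on top, 2: one a not on top, 3: two a -/
noncomputable def stT (a b : α) (s : Fin 4) (c : α) : Fin 4 :=
  if c = a then (if s = 0 then 1 else 3)
  else if c = b then (if s = 0 then 0 else if s = 3 then 3 else 2) else 0

noncomputable def stTw (a b : α) : List α → Fin 4
  | [] => 0
  | c :: w => stT a b (stTw a b w) c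

theorem Rl_rep {b : β} {Tm : List (List β × List β)} {x y : List β} (j : ℕ) (h : Rl [b] [b] Tm x y) :
    Rl [b] [b] Tm (List.replicate j b ++ x) (List.replicate j b ++ y) := by
  induction j with
  | zero => exact h
  | succ j ih => exact Rl.step _ _ ih

open Classical in
/-- aaa = ba -/
theorem S3 [Finite α] (a b : α) (hab : a ≠ b) : MonPrefixAutomatic {([a, a, a], [b, a])} := by
  let st := stTw a b
  have sta : ∀ w, st (a :: w) = if st w = 0 then 1 else 3 := by intro w; simp [st, stTw, stT, hab]
  have stb : ∀ w, st (b :: w) = if st w = 0 then 0 else if st w = 3 then 3 else 2 := by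
    intro w; simp [st, stTw, stT, hab.symm]
  have stn : ∀ w c, c ≠ a → c ≠ b → st (c :: w) = 0 := by
    intro w c h1 h2; simp [st, stTw, stT, h1, h2]
  let ok : List α → α → Prop := fun w c => c = a → st w = 0 ∨ st w = 1
  let f2 := Fr [b] [b] [a, a] [b] ([] : List α)
  let f1 := Fr [b] [b] [a] [] ([] : List α)
  let act : List α → α → List α := fun w c => if c = a then
    (if st w = 0 then a :: w else if st w = 3 then a :: f2 w else a :: a :: f1 w) else c :: w
  have f2r : ∀ j w, f2 (List.replicate j b ++ a :: a :: w) = List.replicate (j+1) b ++ w := by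
    intro j w
    induction j with
    | zero => exact Fr_term (q := [a, a]) w (by intro _ h; simp [List.cons_prefix_cons, hab.symm] at h)
    | succ j ih =>
      refine (Fr_step (s := [b]) (by simp) (List.replicate j b ++ a :: a :: w)).trans ?_
      rw [show Fr [b] [b] [a, a] [b] [] (List.replicate j b ++ a :: a :: w) = _ from ih]; rfl
  have f1r : ∀ j w, f1 (List.replicate j b ++ a :: w) = List.replicate j b ++ w := by
    intro j w
    induction j with
    | zero => exact Fr_term (q := [a]) w (by intro _ h; simp [List.cons_prefix_cons, hab.symm] at h)
    | succ j ih =>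
      refine (Fr_step (s := [b]) (by simp) (List.replicate j b ++ a :: w)).trans ?_
      rw [show Fr [b] [b] [a] [] [] (List.replicate j b ++ a :: w) = _ from ih]; rfl
  have str0 : ∀ j w, st w = 0 → st (List.replicate j b ++ w) = 0 := by
    intro j w h
    induction j with
    | zero => exact h
    | succ j ih => rw [List.replicate_succ, List.cons_append, stb, ih]; rfl
  have str3 : ∀ j w, st w = 0 → st (List.replicate j b ++ a :: a :: w) = 3 := by
    intro j w h
    induction j with
    | zero => simp [sta, h]
    | succ j ih => rw [List.replicate_succ, List.cons_append, stb, ih]; rfl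
  have str1 : ∀ j w, st w = 0 → st (List.replicate j b ++ a :: w) = 1 ∨ st (List.replicate j b ++ a :: w) = 2 := by
    intro j w h
    induction j with
    | zero => simp [sta, h]
    | succ j ih => rw [List.replicate_succ, List.cons_append, stb]; rcases ih with ih | ih <;> rw [ih] <;> decide
  have actn : ∀ w c, c ≠ a → act w c = c :: w := by intro w c hc; simp [act, hc]
  have A0 : ∀ w, st w = 0 → act w a = a :: w := by intro w h; simp [act, h]
  have A1 : ∀ j w, st w = 0 → act (List.replicate j b ++ a :: w) a = a :: a :: (List.replicate j b ++ w) := by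
    intro j w h
    have h1 := f1r j w
    have : st (List.replicate j b ++ a :: w) ≠ 0 ∧ st (List.replicate j b ++ a :: w) ≠ 3 := by
      rcases str1 j w h with h | h <;> rw [h] <;> decide
    simp only [act, this.1, this.2, if_true, if_false, h1]
  have A2 : ∀ j w, st w = 0 → act (List.replicate j b ++ a :: a :: w) a = a :: (List.replicate (j+1) b ++ w) := by
    intro j w h
    have h1 := f2r j w
    have := str3 j w h
    simp only [act, this, if_true, if_false, h1]
    rfl
  have okb : ∀ w, ok w b := fun w e => absurd e hab.symm
  have NFr : ∀ j w, NF ok (List.replicate j b ++ w) ↔ NF ok w := by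
    intro j w
    induction j with
    | zero => exact Iff.rfl
    | succ j ih => exact ⟨fun h => ih.1 h.2, fun h => ⟨okb _, ih.2 h⟩⟩
  have dec : ∀ w, NF ok w → st w = 0 ∨ (∃ j w', NF ok w' ∧ st w' = 0 ∧ w = List.replicate j b ++ a :: w') ∨
      (∃ j w', NF ok w' ∧ st w' = 0 ∧ w = List.replicate j b ++ a :: a :: w') := by
    intro w
    induction w with
    | nil => intro _; exact Or.inl rfl
    | cons c w ih =>
      intro h
      by_cases h1 : c = a
      · subst h1
        rcases h.1 rfl with h2 | h2
        · exact Or.inr (Or.inl ⟨0, w, h.2, h2, rfl⟩)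
        · rcases ih h.2 with h3 | ⟨j, w', h3, h4, rfl⟩ | ⟨j, w', h3, h4, rfl⟩
          · rw [h3] at h2; simp at h2
          · cases j with
            | zero => exact Or.inr (Or.inr ⟨0, w', h3, h4, rfl⟩)
            | succ j =>
              exfalso
              rw [List.replicate_succ, List.cons_append, stb] at h2
              split_ifs at h2 <;> simp at h2
          · rw [str3 _ _ h4] at h2; simp at h2
      · by_cases h2 : c = b
        · subst h2
          rcases ih h.2 with h3 | ⟨j, w', h3, h4, rfl⟩ | ⟨j, w', h3, h4, rfl⟩
          · left; rw [stb, h3]; rfl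
          · exact Or.inr (Or.inl ⟨j+1, w', h3, h4, rfl⟩)
          · exact Or.inr (Or.inr ⟨j+1, w', h3, h4, rfl⟩)
        · exact Or.inl (stn _ _ h1 h2)
  refine KEYa ok act ?_ ?_ ?_ ?_ ?_
  · exact NF_reg ok st (stT a b) (fun s c => c = a → s = 0 ∨ s = 1) (fun _ _ => rfl) (fun _ _ => Iff.rfl)
  · intro w c hw hc
    by_cases h1 : c = a
    · subst h1
      rcases dec w hw with h3 | ⟨j, w', h3, h4, rfl⟩ | ⟨j, w', h3, h4, rfl⟩
      · exact A0 _ h3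
      · cases j with
        | zero => exact A1 0 w' h4
        | succ j =>
          exfalso
          have h2 := hc rfl
          rw [List.replicate_succ, List.cons_append, stb] at h2
          have := str1 j w' h4
          split_ifs at h2 with h5 h6
          · rw [h5] at this; simp at this
          · simp at h2
          · simp at h2
      · have h2 := hc rfl
        rw [str3 _ _ h4] at h2; simp at h2
    · exact actn _ _ h1
  · intro w c hw
    by_cases h1 : c = a
    · subst h1
      rcases dec w hw with h3 | ⟨j, w', h3, h4, rfl⟩ | ⟨j, w', h3, h4, rfl⟩
      · rw [A0 _ h3]; exact ⟨fun _ => Or.inl h3, hw⟩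
      · rw [A1 _ _ h4]
        have h5 := str0 j w' h4
        exact ⟨fun _ => Or.inr (by rw [sta, h5]; rfl), fun _ => Or.inl h5, (NFr _ _).2 h3⟩
      · rw [A2 _ _ h4]
        exact ⟨fun _ => Or.inl (str0 _ _ h4), (NFr _ _).2 h3⟩
    · rw [actn _ _ h1]; exact ⟨fun e => absurd e h1, hw⟩
  · intro c
    by_cases h1 : c = a
    · subst h1
      refine ⟨_, (((Rl.rr [b] [b] (Or.inl rfl) [([c, c], [b])]).cons_snd c).union
        (((Rl.rr [b] [b] (Or.inl rfl) [([c], [])]).cons_snd c).cons_snd c)).union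
        (Rl.rr [] [] (Or.inl rfl) [([], [c])]), ?_, ?_⟩
      · intro w hw
        rcases dec w hw with h3 | ⟨j, w', h3, h4, rfl⟩ | ⟨j, w', h3, h4, rfl⟩
        · rw [A0 _ h3]; exact Or.inr (Rl.term [] [c] w (by simp))
        · rw [A1 _ _ h4]
          exact Or.inl (Or.inr ⟨_, ⟨_, Rl_rep j (Rl.term [c] [] w' (by simp)), rfl⟩, rfl⟩)
        · rw [A2 _ _ h4]
          refine Or.inl (Or.inl ⟨_, Rl_rep j (Rl.term [c, c] [b] w' (by simp)), ?_⟩)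
          rw [List.replicate_succ']; simp
      · have hr := toQ_rel [c, c, c] [b, c]
        simp only [toQ_cons_s, toQ_nil_s, mul_one] at hr
        generalize hR : ({([c, c, c], [b, c])} : Set (List α × List α)) = R at hr ⊢
        rintro x _ ((⟨y, h, rfl⟩ | ⟨_, ⟨y, h, rfl⟩, rfl⟩) | h)
        · show evs R sg x * el R c = evs R sg y * el R c
          refine h.sound2 (el R c) (el R c * el R c) ?_ ?_ ?_
          · simp [hr, evs, sg, toQ_cons_s, toQ_nil_s]
          · simp [hr, evs, sg, toQ_cons_s, toQ_nil_s]
          · simp [hr, evs, sg, toQ_cons_s, toQ_nil_s, mul_assoc]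
        · show evs R sg x * el R c = evs R sg y * el R c * el R c
          induction h with
          | term q q' w hq =>
            simp at hq
            obtain ⟨rfl, rfl⟩ := hq
            simp only [List.cons_append, List.nil_append, evs_sg_cons, mul_assoc]
          | step x y h ih =>
            simp only [List.cons_append, List.nil_append, evs_sg_cons]
            rw [mul_assoc, ← hr, ← mul_assoc, ih]
            simp only [mul_assoc]
            rw [← mul_assoc (el R b), ← hr]; simp only [mul_assoc]
        · exact h.sound _ (by simp [evs]) (by simp [evs])
    · exact good_push (fun w _ => actn _ _ h1)
  · intro w hw
    simp only [List.foldl_cons, List.foldl_nil]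
    rw [actn w b hab.symm]
    rcases dec w hw with h3 | ⟨j, w', h3, h4, rfl⟩ | ⟨j, w', h3, h4, rfl⟩
    · rw [A0 _ h3, A0 (b :: w) (str0 1 w h3)]
      have := A1 0 w h3
      simp only [List.replicate_zero, List.nil_append] at this
      rw [this]
      exact A2 0 w h3
    · rw [A1 _ _ h4]
      have h5 := str0 j w' h4
      have e1 := A2 0 _ h5
      simp only [List.replicate_zero, List.nil_append] at e1
      rw [e1]
      have e2 := A1 0 _ (str0 1 _ h5)
      simp only [List.replicate_zero, List.nil_append] at e2
      exact e2.trans (A1 (j+1) w' h4).symm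
    · rw [A2 _ _ h4]
      have h5 := str0 (j+1) w' h4
      have e1 := A1 0 _ h5
      simp only [List.replicate_zero, List.nil_append] at e1
      rw [e1]
      have e2 := A2 0 _ h5
      simp only [List.replicate_zero, List.nil_append] at e2
      exact e2.trans (A2 (j+1) w' h4).symm
end sp

set_option linter.unusedSimpArgs false
set_option linter.unusedVariables false
set_option linter.unnecessarySeqFocus false
section sp
variable {α β : Type}

inductive Bf (a b : β) : List β → List β → Prop
  | base (w) : Bf a b w w
  | stepa (x y) : Bf a b x y → Bf a b (a :: x) (b :: y)
  | stepb (x y) : Bf a b x y → Bf a b (b :: x) (b :: y)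

theorem Bf.rr [Finite β] (a b : β) : RRs (Bf a b) := by
  have h0 : RR (fun x y : List β => (∀ c ∈ x, c = a ∨ c = b) ∧ y = List.replicate x.length b) := by
    have := IsReg.all (fun p : Option β × Option β => p = (some a, some b) ∨ p = (some b, some b))
    unfold RR
    convert this using 1
    ext p
    simp only [Set.mem_ofPred_eq]
    constructor
    · rintro ⟨x, _, ⟨h, rfl⟩, rfl⟩
      induction x with
      | nil => simp
      | cons c x ih =>
        have h1 := ih (fun c hc => h c (List.mem_cons_of_mem _ hc))
        have h2 := h c List.mem_cons_self
        simp only [List.length_cons, List.replicate_succ, padR_cons_cons]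
        intro p hp
        rcases List.mem_cons.1 hp with rfl | hp
        · rcases h2 with rfl | rfl <;> simp
        · exact h1 p hp
    · intro h
      induction p with
      | nil => exact ⟨[], [], by simp, by simp⟩
      | cons q p ih =>
        obtain ⟨x, y, ⟨h1, h2⟩, rfl⟩ := ih (fun c hc => h c (List.mem_cons_of_mem _ hc))
        have h3 := h q List.mem_cons_self
        rcases h3 with rfl | rfl
        · exact ⟨a :: x, b :: y, ⟨by simpa using h1, by rw [h2]; rfl⟩, by simp⟩
        · exact ⟨b :: x, b :: y, ⟨by simpa using h1, by rw [h2]; rfl⟩, by simp⟩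
  refine h0.common.congr (fun x y => ?_)
  constructor
  · rintro ⟨w, x, _, -, ⟨h, rfl⟩, rfl, rfl⟩
    rw [List.reverse_append, List.reverse_append, List.reverse_replicate]
    induction x using List.reverseRecOn with
    | nil => exact Bf.base _
    | append_singleton x c ih =>
      have h1 := ih (fun c hc => h c (by simp [hc]))
      have h2 := h c (by simp)
      rw [List.reverse_append, List.length_append, List.length_singleton, List.replicate_succ]
      rcases h2 with rfl | rfl
      · exact Bf.stepa _ _ h1
      · exact Bf.stepb _ _ h1
  · intro h
    have key : ∀ X Y : List β, Bf a b X Y → ∃ w p, (∀ c ∈ p, c = a ∨ c = b) ∧ X.reverse = w ++ p ∧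
        Y.reverse = w ++ List.replicate p.length b := by
      intro X Y h
      induction h with
      | base w => exact ⟨w.reverse, [], by simp, by simp, by simp⟩
      | stepa x y _ ih =>
        obtain ⟨w, p, h, h1, h2⟩ := ih
        refine ⟨w, p ++ [a], ?_, by simp [h1], by simp [h2, List.replicate_succ']⟩
        intro c hc
        rcases List.mem_append.1 hc with hc | hc
        · exact h c hc
        · exact Or.inl (by simpa using hc)
      | stepb x y _ ih =>
        obtain ⟨w, p, h, h1, h2⟩ := ih
        refine ⟨w, p ++ [b], ?_, by simp [h1], by simp [h2, List.replicate_succ']⟩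
        intro c hc
        rcases List.mem_append.1 hc with hc | hc
        · exact h c hc
        · exact Or.inr (by simpa using hc)
    obtain ⟨w, p, h, h1, h2⟩ := key _ _ h
    exact ⟨w, p, _, by simp, ⟨h, rfl⟩, by simpa using h1, by simpa using h2⟩

open Classical in
noncomputable def bify (a b : α) : List α → List α
  | [] => []
  | x :: w => if x = a ∨ x = b then b :: bify a b w else x :: w

open Classical in
/-- abb = bbb -/
theorem S8 [Finite α] (a b : α) (hab : a ≠ b) : MonPrefixAutomatic {([a, b, b], [b, b, b])} := by
  let ok : List α → α → Prop := okR b [b, a] []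
  let f := bify a b
  have fa : ∀ w, f (a :: w) = b :: f w := by intro w; simp [f, bify]
  have fb : ∀ w, f (b :: w) = b :: f w := by intro w; simp [f, bify]
  have fn : ∀ w c, c ≠ a → c ≠ b → f (c :: w) = c :: w := by intro w c h1 h2; simp [f, bify, h1, h2]
  have okb : ∀ w, ok w b ↔ ¬ [b, a] <+: w := by intro w; simp [ok, okR]
  have okn : ∀ w c, c ≠ b → ok w c := fun w c h e => absurd e h
  let act : List α → α → List α := fun w c => if c = b ∧ [b, a] <+: w then b :: f w else c :: w
  have actn : ∀ w c, c ≠ b → act w c = c :: w := by intro w c hc; simp [act, hc]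
  have actb : ∀ w, act (b :: a :: w) b = b :: b :: b :: f w := by
    intro w; simp [act, List.cons_prefix_cons, fa, fb]
  have actb' : ∀ w, ¬ [b, a] <+: w → act w b = b :: w := by intro w h; simp [act, h]
  have tp1 : ∀ w, ¬ [a] <+: f w := by
    intro w
    cases w with
    | nil => simp [f, bify]
    | cons c w =>
      by_cases h1 : c = a
      · subst h1; rw [fa]; simp [List.cons_prefix_cons, hab]
      · by_cases h2 : c = b
        · subst h2; rw [fb]; simp [List.cons_prefix_cons, hab]
        · rw [fn _ _ h1 h2]; simp [List.cons_prefix_cons, Ne.symm h1]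
  have tp2 : ∀ w, ¬ [b, a] <+: f w := by
    intro w
    cases w with
    | nil => simp [f, bify]
    | cons c w =>
      have := tp1 w
      by_cases h1 : c = a
      · subst h1; rw [fa]; simpa [List.cons_prefix_cons] using this
      · by_cases h2 : c = b
        · subst h2; rw [fb]; simpa [List.cons_prefix_cons] using this
        · rw [fn _ _ h1 h2]; simp [List.cons_prefix_cons, Ne.symm h2]
  have fN : ∀ w, NF ok w → NF ok (f w) := by
    intro w
    induction w with
    | nil => intro h; exact h
    | cons c w ih =>
      intro h
      by_cases h1 : c = a
      · subst h1; rw [fa]; exact ⟨(okb _).2 (tp2 _), ih h.2⟩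
      · by_cases h2 : c = b
        · subst h2; rw [fb]; exact ⟨(okb _).2 (tp2 _), ih h.2⟩
        · rw [fn _ _ h1 h2]; exact h
  have fid : ∀ w, NF ok w → ¬ [b, a] <+: w → ¬ [a] <+: w → f w = w := by
    intro w
    induction w with
    | nil => intros; rfl
    | cons c w ih =>
      intro h h1 h2
      by_cases h3 : c = a
      · subst h3; simp at h2
      · by_cases h4 : c = b
        · subst h4
          rw [fb, ih h.2 ((okb _).1 h.1) (by simpa [List.cons_prefix_cons] using h1)]
        · exact fn _ _ h3 h4
  refine KEYa ok act ?_ ?_ ?_ ?_ ?_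
  · exact okR_reg b [b, a] []
  · intro w c hw hc
    by_cases h1 : c = b
    · subst h1; exact actb' _ ((okb _).1 hc)
    · exact actn _ _ h1
  · intro w c hw
    by_cases h1 : c = b
    · subst h1
      by_cases h2 : [c, a] <+: w
      · obtain ⟨z, rfl⟩ := h2
        show NF ok (act (c :: a :: z) c)
        rw [actb]
        refine ⟨(okb _).2 ?_, (okb _).2 ?_, (okb _).2 (tp2 _), fN _ hw.2.2⟩
        · simp [List.cons_prefix_cons, hab]
        · simpa [List.cons_prefix_cons] using tp1 z
      · rw [actb' _ h2]; exact ⟨(okb _).2 h2, hw⟩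
    · rw [actn _ _ h1]; exact ⟨okn _ _ h1, hw⟩
  · intro c
    by_cases h1 : c = b
    · subst h1
      refine ⟨_, ((((Bf.rr a c).cons_fst c).cons_snd c).cons_snd c).union
        (Rl.rr [] [] (Or.inl rfl) [([], [c])]), ?_, ?_⟩
      · intro w hw
        clear hw
        by_cases h2 : [c, a] <+: w
        · obtain ⟨z, rfl⟩ := h2
          left
          refine ⟨_, ⟨_, ⟨a :: z, ?_, rfl⟩, rfl⟩, actb z⟩
          apply Bf.stepa
          induction z with
          | nil => exact Bf.base _
          | cons d z ih =>
            by_cases h3 : d = a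
            · subst h3; rw [fa]; exact Bf.stepa _ _ ih
            · by_cases h4 : d = c
              · subst h4; rw [fb]; exact Bf.stepb _ _ ih
              · rw [fn _ _ h3 h4]; exact Bf.base _
        · rw [actb' _ h2]; exact Or.inr (Rl.term [] [c] w (by simp))
      · have hr := toQ_rel [a, c, c] [c, c, c]
        simp only [toQ_cons_s, toQ_nil_s, mul_one] at hr
        generalize hR : ({([a, c, c], [c, c, c])} : Set (List α × List α)) = R at hr ⊢
        rintro _ _ (⟨_, ⟨y, ⟨x, h, rfl⟩, rfl⟩, rfl⟩ | h)
        · show evs R sg x * el R c * el R c = evs R sg y * el R c * el R c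
          induction h with
          | base => rfl
          | stepa x y _ ih =>
            rw [evs_sg_cons, evs_sg_cons, ← ih]
            simp only [mul_assoc, hr]
          | stepb x y _ ih =>
            rw [evs_sg_cons, evs_sg_cons, ← ih]
        · exact h.sound _ (by simp [evs]) (by simp [evs])
    · exact good_push (fun w _ => actn _ _ h1)
  · intro w hw
    simp only [List.foldl_cons, List.foldl_nil]
    rw [actn w a hab, actb' (a :: w) (by simp [List.cons_prefix_cons, hab.symm]), actb]
    by_cases h2 : [b, a] <+: w
    · obtain ⟨z, rfl⟩ := h2
      show _ = act (act (act (b :: a :: z) b) b) b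
      rw [actb, actb' (b :: b :: b :: f z), actb' (b :: b :: b :: b :: f z)]
      · show b :: b :: b :: f (b :: a :: z) = _
        rw [fb, fa]
      · simp [List.cons_prefix_cons, hab]
      · simp [List.cons_prefix_cons, hab]
    · rw [actb' _ h2]
      by_cases h3 : [a] <+: w
      · obtain ⟨z, rfl⟩ := h3
        show _ = act (act (b :: a :: z) b) b
        rw [actb, actb']
        · show b :: b :: b :: f (a :: z) = _
          rw [fa]
        · simp [List.cons_prefix_cons, hab]
      · rw [fid w hw h2 h3, actb' (b :: w), actb' (b :: b :: w)]
        · simp [List.cons_prefix_cons, hab]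
        · simpa [List.cons_prefix_cons] using h3

open Classical in
noncomputable def fO (a b : α) : List (Option α) → List (Option α)
  | none :: w => none :: fO b a w
  | some y :: some z :: w => if y = b ∧ z = a then none :: w else some a :: some y :: some z :: w
  | w => some a :: w

theorem fO_push (a b : α) (w : List (Option α)) (h1 : ¬ [none] <+: w) (h2 : ¬ [some b, some a] <+: w) :
    fO a b w = some a :: w := by
  match w with
  | [] => simp [fO]
  | none :: w => simp at h1
  | [some y] => simp [fO]
  | some y :: none :: w => simp [fO]
  | some y :: some z :: w =>
    simp only [fO]
    rw [if_neg]
    rintro ⟨rfl, rfl⟩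
    simp at h2

theorem fO_none (a b : α) (w : List (Option α)) : fO a b (none :: w) = none :: fO b a w := by simp [fO]
theorem fO_red (a b : α) (w : List (Option α)) : fO a b (some b :: some a :: w) = none :: w := by simp [fO]

theorem fO_cases (a b : α) (w : List (Option α)) : (∃ z, w = none :: z) ∨ (∃ z, w = some b :: some a :: z) ∨
    (¬ [none] <+: w ∧ ¬ [some b, some a] <+: w) := by
  by_cases h1 : [none] <+: w
  · obtain ⟨z, rfl⟩ := h1; exact Or.inl ⟨z, rfl⟩
  · by_cases h2 : [some b, some a] <+: w
    · obtain ⟨z, rfl⟩ := h2; exact Or.inr (Or.inl ⟨z, rfl⟩)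
    · exact Or.inr (Or.inr ⟨h1, h2⟩)

theorem fO_Rl (a b : α) (w : List (Option α)) : Rl [none, none] [none, none]
    [([], [some a]), ([some b, some a], [none]), ([none], [none, some b]), ([none, some a, some b], [none, none])]
    w (fO a b w) := by
  induction h : w.length using Nat.strong_induction_on generalizing w with
  | _ n ih =>
    rcases fO_cases a b w with ⟨z, rfl⟩ | ⟨z, rfl⟩ | ⟨h1, h2⟩
    · rw [fO_none]
      rcases fO_cases b a z with ⟨z, rfl⟩ | ⟨z, rfl⟩ | ⟨h1, h2⟩
      · rw [fO_none]; exact Rl.step _ _ (ih z.length (by simp at h; omega) z rfl)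
      · rw [fO_red]; exact Rl.term [none, some a, some b] [none, none] z (by simp)
      · rw [fO_push _ _ _ h1 h2]; exact Rl.term [none] [none, some b] z (by simp)
    · rw [fO_red]; exact Rl.term [some b, some a] [none] z (by simp)
    · rw [fO_push _ _ _ h1 h2]; exact Rl.term [] [some a] w (by simp)

def okO (a b : α) (w : List (Option α)) (c : Option α) : Prop :=
  (c = some a → ¬ [none] <+: w ∧ ¬ [some b, some a] <+: w) ∧
  (c = some b → ¬ [none] <+: w ∧ ¬ [some a, some b] <+: w)

theorem okO_none (a b : α) (w : List (Option α)) : okO a b w none := by simp [okO]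
theorem okO_symm (a b : α) : okO a b = okO b a := by
  funext w c; simp only [okO]; exact propext and_comm

theorem fO_NF (a b : α) (hab : a ≠ b) (w : List (Option α)) (h : NF (okO a b) w) : NF (okO a b) (fO a b w) := by
  induction w generalizing a b with
  | nil => simp only [fO]; exact ⟨by simp [okO, hab], h⟩
  | cons c w ih =>
    rcases fO_cases a b (c :: w) with ⟨z, e⟩ | ⟨z, e⟩ | ⟨h1, h2⟩
    · obtain ⟨rfl, rfl⟩ := List.cons.inj e
      rw [fO_none]
      refine ⟨okO_none _ _ _, ?_⟩
      rw [okO_symm]; rw [okO_symm] at h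
      exact ih b a hab.symm h.2
    · rw [e, fO_red]; rw [e] at h; exact ⟨okO_none _ _ _, h.2.2⟩
    · rw [fO_push _ _ _ h1 h2]
      exact ⟨⟨fun _ => ⟨h1, h2⟩, fun e => absurd (Option.some.inj e) hab⟩, h⟩

theorem fO_key (a b : α) (hab : a ≠ b) (w : List (Option α)) (h : NF (okO a b) w) :
    fO a b (fO b a (fO a b w)) = none :: w := by
  induction w generalizing a b with
  | nil => simp [fO]
  | cons c w ih =>
    rcases fO_cases a b (c :: w) with ⟨z, e⟩ | ⟨z, e⟩ | ⟨h1, h2⟩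
    · obtain ⟨rfl, rfl⟩ := List.cons.inj e
      rw [fO_none, fO_none, fO_none, ih b a hab.symm]
      rw [okO_symm] at h; exact h.2
    · rw [e] at h ⊢
      rw [fO_red, fO_none, fO_none]
      have h3 := h.2.1.1 rfl
      have h4 := h.1.2 rfl
      rw [fO_push _ _ _ h3.1 h3.2, fO_push _ _ _ h4.1 h4.2]
    · rw [fO_push _ _ _ h1 h2]
      rcases fO_cases b a (some a :: c :: w) with ⟨z, e⟩ | ⟨z, e⟩ | ⟨h3, h4⟩
      · simp at e
      · obtain ⟨_, e⟩ := List.cons.inj e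
        obtain ⟨rfl, rfl⟩ := List.cons.inj e
        rw [fO_red, fO_none]
        have h3 := h.1.2 rfl
        rw [fO_push _ _ _ h3.1 h3.2]
      · rw [fO_push _ _ _ h3 h4, fO_red]

open Classical in
/-- aba = bab -/
theorem O5 [Finite α] (a b : α) (hab : a ≠ b) : MonPrefixAutomatic {([a, b, a], [b, a, b])} := by
  let act : List (Option α) → Option α → List (Option α) := fun w c =>
    if c = some a then fO a b w else if c = some b then fO b a w else c :: w
  have acta : ∀ w, act w (some a) = fO a b w := by intro w; simp [act]
  have actb : ∀ w, act w (some b) = fO b a w := by intro w; simp [act, hab.symm]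
  have actn : ∀ w c, c ≠ some a → c ≠ some b → act w c = c :: w := by intro w c h1 h2; simp [act, h1, h2]
  refine KEY (gO [a, b, a]) some (fun _ => rfl) (okO a b) act ?_ ?_ ?_ ?_ ?_ ?_
  · refine NF_reg_take 2 _ ?_
    intro c w
    have : ∀ p : List (Option α), p.length ≤ 2 → (p <+: w ↔ p <+: w.take 2) := by
      intro p hp
      simp [List.prefix_take_iff]; intro _; exact hp
    unfold okO
    rw [this [none] (by simp), this [some b, some a] (by simp), this [some a, some b] (by simp)]
  · intro w c hw hc
    by_cases h1 : c = some a
    · subst h1; rw [acta]; exact fO_push _ _ _ (hc.1 rfl).1 (hc.1 rfl).2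
    · by_cases h2 : c = some b
      · subst h2; rw [actb]; exact fO_push _ _ _ (hc.2 rfl).1 (hc.2 rfl).2
      · exact actn _ _ h1 h2
  · intro w c hw
    by_cases h1 : c = some a
    · subst h1; rw [acta]; exact fO_NF _ _ hab _ hw
    · by_cases h2 : c = some b
      · subst h2; rw [actb]; rw [okO_symm] at hw ⊢; exact fO_NF _ _ hab.symm _ hw
      · rw [actn _ _ h1 h2]; exact ⟨⟨fun e => absurd e h1, fun e => absurd e h2⟩, hw⟩
  · intro c
    have hr := toQ_rel [a, b, a] [b, a, b]
    simp only [toQ_cons_s, toQ_nil_s, mul_one] at hr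
    generalize hR : ({([a, b, a], [b, a, b])} : Set (List α × List α)) = R at hr ⊢
    set A := el R a with hA
    set B := el R b with hB
    have e1 : A * (B * (A * B)) = A * (A * (B * A)) := by rw [hr]
    have e2 : A * (B * (A * A)) = B * (A * (B * A)) := by
      calc A * (B * (A * A)) = (A * (B * A)) * A := by simp only [mul_assoc]
        _ = (B * (A * B)) * A := by rw [hr]
        _ = _ := by simp only [mul_assoc]
    by_cases h1 : c = some a
    · subst h1
      refine good_of_Rl _ _ _ (Or.inl rfl) (fun w _ => (acta w).symm ▸ fO_Rl a b w) ?_ ?_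
      · simp only [evs_gO_none, evs_nil_s, one_mul, toQ_cons_s, toQ_nil_s, mul_one, gO_some, gO_none, ← hA, ← hB]
        calc A * (B * A) * (A * (B * A)) * A = A * (B * A) * (A * (B * (A * A))) := by simp only [mul_assoc]
          _ = A * (B * A) * B * (A * (B * A)) := by rw [e2]; simp only [mul_assoc]
          _ = A * (B * (A * B)) * (A * (B * A)) := by simp only [mul_assoc]
          _ = _ := by rw [e1]; simp only [mul_assoc]
      · simp [← hA, ← hB, mul_assoc]
        refine ⟨e2, ?_⟩
        calc B * (A * (A * (B * (A * A)))) = B * (A * B) * (A * (B * A)) := by rw [e2]; simp only [mul_assoc]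
          _ = _ := by rw [← hr]; simp only [mul_assoc]
    · by_cases h2 : c = some b
      · subst h2
        refine good_of_Rl _ _ _ (Or.inl rfl) (fun w _ => (actb w).symm ▸ fO_Rl b a w) ?_ ?_
        · simp only [evs_gO_none, evs_nil_s, one_mul, toQ_cons_s, toQ_nil_s, mul_one, gO_some, gO_none, ← hA, ← hB]
          calc A * (B * A) * (A * (B * A)) * B = A * (B * A) * (A * (B * (A * B))) := by simp only [mul_assoc]
            _ = A * (B * (A * A)) * (A * (B * A)) := by rw [e1]; simp only [mul_assoc]
            _ = _ := by rw [e2]; simp only [mul_assoc]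
        · simp [← hA, ← hB, mul_assoc]
          refine ⟨hr.symm, e1, ?_⟩
          calc A * (B * (A * (B * (A * B)))) = A * (B * (A * (A * (B * A)))) := by rw [e1]
            _ = _ := by simp only [mul_assoc]
      · exact good_push (fun w _ => actn _ _ h1 h2)
  · intro w hw
    simp only [List.foldl_cons, List.foldl_nil, List.map_cons, List.map_nil]
    rw [acta w, actb, acta, actb w, acta, actb, fO_key _ _ hab _ hw]
    rw [okO_symm] at hw
    rw [fO_key _ _ hab.symm _ hw]
  · intro w c hw
    cases c with
    | some c => simp
    | none =>
      simp only [gO, List.foldl_cons, List.foldl_nil, List.map_cons, List.map_nil]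
      rw [acta w, actb, acta, actn w none (by simp) (by simp), fO_key _ _ hab _ hw]
end sp

set_option linter.unusedSimpArgs false
set_option linter.unusedVariables false
set_option linter.unnecessarySeqFocus false
section fin
variable {α : Type}

theorem infix2 {p q : α} {r : List α} (h : [p, q] <:+: r) (hr : r.length ≤ 3) :
    r = [p, q] ∨ (∃ x, r = [p, q, x]) ∨ ∃ x, r = [x, p, q] := by
  obtain ⟨s, t, rfl⟩ := h
  match s, t, hr with
  | [], [], _ => simp
  | [], [x], _ => simp
  | [x], [], _ => simp
  | _ :: _, _ :: _, h => simp at h; omega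
  | [], _ :: _ :: _, h => simp at h; omega
  | _ :: _ :: _, [], h => simp at h; omega

theorem N3 [Finite α] (l1 l2 l3 : α) (r : List α) (h : l1 ≠ l3) (hr : r.length ≤ 3)
    (e1 : ¬ (l2 = l3 ∧ r = [l3, l3])) (e2 : ¬ (l2 = l1 ∧ r = [l3, l1])) :
    MonPrefixAutomatic {([l1, l2, l3], r)} := by
  match r, hr with
  | [], _ => exact G0_3 _ _ _ _ h (by simp) (by simp) (by simp) (by simp)
  | [d], _ =>
    by_cases hd : d = l3
    · subst hd; exact G1_3 _ _ _ h
    · exact G0_3 _ _ _ _ h (by simp) (by simpa using hd) (by simp [List.cons_prefix_cons]) (by simp)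
  | [d, e], _ =>
    by_cases hd : d = l3
    · subst hd
      by_cases h2 : l2 = d
      · subst h2
        by_cases h3 : e = l2
        · subst h3; simp at e1
        by_cases h4 : e = l1
        · subst h4; exact S7 _ _ h
        refine MonPrefixAutomatic.swap (G0_2 _ _ _ (Ne.symm h3) (by simp) (by simpa using Ne.symm h4) ?_)
        intro hi
        rcases infix2 hi (by simp) with h | ⟨x, h⟩ | ⟨x, h⟩ <;> simp at h <;> grind
      by_cases h3 : l2 = l1
      · subst h3
        by_cases h3 : e = d
        · subst h3; exact S2 _ _ h
        by_cases h4 : e = l2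
        · subst h4; simp at e2
        refine MonPrefixAutomatic.swap (G0_2 _ _ _ (Ne.symm h3) (by simp) (by simpa using Ne.symm h4) ?_)
        intro hi
        rcases infix2 hi (by simp) with h | ⟨x, h⟩ | ⟨x, h⟩ <;> simp at h <;> grind
      by_cases h4 : e = l1 ∨ e = d
      · exact LF _ _ _ _ (Ne.symm h3) h h2 h4
      · push Not at h4
        refine MonPrefixAutomatic.swap (G0_2 _ _ _ (Ne.symm h4.2) (by simp) (by simpa using Ne.symm h4.1) ?_)
        intro hi
        rcases infix2 hi (by simp) with h | ⟨x, h⟩ | ⟨x, h⟩ <;> simp at h <;> grind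
    · by_cases h2 : d = l2 ∧ e = l3
      · obtain ⟨rfl, rfl⟩ := h2
        exact G2 _ _ _ [] h hd (Or.inl rfl)
      · exact G0_3 _ _ _ _ h (by simp) (by simpa using hd) (by simp [List.cons_prefix_cons]; grind) (by simp)
  | [d, e, f], _ =>
    by_cases hd : d = l3
    · subst hd
      by_cases h2 : l2 = d ∧ e = d
      · obtain ⟨rfl, rfl⟩ := h2
        by_cases h3 : f = e
        · subst h3; exact S8 _ _ h
        by_cases h4 : f = l1
        · subst h4; exact MonPrefixAutomatic.swap (G1_4 _ _ _ _ _ (Ne.symm h) (by grind))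
        · exact MonPrefixAutomatic.swap (G0_3 _ _ _ _ (Ne.symm h3) (by simp) (by simpa using Ne.symm h4)
            (by simp [List.cons_prefix_cons]; grind) (by simp; grind))
      · exact G1_4 _ _ _ _ _ h h2
    · by_cases h2 : d = l2 ∧ e = l3
      · obtain ⟨rfl, rfl⟩ := h2
        exact G2 _ _ _ [f] h hd (Or.inr ⟨_, rfl⟩)
      · by_cases h3 : [d, e, f] = [l1, l2, l3]
        · rw [h3]; exact F0 _
        · exact G0_3 _ _ _ _ h (by simp) (by simpa using hd) (by simp [List.cons_prefix_cons]; grind) h3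

theorem V3 [Finite α] (x y : α) (r : List α) (hr : r.length ≤ 3)
    (e1 : ¬ (y ≠ x ∧ r = [y, x])) :
    MonPrefixAutomatic {([x, y, x], r)} := by
  match r, hr with
  | [], _ =>
    by_cases h : y = x
    · subst h; exact famP3 _ _ (by simp)
    · exact S1 _ _ (Ne.symm h)
  | [d], _ =>
    by_cases h : y = x
    · subst h
      by_cases hd : d = y
      · subst hd; exact famP3 _ _ (by simp)
      · exact famA3 _ _ (by simp) (by simpa using Ne.symm hd)
    · by_cases hd : d = x
      · subst hd; exact G1' _ _ (Ne.symm h) [] (Or.inl rfl)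
      · exact famB _ _ (Ne.symm h) _ (by simp) (by simpa using Ne.symm hd)
  | [d, e], _ =>
    by_cases h : y = x
    · subst h
      by_cases hd : d = y
      · subst hd
        by_cases he : e = d
        · subst he; exact famP3 _ _ (by simp)
        · refine MonPrefixAutomatic.swap (G0_2 _ _ _ (Ne.symm he) (by simp) (by simpa using Ne.symm he) ?_)
          intro hi
          rcases infix2 hi (by simp) with h | ⟨x, h⟩ | ⟨x, h⟩ <;> simp at h <;> grind
      · by_cases he : e = y
        · subst he; exact S3 _ _ (Ne.symm hd)
        · exact famA3 _ _ (by simp) (by simp; grind)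
    · by_cases hd : d = x
      · subst hd
        by_cases he : e = d
        · subst he; exact S6 _ _ (Ne.symm h)
        · by_cases he' : e = y
          · subst he'; exact S4 _ _ (Ne.symm h)
          · refine MonPrefixAutomatic.swap (G0_2 _ _ _ (Ne.symm he) (by simp) (by simpa using Ne.symm he) ?_)
            intro hi
            rcases infix2 hi (by simp) with h | ⟨x, h⟩ | ⟨x, h⟩ <;> simp at h <;> grind
      · by_cases he : e = x
        · subst he
          by_cases hd' : d = y
          · subst hd'; exact absurd ⟨h, rfl⟩ e1
          · exact S5 _ _ _ (Ne.symm h) (Ne.symm hd) (Ne.symm hd')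
        · exact famB _ _ (Ne.symm h) _ (by simp) (by simp; grind)
  | [d, e, f], _ =>
    by_cases hdf : d = f
    swap
    · exact MonPrefixAutomatic.swap (N3 _ _ _ _ hdf (by simp) (by simp) (by simp))
    subst hdf
    by_cases hxd : x = d
    · subst hxd
      by_cases hye : y = e
      · subst hye; exact F0 _
      · by_cases hy : y = x
        · subst hy
          exact MonPrefixAutomatic.swap (G1' _ _ hye [y, y] (Or.inr ⟨_, hye, rfl⟩))
        · exact G1' _ _ (Ne.symm hy) [x, e] (Or.inr ⟨_, Ne.symm hye, rfl⟩)
    · by_cases hex : e = x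
      · subst hex
        by_cases hyd : y = d
        · subst hyd; exact O5 _ _ hxd
        · exact MonPrefixAutomatic.swap (famB _ _ (Ne.symm hxd) _ (by simp) (by simp; grind))
      · by_cases hy : y = x
        · subst hy; exact famA3 _ _ (by simp) (by simp; grind)
        · exact famB _ _ (Ne.symm hy) _ (by simp) (by simp; grind)

theorem POS [Finite α] (u v : List α) (hvu : v.length ≤ u.length) (hu3 : u.length ≤ 3)
    (hb : ¬ ∃ a b : α, a ≠ b ∧ ((u = [a, b, a] ∧ v = [b, a]) ∨ (u = [a, a, b] ∧ v = [b, a]) ∨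
      (u = [a, b, b] ∧ v = [b, b]))) : MonPrefixAutomatic {(u, v)} := by
  match u, hu3 with
  | [], _ =>
    have : v = [] := by simpa using hvu
    subst this; exact F0 _
  | [x], _ =>
    match v, hvu with
    | [], _ => exact G0_1 _ _ (by simp)
    | [y], _ =>
      by_cases h : x = y
      · subst h; exact F0 _
      · exact G0_1 _ _ (by simpa using h)
  | [x, y], _ =>
    match v, hvu with
    | [], _ =>
      by_cases h : x = y
      · subst h; exact famP2 _ _ (by simp)
      · refine G0_2 _ _ _ h (by simp) (by simp) (by simp)
    | [z], _ =>
      by_cases h : x = y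
      · subst h
        by_cases hz : z = x
        · subst hz; exact famP2 _ _ (by simp)
        · exact famA2 _ _ (by simp) (by simpa using Ne.symm hz)
      · by_cases hz : z = y
        · subst hz; exact G1_1 _ _ h
        · refine G0_2 _ _ _ h (by simp) (by simpa using hz) ?_
          intro hi
          rcases infix2 hi (by simp) with h | ⟨x, h⟩ | ⟨x, h⟩ <;> simp at h
    | [z, t], _ =>
      by_cases he : [x, y] = [z, t]
      · rw [he]; exact F0 _
      have g : ∀ p q z t : α, [p, q] ≠ [z, t] → p ≠ q → MonPrefixAutomatic {([p, q], [z, t])} := by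
        intro p q z t he h
        by_cases hz : z = q
        · subst hz; exact G1_2 _ _ _ h
        · refine G0_2 _ _ _ h (by simp) (by simpa using hz) ?_
          intro hi
          rcases infix2 hi (by simp) with h | ⟨x, h⟩ | ⟨x, h⟩
          · exact he h.symm
          · simp at h
          · simp at h
      by_cases h : x = y
      · by_cases h' : z = t
        · subst h h'; exact famA2 _ _ (by simp) (by simp; grind)
        · exact MonPrefixAutomatic.swap (g _ _ _ _ (Ne.symm he) h')
      · exact g _ _ _ _ he h
  | [x, y, z], _ =>
    by_cases h : x = z
    · subst h
      refine V3 _ _ _ (by simpa using hvu) ?_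
      rintro ⟨h1, rfl⟩
      exact hb ⟨x, y, Ne.symm h1, by simp⟩
    · refine N3 _ _ _ _ h (by simpa using hvu) ?_ ?_
      · rintro ⟨rfl, rfl⟩
        exact hb ⟨_, _, h, by simp⟩
      · rintro ⟨rfl, rfl⟩
        exact hb ⟨_, _, h, by simp⟩
end fin

set_option linter.unusedSimpArgs false
set_option linter.unusedVariables false
set_option linter.unnecessarySeqFocus false
section neg
variable {α β : Type}

theorem WordEq.single {u v x y : List α} (h : WordEq {(u, v)} x y) (h1 : ¬ u <:+: x) (h2 : ¬ v <:+: x) : y = x := by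
  have := WordEq.inv (fun w => w = x) (fun p s => ?_) h
  · simpa using this
  · apply propext
    constructor
    · intro e; exact absurd ⟨p, s, e⟩ h1
    · intro e; exact absurd ⟨p, s, e⟩ h2

theorem gen_of_single (g : β → List α) (c : α) (x : List β) (h : expandW g x = [c]) : ∃ b, g b = [c] := by
  induction x with
  | nil => simp [expandW] at h
  | cons b x ih =>
    have e : expandW g (b :: x) = g b ++ expandW g x := by simp [expandW]
    rw [e] at h
    rcases List.append_eq_singleton_iff.1 h with ⟨_, h⟩ | ⟨h, _⟩
    · exact ih h
    · exact ⟨b, h⟩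

theorem expandW_append (g : β → List α) (x y : List β) : expandW g (x ++ y) = expandW g x ++ expandW g y := by
  simp [expandW]

theorem gbound [Finite β] (g : β → List α) : ∃ G, ∀ x, (expandW g x).length ≤ G * x.length := by
  haveI := Fintype.ofFinite β
  refine ⟨∑ b, (g b).length, fun x => ?_⟩
  induction x with
  | nil => simp [expandW]
  | cons b x ih =>
    have e : expandW g (b :: x) = g b ++ expandW g x := by simp [expandW]
    rw [e, List.length_append, List.length_cons, mul_add, mul_one]
    have : (g b).length ≤ ∑ b, (g b).length :=
      Finset.single_le_sum (f := fun b => (g b).length) (fun _ _ => Nat.zero_le _) (Finset.mem_univ b)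
    omega

def MulR (R : Set (List α × List α)) (g : β → List α) (L : Set (List β)) (c : List α) (x y : List β) : Prop :=
  x ∈ L ∧ y ∈ L ∧ WordEq R (expandW g x ++ c) (expandW g y)

theorem MulR.rr {R : Set (List α × List α)} {g : β → List α} {L : Set (List β)} (h : MonAutoStruct R g L) (b : β) :
    RR (MulR R g L (g b)) := by
  have := h.mul_reg b
  unfold RR
  convert this using 1
  ext p
  constructor
  · rintro ⟨x, y, ⟨hx, hy, h⟩, rfl⟩; exact ⟨x, hx, y, hy, h, rfl⟩
  · rintro ⟨x, hx, y, hy, h, rfl⟩; exact ⟨x, y, ⟨hx, hy, h⟩, rfl⟩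

open Classical in
theorem NA1 (u v : List α) (a b c : α) (hab : a ≠ b) (z Y : ℕ → List α)
    (hz : ∀ n m, (z n).count b = (z m).count b → n = m) (huv : u.count b = v.count b)
    (h1 : ∀ k n w, WordEq {(u, v)} (List.replicate k a ++ z n) w → w = List.replicate k a ++ z n)
    (h2 : ∀ w, WordEq {(u, v)} [c] w → w = [c])
    (hY : ∀ k n, WordEq {(u, v)} (List.replicate k a ++ z n ++ [c]) (Y n)) :
    ¬ MonAutomatic {(u, v)} := by
  rintro ⟨β, _, g, L, hL⟩
  obtain ⟨x, _, hx⟩ := hL.onto [c]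
  obtain ⟨b0, hb0⟩ := gen_of_single g c x (h2 _ hx.symm')
  have hrr := MulR.rr hL b0
  rw [hb0] at hrr
  obtain ⟨σ, _, M, hM⟩ := hrr.dfa
  obtain ⟨G, hG⟩ := gbound g
  choose y hyL hy using fun n => hL.onto (Y n)
  choose x hxL hx using fun n => hL.onto (List.replicate (G * (y n).length + 1) a ++ z n)
  have hx' : ∀ n, expandW g (x n) = List.replicate (G * (y n).length + 1) a ++ z n := fun n => h1 _ _ _ (hx n).symm'
  have hlen : ∀ n, (y n).length ≤ (x n).length := by
    intro n
    have e1 := hG (x n)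
    rw [hx', List.length_append, List.length_replicate] at e1
    by_contra h
    have := Nat.mul_le_mul_left G (Nat.le_of_lt (not_le.1 h))
    omega
  have hxy : ∀ n, MulR {(u, v)} g L [c] (x n) (y n) := by
    intro n
    refine ⟨hxL n, hyL n, ?_⟩
    rw [hx']
    exact (hY _ n).trans' (hy n).symm'
  have hcnt : ∀ {p q : List α}, WordEq {(u, v)} p q → p.count b = q.count b := by
    intro p q h
    exact WordEq.inv (fun w => w.count b) (fun p s => by simp [huv]) h
  let q : ℕ → σ := fun n => M.evalFrom M.start (padR ((x n).take (y n).length) (y n))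
  have hc0 : ∀ n, (expandW g ((x n).take (y n).length)).count b = 0 := by
    intro n
    have e1 := hG ((x n).take (y n).length)
    rw [List.length_take, min_eq_left (hlen n)] at e1
    have e2 : expandW g ((x n).take (y n).length) ++ expandW g ((x n).drop (y n).length) =
        List.replicate (G * (y n).length + 1) a ++ z n := by
      rw [← expandW_append, List.take_append_drop, hx']
    have e3 : expandW g ((x n).take (y n).length) <+: List.replicate (G * (y n).length + 1) a := by
      refine List.prefix_of_prefix_length_le ⟨_, e2⟩ ⟨_, rfl⟩ ?_
      rw [List.length_replicate]; omega
    rw [List.count_eq_zero]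
    intro hmem
    exact hab.symm (List.eq_of_mem_replicate (e3.subset hmem))
  obtain ⟨n, m, hnm, hq⟩ := Finite.exists_ne_map_eq_of_infinite q
  have hsplit : ∀ n, padR (x n) (y n) = padR ((x n).take (y n).length) (y n) ++ padR ((x n).drop (y n).length) [] := by
    intro n
    rw [← padR_append _ _ _ _ (by rw [List.length_take, min_eq_left (hlen n)]), List.take_append_drop, List.append_nil]
  have hm := (hM _ _).1 (hxy m)
  rw [hsplit, DFA.evalFrom_of_append] at hm
  have hmix : MulR {(u, v)} g L [c] ((x n).take (y n).length ++ (x m).drop (y m).length) (y n) := by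
    rw [hM]
    have : padR ((x n).take (y n).length ++ (x m).drop (y m).length) (y n) =
        padR ((x n).take (y n).length) (y n) ++ padR ((x m).drop (y m).length) [] := by
      rw [← padR_append _ _ _ _ (by rw [List.length_take, min_eq_left (hlen n)]), List.append_nil]
    rw [this, DFA.evalFrom_of_append]
    have hq' : M.evalFrom M.start (padR ((x n).take (y n).length) (y n)) =
      M.evalFrom M.start (padR ((x m).take (y m).length) (y m)) := hq
    rw [hq']; exact hm
  have e1 := hcnt (hmix.2.2.trans' (hxy n).2.2.symm')
  rw [expandW_append, List.count_append, List.count_append, List.count_append, hc0, hx'] at e1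
  have e2 : (expandW g (x m)).count b = (expandW g ((x m).drop (y m).length)).count b := by
    conv_lhs => rw [← List.take_append_drop (y m).length (x m), expandW_append, List.count_append, hc0]
    simp
  rw [hx'] at e2
  have hr0 : ∀ k, (List.replicate k a).count b = 0 := by
    intro k; rw [List.count_eq_zero]; intro h; exact hab.symm (List.eq_of_mem_replicate h)
  rw [List.count_append, hr0] at e1 e2
  exact hnm (hz _ _ (by omega))

theorem infix_cons2 {p q x : α} {l : List α} (h : [p, q] <:+: x :: l) : (p = x ∧ [q] <+: l) ∨ [p, q] <:+: l := by
  rcases List.infix_cons_iff.1 h with h | h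
  · rw [List.cons_prefix_cons] at h; exact Or.inl h
  · exact Or.inr h

theorem neg1 (a b : α) (hab : a ≠ b) : ¬ MonAutomatic {([a, b, a], [b, a])} := by
  classical
  have hi : ∀ w : List α, ¬ [b, a] <:+: w → ¬ [a, b, a] <:+: w := fun w h h' =>
    h (List.IsInfix.trans ⟨[a], [], rfl⟩ h')
  have hb : ∀ k n, ¬ [b, a] <:+: List.replicate k a ++ List.replicate n b := by
    intro k n
    induction k with
    | zero =>
      intro h
      exact hab (List.eq_of_mem_replicate (h.subset (by simp : a ∈ [b, a])))
    | succ k ih =>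
      intro h
      rw [List.replicate_succ, List.cons_append] at h
      rcases infix_cons2 h with ⟨h, _⟩ | h
      · exact hab h.symm
      · exact ih h
  refine NA1 _ _ a b a hab (fun n => List.replicate (n+1) b) (fun n => List.replicate (n+1) b ++ [a]) ?_ ?_ ?_ ?_ ?_
  · intro n m h; simpa using h
  · simp [hab, hab.symm]
  · intro k n w h
    exact h.single (hi _ (hb _ _)) (hb _ _)
  · intro w h
    have : ¬ [b, a] <:+: [a] := by intro h; simpa using h.length_le
    exact h.single (hi _ this) this
  · intro k n
    have hr := toQ_rel [a, b, a] [b, a]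
    generalize hR : ({([a, b, a], [b, a])} : Set (List α × List α)) = R at hr ⊢
    rw [← toQ_eq]
    simp only [toQ_cons_s, toQ_nil_s, mul_one] at hr
    have h1 : ∀ n, el R a * toQ R (List.replicate (n+1) b ++ [a]) = toQ R (List.replicate (n+1) b ++ [a]) := by
      intro n
      induction n with
      | zero => simpa using hr
      | succ n ih =>
        rw [List.replicate_succ, List.cons_append, toQ_cons_s]
        rw [← ih, ← mul_assoc, ← mul_assoc, mul_assoc (el R a), ← mul_assoc (el R b), ← mul_assoc (el R a), ← hr]
        simp only [← mul_assoc] at hr ⊢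
    induction k with
    | zero => rfl
    | succ k ih =>
      rw [List.replicate_succ, List.cons_append, List.cons_append, toQ_cons_s, ih, h1]

theorem neg2 (a b : α) (hab : a ≠ b) : ¬ MonAutomatic {([a, b, b], [b, b])} := by
  classical
  have hi : ∀ w : List α, ¬ [b, b] <:+: w → ¬ [a, b, b] <:+: w := fun w h h' =>
    h (List.IsInfix.trans ⟨[a], [], rfl⟩ h')
  have h0 : ¬ [b, b] <:+: [b] := by intro h; simpa using h.length_le
  have hz : ∀ n, ¬ [b, b] <:+: pw [b, a] n ++ [b] := by
    intro n
    induction n with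
    | zero => exact h0
    | succ n ih =>
      intro h
      have e : pw [b, a] (n+1) ++ [b] = b :: a :: (pw [b, a] n ++ [b]) := rfl
      rw [e] at h
      rcases infix_cons2 h with ⟨_, h⟩ | h
      · simp [List.cons_prefix_cons, hab.symm] at h
      · rcases infix_cons2 h with ⟨h, _⟩ | h
        · exact hab h.symm
        · exact ih h
  have hb : ∀ k n, ¬ [b, b] <:+: List.replicate k a ++ (pw [b, a] n ++ [b]) := by
    intro k n
    induction k with
    | zero => exact hz n
    | succ k ih =>
      intro h
      rw [List.replicate_succ, List.cons_append] at h
      rcases infix_cons2 h with ⟨h, _⟩ | h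
      · exact hab h.symm
      · exact ih h
  refine NA1 _ _ a b b hab (fun n => pw [b, a] n ++ [b]) (fun n => List.replicate (n+2) b) ?_ ?_ ?_ ?_ ?_
  · have : ∀ n, (pw [b, a] n ++ [b]).count b = n + 1 := by
      intro n
      induction n with
      | zero => simp [pw]
      | succ n ih =>
        have e : pw [b, a] (n+1) ++ [b] = b :: a :: (pw [b, a] n ++ [b]) := rfl
        rw [e]
        rw [List.count_cons_self, List.count_cons_of_ne hab, ih]
    intro n m h
    simp only [this] at h; omega
  · simp [hab, hab.symm]
  · intro k n w h
    exact h.single (hi _ (hb _ _)) (hb _ _)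
  · intro w h
    exact h.single (hi _ h0) h0
  · intro k n
    have hr := toQ_rel [a, b, b] [b, b]
    generalize hR : ({([a, b, b], [b, b])} : Set (List α × List α)) = R at hr ⊢
    rw [← toQ_eq]
    simp only [toQ_cons_s, toQ_nil_s, mul_one] at hr
    have h1 : ∀ n, el R a * toQ R (List.replicate (n+2) b) = toQ R (List.replicate (n+2) b) := by
      intro n
      rw [List.replicate_succ, List.replicate_succ, toQ_cons_s, toQ_cons_s, ← mul_assoc (el R b), ← mul_assoc, hr]
    have h2 : toQ R (pw [b, a] n ++ [b] ++ [b]) = toQ R (List.replicate (n+2) b) := by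
      induction n with
      | zero => rfl
      | succ n ih =>
        have e : pw [b, a] (n+1) ++ [b] ++ [b] = b :: a :: (pw [b, a] n ++ [b] ++ [b]) := rfl
        rw [e, toQ_cons_s, toQ_cons_s, ih, h1]; rfl
    induction k with
    | zero => exact h2
    | succ k ih =>
      rw [List.replicate_succ, List.cons_append, List.cons_append, toQ_cons_s, ih, h1]

theorem len_bound {ρ : List β → List β → Prop} (h : RR ρ) :
    ∃ C, ∀ x y, ρ x y → ∃ y', ρ x y' ∧ y'.length ≤ x.length + C := by
  obtain ⟨σ, _, M, hM⟩ := h.dfa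
  refine ⟨Fintype.card σ, fun x y hxy => ?_⟩
  induction hn : y.length using Nat.strong_induction_on generalizing y with
  | _ n ih =>
    by_cases hl : y.length ≤ x.length + Fintype.card σ
    · exact ⟨y, hxy, hl⟩
    push Not at hl
    have key : ∀ y2 : List β, padR ([] : List β) y2 = y2.map (fun b => (none, some b)) := by
      intro y2; induction y2 <;> simp_all
    have sp : ∀ y2, padR x (y.take x.length ++ y2) = padR x (y.take x.length) ++ padR [] y2 := by
      intro y2
      rw [← padR_append _ _ _ _ (by rw [List.length_take]; omega), List.append_nil]
    have h1 := (hM _ _).1 hxy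
    rw [← List.take_append_drop x.length y, sp, DFA.evalFrom_of_append, key] at h1
    generalize hq : M.evalFrom M.start (padR x (y.take x.length)) = q at h1
    rw [← DFA.evalFrom_comap] at h1
    obtain ⟨q', p1, p2, p3, e, _, hne, e1, e2, e3⟩ := DFA.evalFrom_split
      (M.comap (fun b : β => ((none, some b) : Option β × Option β))) (x := y.drop x.length) (s := q)
      (t := _) (by rw [List.length_drop]; omega) rfl
    have hlen2 : 0 < p2.length := List.length_pos_iff.2 hne
    have hlen : (y.drop x.length).length = p1.length + p2.length + p3.length := by rw [e]; simp [add_assoc]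
    rw [List.length_drop] at hlen
    refine ih (y.take x.length ++ (p1 ++ p3)).length ?_ _ ?_ rfl
    · simp only [List.length_append, List.length_take]; omega
    · rw [hM, sp, DFA.evalFrom_of_append, hq, key, ← DFA.evalFrom_comap, DFA.evalFrom_of_append, e1, e3]
      exact h1

open Classical in
/-- invariant for aab = ba -/
noncomputable def stepP (a b : α) (s : Option (ℕ × ℕ)) (c : α) : Option (ℕ × ℕ) :=
  s.bind fun p => if c = a then some (p.1 + 2 ^ p.2, p.2) else if c = b then some (p.1, p.2 + 1) else none

noncomputable def phi (a b : α) (w : List α) : Option (ℕ × ℕ) := w.foldl (stepP a b) (some (0, 0))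

theorem neg3 (a b : α) (hab : a ≠ b) : ¬ MonAutomatic {([a, a, b], [b, a])} := by
  have hr := toQ_rel [a, a, b] [b, a]
  have sa : ∀ i n, stepP a b (some (i, n)) a = some (i + 2 ^ n, n) := by intro i n; simp [stepP]
  have sb : ∀ i n, stepP a b (some (i, n)) b = some (i, n + 1) := by intro i n; simp [stepP, hab.symm]
  have s0 : ∀ c, stepP a b none c = none := by intro c; simp [stepP]
  have hinv : ∀ {x y}, WordEq {([a, a, b], [b, a])} x y → phi a b x = phi a b y := by
    intro x y h
    refine WordEq.inv (phi a b) (fun p s => ?_) h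
    simp only [phi, List.foldl_append]
    congr 1
    simp only [List.foldl_cons, List.foldl_nil]
    rcases List.foldl (stepP a b) (some (0, 0)) p with _ | ⟨i, n⟩
    · simp [s0]
    · simp only [sa, sb]
      congr 2
      ring
  have hsing1 : ∀ {x w : List α}, ¬ [a, a, b] <:+: x → ¬ [b, a] <:+: x →
      WordEq {([a, a, b], [b, a])} w x → w = x := fun h1 h2 h => h.symm'.single h1 h2
  have pa : ∀ k, phi a b (List.replicate k a) = some (k, 0) := by
    intro k
    induction k with
    | zero => rfl
    | succ k ih =>
      rw [List.replicate_succ', phi, List.foldl_append]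
      change stepP a b (phi a b _) a = _
      rw [ih, sa]; rfl
  have pab : ∀ k n, phi a b (List.replicate k a ++ List.replicate n b) = some (k, n) := by
    intro k n
    induction n with
    | zero => simpa using pa k
    | succ n ih =>
      rw [List.replicate_succ', ← List.append_assoc, phi, List.foldl_append]
      change stepP a b (phi a b _) b = _
      rw [ih, sb]
  have pb : ∀ n m, phi a b (List.replicate n b ++ List.replicate m a) = some (m * 2 ^ n, n) := by
    intro n m
    induction m with
    | zero => simpa using pab 0 n
    | succ m ih =>
      rw [List.replicate_succ', ← List.append_assoc, phi, List.foldl_append]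
      change stepP a b (phi a b _) a = _
      rw [ih, sa]; congr 2; ring
  have hnf : ∀ w k n, phi a b w = some (k, n) →
      WordEq {([a, a, b], [b, a])} w (List.replicate k a ++ List.replicate n b) := by
    generalize hR : ({([a, a, b], [b, a])} : Set (List α × List α)) = R at hr ⊢
    simp only [toQ_cons_s, toQ_nil_s, mul_one] at hr
    have trep : ∀ (c : α) k, toQ R (List.replicate k c) = el R c ^ k := by
      intro c k
      induction k with
      | zero => rfl
      | succ k ih => rw [List.replicate_succ, toQ_cons_s, ih, pow_succ']
    have hc : ∀ n, el R b ^ n * el R a = el R a ^ (2 ^ n) * el R b ^ n := by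
      intro n
      induction n with
      | zero => simp
      | succ n ih =>
        calc el R b ^ (n+1) * el R a = el R b ^ n * (el R b * el R a) := by rw [pow_succ, mul_assoc]
          _ = (el R b ^ n * el R a) * (el R a * el R b) := by rw [← hr]; simp only [mul_assoc]
          _ = el R a ^ (2 ^ n) * (el R b ^ n * el R a) * el R b := by rw [ih]; simp only [mul_assoc]; rw [← mul_assoc (el R b ^ n), ih]; simp only [mul_assoc]
          _ = el R a ^ (2 ^ (n+1)) * el R b ^ (n+1) := by
            rw [ih, pow_succ 2 n, mul_two, pow_add, pow_succ]; simp only [mul_assoc]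
    intro w
    induction w using List.reverseRecOn with
    | nil =>
      intro k n h
      simp [phi] at h
      obtain ⟨rfl, rfl⟩ := h
      exact WordEq.refl' _ _
    | append_singleton w c ih =>
      intro k n h
      rw [phi, List.foldl_append] at h
      change stepP a b (phi a b w) c = _ at h
      rcases hp : phi a b w with _ | ⟨i, m⟩
      · rw [hp, s0] at h; simp at h
      · have := ih i m hp
        rw [← toQ_eq] at this ⊢
        rw [toQ_append, this]
        rw [hp] at h
        simp only [toQ_append, trep]
        by_cases h1 : c = a
        · subst h1
          rw [sa] at h
          simp at h
          obtain ⟨rfl, rfl⟩ := h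
          have e : toQ R [c] = el R c := rfl
          rw [e, mul_assoc, hc, pow_add, mul_assoc]
        · by_cases h2 : c = b
          · subst h2
            rw [sb] at h
            simp at h
            obtain ⟨rfl, rfl⟩ := h
            have e : toQ R [c] = el R c := rfl
            rw [e, pow_succ, mul_assoc]
          · simp [stepP, h1, h2] at h
  rintro ⟨β, _, g, L, hL⟩
  obtain ⟨ba, hba⟩ : ∃ c, g c = [a] := by
    obtain ⟨x, _, hx⟩ := hL.onto [a]
    refine gen_of_single g a x (hsing1 ?_ ?_ hx) <;> intro h <;> simpa using h.length_le
  obtain ⟨bb, hbb⟩ : ∃ c, g c = [b] := by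
    obtain ⟨x, _, hx⟩ := hL.onto [b]
    refine gen_of_single g b x (hsing1 ?_ ?_ hx) <;> intro h <;> simpa using h.length_le
  have hA := MulR.rr hL ba
  have hB := MulR.rr hL bb
  rw [hba] at hA
  rw [hbb] at hB
  obtain ⟨C, hC⟩ := len_bound hA
  obtain ⟨D, hD⟩ := len_bound hB.swap
  obtain ⟨G, hG⟩ := gbound g
  have c2 : ∀ n k x, x ∈ L → WordEq {([a, a, b], [b, a])} (expandW g x) (List.replicate k a ++ List.replicate n b) →
      k ≤ G * (x.length + D * n) := by
    intro n
    induction n with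
    | zero =>
      intro k x hx h
      simp only [List.replicate_zero, List.append_nil] at h
      have hb : b ∉ List.replicate k a := fun h => hab.symm (List.eq_of_mem_replicate h)
      have := hsing1 (fun h => hb (h.subset (by simp))) (fun h => hb (h.subset (by simp))) h
      have h2 := hG x
      rw [this, List.length_replicate] at h2
      simpa using h2
    | succ n ih =>
      intro k x hx h
      obtain ⟨x1, hx1, h1⟩ := hL.onto (List.replicate k a ++ List.replicate n b)
      obtain ⟨x', hx', hl⟩ := hD x x1 ⟨hx1, hx, by
        have := h1.app [] [b]
        rw [List.nil_append, List.nil_append, List.append_assoc, ← List.replicate_succ'] at this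
        exact this.trans' h.symm'⟩
      have h3 : phi a b (expandW g x' ++ [b]) = some (k, n+1) := by
        rw [hinv (hx'.2.2.trans' h), pab]
      rw [phi, List.foldl_append] at h3
      change stepP a b (phi a b _) b = _ at h3
      have h4 : phi a b (expandW g x') = some (k, n) := by
        rcases hp : phi a b (expandW g x') with _ | ⟨i, m⟩
        · rw [hp, s0] at h3; simp at h3
        · rw [hp, sb] at h3; simpa using h3
      have h5 := ih k x' hx'.1 (hnf _ _ _ h4)
      refine h5.trans (Nat.mul_le_mul_left _ ?_)
      rw [mul_add]; omega
  obtain ⟨x0, hx0, h0⟩ := hL.onto (List.replicate (G * C) b)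
  have c1 : ∀ m, ∃ x ∈ L, WordEq {([a, a, b], [b, a])} (expandW g x) (List.replicate (G * C) b ++ List.replicate m a) ∧
      x.length ≤ x0.length + C * m := by
    intro m
    induction m with
    | zero => exact ⟨x0, hx0, by simpa using h0, by simp⟩
    | succ m ih =>
      obtain ⟨x, hx, h, hl⟩ := ih
      have h1 := h.app [] [a]
      rw [List.nil_append, List.nil_append, List.append_assoc, ← List.replicate_succ'] at h1
      obtain ⟨y, hy, hyx⟩ := hL.onto (List.replicate (G * C) b ++ List.replicate (m + 1) a)
      obtain ⟨y', hy', hl'⟩ := hC x y ⟨hx, hy, h1.trans' hyx.symm'⟩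
      refine ⟨y', hy'.2.1, hy'.2.2.symm'.trans' h1, ?_⟩
      rw [mul_add]; omega
  obtain ⟨x, hx, h, hl⟩ := c1 (G * (x0.length + D * (G * C)) + 1)
  have h1 := c2 _ _ x hx (hnf _ _ _ ((hinv h).trans (pb _ _)))
  have h2 : G * C + 1 ≤ 2 ^ (G * C) := Nat.lt_two_pow_self
  set m := G * (x0.length + D * (G * C)) + 1 with hm
  have h3 : m * (G * C + 1) ≤ G * (x0.length + C * m + D * (G * C)) :=
    (Nat.mul_le_mul_left m h2).trans (h1.trans (Nat.mul_le_mul_left _ (by omega)))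
  have h4 : G * (x0.length + C * m + D * (G * C)) = G * (x0.length + D * (G * C)) + m * (G * C) := by ring
  have h5 : m * (G * C + 1) = m * (G * C) + m := by ring
  omega
end neg

/-- let `S = sgp⟨α ∣ u = v⟩` be a one-relator monoid with
`|α| = n ≥ 2` and `|v| ≤ |u| ≤ 3`.  If the relation is not of the form
`aba = ba`, `aab = ba` or `abb = bb` for distinct letters `a, b`, then `S` is
prefix-automatic; if it is of one of these forms, `S` is not automatic. -/
theorem statement_11 {α : Type} [Fintype α] (hcard : 2 ≤ Fintype.card α)
    (u v : List α) (hvu : v.length ≤ u.length) (hu3 : u.length ≤ 3)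
    (R : Set (List α × List α)) (hRdef : R = {(u, v)}) :
    ((¬ ∃ a b : α, a ≠ b ∧
        ((u = [a, b, a] ∧ v = [b, a]) ∨ (u = [a, a, b] ∧ v = [b, a]) ∨
          (u = [a, b, b] ∧ v = [b, b]))) → MonPrefixAutomatic R) ∧
    ((∃ a b : α, a ≠ b ∧
        ((u = [a, b, a] ∧ v = [b, a]) ∨ (u = [a, a, b] ∧ v = [b, a]) ∨
          (u = [a, b, b] ∧ v = [b, b]))) → ¬ MonAutomatic R) := by
  subst hRdef
  refine ⟨fun h => POS u v hvu hu3 h, ?_⟩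
  rintro ⟨a, b, hab, (⟨rfl, rfl⟩ | ⟨rfl, rfl⟩ | ⟨rfl, rfl⟩)⟩
  exacts [neg1 a b hab, neg3 a b hab, neg2 a b hab]
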